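/- arXiv:1811.11240 — 3 statements merged into one kernel-verified Lean document; each statement's English description precedes it below -/
import Mathlib

section
/- Let 0 < α < 2 and let q : (0,∞) → ℝ be a locally integrable potential such that a := limsup_{x→∞} x^{1-α/2}|q(x)| is finite. Then the set P of energies E ∈ ℝ for which the equation -u''(x) - x^α u(x) + q(x)u(x) = E u(x) has a nonzero square-integrable solution on (0,∞) is finite, and a ≥ ((2-α)/√2) · (card P)^{1/2}; equivalently, card P ≤ 2a²/(2-α)². -/
open Filter MeasureTheory Set
open scoped Topology

/-- `f` agrees, up to an error `o(1/x)`, with the derivative of a function that tends to `0`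
at infinity. -/
def Negligible (f : ℝ → ℝ) : Prop :=
  ∃ G G' : ℝ → ℝ, (∀ᶠ x in atTop, HasDerivAt G (G' x) x) ∧ Tendsto G atTop (𝓝 0) ∧
    Tendsto (fun x => x * (f x - G' x)) atTop (𝓝 0)

namespace Negligible

theorem of_tendsto {f : ℝ → ℝ} (h : Tendsto (fun x => x * f x) atTop (𝓝 0)) : Negligible f :=
  ⟨fun _ => 0, fun _ => 0, Eventually.of_forall fun x => hasDerivAt_const x 0,
    tendsto_const_nhds, by simpa using h⟩

theorem congr {f g : ℝ → ℝ} (hf : Negligible f) (h : f =ᶠ[atTop] g) : Negligible g := by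
  obtain ⟨G, G', h1, h2, h3⟩ := hf
  refine ⟨G, G', h1, h2, h3.congr' ?_⟩
  filter_upwards [h] with x hx
  rw [hx]

theorem add {f g : ℝ → ℝ} (hf : Negligible f) (hg : Negligible g) :
    Negligible (fun x => f x + g x) := by
  obtain ⟨F, F', h1, h2, h3⟩ := hf
  obtain ⟨G, G', k1, k2, k3⟩ := hg
  refine ⟨fun x => F x + G x, fun x => F' x + G' x, ?_, by simpa using h2.add k2, ?_⟩
  · filter_upwards [h1, k1] with x hx kx using hx.add kx
  · have := h3.add k3
    rw [add_zero] at this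
    exact this.congr fun x => by ring

theorem const_mul {f : ℝ → ℝ} (c : ℝ) (hf : Negligible f) : Negligible (fun x => c * f x) := by
  obtain ⟨F, F', h1, h2, h3⟩ := hf
  refine ⟨fun x => c * F x, fun x => c * F' x, ?_, by simpa using h2.const_mul c, ?_⟩
  · filter_upwards [h1] with x hx using hx.const_mul c
  · have := h3.const_mul c
    rw [mul_zero] at this
    exact this.congr fun x => by ring

theorem sum {ι : Type*} (s : Finset ι) {f : ι → ℝ → ℝ} (hf : ∀ i, Negligible (f i)) :
    Negligible (fun x => ∑ i ∈ s, f i x) := by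
  classical
  induction s using Finset.induction_on with
  | empty => exact of_tendsto (by simp)
  | insert a s ha ih =>
    simp only [Finset.sum_insert ha]
    exact (hf a).add ih

/-- Non-stationary phase: a function with phase derivative `ω + O(1/x)` is negligible with respect
to `dx/x` as soon as `x ω` is large. -/
theorem of_oscillating {C S ω b g : ℝ → ℝ} {K : ℝ}
    (hS : ∀ᶠ x in atTop, HasDerivAt S ((ω x + b x) * C x) x)
    (hC1 : ∀ᶠ x in atTop, |C x| ≤ 1) (hS1 : ∀ᶠ x in atTop, |S x| ≤ 1)
    (hb : ∀ᶠ x in atTop, |x * b x| ≤ K)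
    (hω : ∀ᶠ x in atTop, HasDerivAt ω (g x * ω x / x) x)
    (hg : ∀ᶠ x in atTop, |g x| ≤ K)
    (hinf : Tendsto (fun x => |x * ω x|) atTop atTop) :
    Negligible (fun x => C x / x) := by
  have hinv : Tendsto (fun x => |x * ω x|⁻¹) atTop (𝓝 0) := tendsto_inv_atTop_zero.comp hinf
  refine ⟨fun x => S x / (x * ω x), fun x => C x / x + b x * C x / (x * ω x) -
    S x * (1 + g x) / (x * (x * ω x)), ?_, ?_, ?_⟩
  · filter_upwards [hS, hω, hinf.eventually_gt_atTop 0, eventually_gt_atTop 0]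
      with x h1 h2 h3 hx
    have h0 : x * ω x ≠ 0 := abs_pos.1 h3
    have h0' : ω x ≠ 0 := right_ne_zero_of_mul h0
    refine (h1.fun_div ((hasDerivAt_id' x).fun_mul h2) h0).congr_deriv ?_
    field_simp
  · refine squeeze_zero_norm' ?_ hinv
    filter_upwards [hS1] with x h1
    rw [Real.norm_eq_abs, abs_div, div_eq_mul_inv]
    exact mul_le_of_le_one_left (by positivity) h1
  · refine squeeze_zero_norm' (a := fun x => (K + (1 + K)) * |x * ω x|⁻¹) ?_
      (by simpa using hinv.const_mul (K + (1 + K)))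
    filter_upwards [hC1, hS1, hb, hg, hinf.eventually_gt_atTop 0, eventually_gt_atTop 0]
      with x h1 h2 h3 h4 h5 hx
    have h0 : x * ω x ≠ 0 := abs_pos.1 h5
    have h0' : ω x ≠ 0 := right_ne_zero_of_mul h0
    have e : x * (C x / x - (C x / x + b x * C x / (x * ω x) -
        S x * (1 + g x) / (x * (x * ω x)))) =
        (S x * (1 + g x) - (x * b x) * C x) * (x * ω x)⁻¹ := by
      field_simp
      ring
    rw [e, Real.norm_eq_abs, abs_mul, abs_inv]
    gcongr
    have e1 : |x * b x * C x| ≤ K := by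
      rw [abs_mul]
      nlinarith [abs_nonneg (x * b x), abs_nonneg (C x)]
    have e2 : |S x * (1 + g x)| ≤ 1 + K := by
      rw [abs_mul]
      have : |1 + g x| ≤ 1 + K := (abs_add_le _ _).trans (by simpa using h4)
      nlinarith [abs_nonneg (1 + g x), abs_nonneg (S x)]
    exact (abs_sub _ _).trans (by linarith)

end Negligible

theorem eventually_ge_of_deriv_nonneg {F F' : ℝ → ℝ}
    (hF : ∀ᶠ x in atTop, HasDerivAt F (F' x) x) (h0 : ∀ᶠ x in atTop, 0 ≤ F' x) :
    ∃ K, ∀ᶠ x in atTop, K ≤ F x := by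
  obtain ⟨a, ha⟩ := eventually_atTop.1 (hF.and h0)
  have hm : MonotoneOn F (Ici a) := by
    refine monotoneOn_of_deriv_nonneg (convex_Ici a)
      (fun x hx => (ha x hx).1.continuousAt.continuousWithinAt) ?_ ?_
    · intro x hx
      rw [interior_Ici] at hx
      exact (ha x (le_of_lt hx)).1.differentiableAt.differentiableWithinAt
    · intro x hx
      rw [interior_Ici] at hx
      rw [(ha x (le_of_lt hx)).1.deriv]
      exact (ha x (le_of_lt hx)).2
  refine ⟨F a, ?_⟩
  filter_upwards [eventually_ge_atTop a] with x hx using hm self_mem_Ici hx hx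

theorem eventually_ge_log_of_deriv {L L' n : ℝ → ℝ} {c c' : ℝ} (hc : c' < c)
    (hL : ∀ᶠ x in atTop, HasDerivAt L (L' x) x) (hn : Negligible n)
    (h : ∀ᶠ x in atTop, c / x + n x ≤ L' x) :
    ∃ K, ∀ᶠ x in atTop, c' * Real.log x + K ≤ L x := by
  obtain ⟨G, G', h1, h2, h3⟩ := hn
  obtain ⟨K, hK⟩ := eventually_ge_of_deriv_nonneg (F := fun x => L x - G x - c' * Real.log x)
    (F' := fun x => L' x - G' x - c' * x⁻¹)
    (by
      filter_upwards [hL, h1, eventually_ne_atTop 0] with x k1 k2 k3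
      exact (k1.sub k2).sub ((Real.hasDerivAt_log k3).const_mul c'))
    (by
      filter_upwards [h, h3.eventually (lt_mem_nhds (show -(c - c') < 0 by linarith)),
        eventually_gt_atTop 0] with x k1 k2 k3
      have : -(c - c') / x < n x - G' x := by
        rw [div_lt_iff₀ k3]; linarith
      have e : -(c - c') / x = c' * x⁻¹ - c / x := by ring
      linarith)
  refine ⟨K - 1, ?_⟩
  filter_upwards [hK, h2.eventually (lt_mem_nhds (show (-1:ℝ) < 0 by norm_num))] with x k1 k2
  linarith

theorem eventually_zero_of_zero {u u' u'' V : ℝ → ℝ}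
    (h1 : ∀ x ∈ Ioi (0 : ℝ), HasDerivAt u (u' x) x)
    (h2 : ∀ x ∈ Ioi (0 : ℝ), HasDerivAt u' (u'' x) x)
    (h3 : ∀ x ∈ Ioi (0 : ℝ), u'' x = V x * u x)
    (hV : LocallyIntegrableOn V (Ioi 0)) {c : ℝ} (hc : 0 < c) (hu : u c = 0) (hu' : u' c = 0) :
    ∀ᶠ x in 𝓝 c, u x = 0 ∧ u' x = 0 := by
  have hsub : Icc (c / 2) (2 * c) ⊆ Ioi 0 := fun x hx => lt_of_lt_of_le (by positivity) hx.1
  have hVi : IntegrableOn V (Icc (c / 2) (2 * c)) :=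
    hV.integrableOn_compact_subset hsub isCompact_Icc
  have hW : IntegrableOn (fun x => 1 + |V x|) (Icc (c / 2) (2 * c)) :=
    (integrableOn_const (by simp)).add hVi.abs
  have hWi : ∀ a ∈ Icc (c / 2) (2 * c), ∀ b ∈ Icc (c / 2) (2 * c),
      IntervalIntegrable (fun x => 1 + |V x|) volume a b := fun a ha b hb =>
    (hW.mono_set (uIcc_subset_Icc ha hb)).intervalIntegrable
  have hcI : c ∈ Icc (c / 2) (2 * c) := ⟨by linarith, by linarith⟩
  have hnhds : Icc (c / 2) (2 * c) ∈ 𝓝 c := Icc_mem_nhds (by linarith) (by linarith)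
  have hcont : ContinuousAt (fun x => ∫ t in c..x, (1 + |V t|)) c := by
    have := intervalIntegral.continuousOn_primitive_interval' (a := c)
      (hWi (c / 2) ⟨le_rfl, by linarith⟩ (2 * c) ⟨by linarith, le_rfl⟩)
      (by rw [uIcc_of_le (by linarith)]; exact hcI)
    rw [uIcc_of_le (by linarith)] at this
    exact this.continuousAt hnhds
  have hsmall : ∀ᶠ x in 𝓝 c, |∫ t in c..x, (1 + |V t|)| < 1 / 4 := by
    have := hcont.abs
    refine this.eventually_lt continuousAt_const ?_
    simp
  obtain ⟨δ, hδ, hball⟩ := Metric.nhds_basis_closedBall.eventually_iff.1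
    (hsmall.and (show ∀ᶠ x in 𝓝 c, x ∈ Icc (c / 2) (2 * c) from hnhds))
  have hconv : ∀ x ∈ Metric.closedBall c δ, uIcc c x ⊆ Metric.closedBall c δ := by
    intro x hx
    rw [Real.closedBall_eq_Icc] at hx ⊢
    exact uIcc_subset_Icc ⟨by linarith, by linarith⟩ hx
  have hpos : ∀ x ∈ Metric.closedBall c δ, x ∈ Ioi (0 : ℝ) := fun x hx => hsub (hball hx).2
  have hcu : ContinuousOn u (Metric.closedBall c δ) := fun x hx =>
    (h1 x (hpos x hx)).continuousAt.continuousWithinAt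
  have hcu' : ContinuousOn u' (Metric.closedBall c δ) := fun x hx =>
    (h2 x (hpos x hx)).continuousAt.continuousWithinAt
  obtain ⟨y, hy, hmax⟩ := (isCompact_closedBall c δ).exists_isMaxOn
    ⟨c, Metric.mem_closedBall_self hδ.le⟩ (hcu.abs.add hcu'.abs)
  set M := |u y| + |u' y| with hM
  have hM0 : 0 ≤ M := by positivity
  have hmax' : ∀ x ∈ Metric.closedBall c δ, |u x| + |u' x| ≤ M := fun x hx => hmax hx
  have hVy : IntegrableOn V (uIcc c y) := hVi.mono_set fun x hx => (hball (hconv y hy hx)).2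
  have hi1 : IntervalIntegrable u' volume c y := (hcu'.mono (hconv y hy)).intervalIntegrable
  have hi2 : IntervalIntegrable u'' volume c y := by
    refine IntegrableOn.intervalIntegrable ?_
    refine (hVy.mul_continuousOn (hcu.mono (hconv y hy)) isCompact_uIcc).congr_fun ?_
      measurableSet_uIcc
    intro x hx
    exact (h3 x (hpos x (hconv y hy hx))).symm
  have e1 : ∫ t in c..y, u' t = u y := by
    rw [intervalIntegral.integral_eq_sub_of_hasDerivAt
      (fun x hx => h1 x (hpos x (hconv y hy hx))) hi1, hu, sub_zero]
  have e2 : ∫ t in c..y, u'' t = u' y := by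
    rw [intervalIntegral.integral_eq_sub_of_hasDerivAt
      (fun x hx => h2 x (hpos x (hconv y hy hx))) hi2, hu', sub_zero]
  have hWM : IntervalIntegrable (fun x => (1 + |V x|) * M) volume c y :=
    (hWi c hcI y (hball hy).2).mul_const M
  have key : ∀ f : ℝ → ℝ, (∀ x ∈ Metric.closedBall c δ, |f x| ≤ (1 + |V x|) * M) →
      |∫ t in c..y, f t| ≤ 1 / 4 * M := by
    intro f hf
    have := intervalIntegral.norm_integral_le_abs_of_norm_le (μ := volume) (f := f)
      (a := c) (b := y) (g := fun x => (1 + |V x|) * M)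
      ((ae_restrict_iff' measurableSet_uIoc).2 (Eventually.of_forall fun x hx =>
        hf x (hconv y hy (uIoc_subset_uIcc hx)))) hWM
    rw [intervalIntegral.integral_mul_const, abs_mul, abs_of_nonneg hM0] at this
    exact this.trans (mul_le_mul_of_nonneg_right (hball hy).1.le hM0)
  have k1 := key u' fun x hx => by
    have := hmax' x hx
    nlinarith [abs_nonneg (V x), abs_nonneg (u x), mul_nonneg (abs_nonneg (V x)) hM0]
  have k2 := key u'' fun x hx => by
    rw [h3 x (hpos x hx), abs_mul]
    have := hmax' x hx
    have h5 : |u x| ≤ M := by linarith [abs_nonneg (u' x)]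
    nlinarith [mul_le_mul_of_nonneg_left h5 (abs_nonneg (V x))]
  rw [e1] at k1
  rw [e2] at k2
  have hM00 : M = 0 := by linarith
  filter_upwards [Metric.closedBall_mem_nhds c hδ] with x hx
  have := hmax' x hx
  exact ⟨abs_eq_zero.1 (by linarith [abs_nonneg (u x), abs_nonneg (u' x)]),
    abs_eq_zero.1 (by linarith [abs_nonneg (u x), abs_nonneg (u' x)])⟩

theorem eq_zero_of_zero {u u' u'' V : ℝ → ℝ}
    (h1 : ∀ x ∈ Ioi (0 : ℝ), HasDerivAt u (u' x) x)
    (h2 : ∀ x ∈ Ioi (0 : ℝ), HasDerivAt u' (u'' x) x)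
    (h3 : ∀ x ∈ Ioi (0 : ℝ), u'' x = V x * u x)
    (hV : LocallyIntegrableOn V (Ioi 0)) {c : ℝ} (hc : 0 < c) (hu : u c = 0) (hu' : u' c = 0) :
    ∀ x ∈ Ioi (0 : ℝ), u x = 0 := by
  have : Ioi (0 : ℝ) ⊆ {x | 0 < x ∧ u x = 0 ∧ u' x = 0} := by
    refine isPreconnected_Ioi.subset_of_closure_inter_subset ?_ ⟨c, hc, hc, hu, hu'⟩ ?_
    · rw [isOpen_iff_mem_nhds]
      rintro x ⟨hx, hx1, hx2⟩
      exact (lt_mem_nhds hx).and (eventually_zero_of_zero h1 h2 h3 hV hx hx1 hx2)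
    · rintro x ⟨hx, hx0⟩
      have hf : ∃ᶠ y in 𝓝 x, 0 < y ∧ u y = 0 ∧ u' y = 0 := mem_closure_iff_frequently.1 hx
      refine ⟨hx0, ?_, ?_⟩
      · by_contra h
        exact hf (((h1 x hx0).continuousAt.eventually_ne h).mono fun y hy hy' => hy hy'.2.1)
      · by_contra h
        exact hf (((h2 x hx0).continuousAt.eventually_ne h).mono fun y hy hy' => hy hy'.2.2)
  exact fun x hx => (this hx).2.1

/-- The local wave number `√(x^α + E)`. -/
noncomputable def waveNumber (α E x : ℝ) : ℝ := √(x ^ α + E)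

/-- The logarithmic derivative of `waveNumber`. -/
noncomputable def waveRate (α E x : ℝ) : ℝ := α * x ^ (α - 1) / (2 * waveNumber α E x ^ 2)

section WaveNumber

variable {α : ℝ} (E : ℝ)

theorem eventually_waveNumber (hα : 0 < α) :
    ∀ᶠ x in atTop, 0 < waveNumber α E x ∧ waveNumber α E x ^ 2 = x ^ α + E := by
  filter_upwards [(tendsto_rpow_atTop hα).eventually_gt_atTop (-E)] with x hx
  have : 0 < x ^ α + E := by linarith
  exact ⟨Real.sqrt_pos.2 this, Real.sq_sqrt this.le⟩

theorem eventually_hasDerivAt_waveNumber (hα : 0 < α) :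
    ∀ᶠ x in atTop,
      HasDerivAt (waveNumber α E) (waveRate α E x * waveNumber α E x) x := by
  filter_upwards [eventually_waveNumber E hα, (tendsto_rpow_atTop hα).eventually_gt_atTop (-E),
    eventually_gt_atTop 0] with x hx h1 h0
  refine (((Real.hasDerivAt_rpow_const (Or.inl h0.ne')).add_const E).sqrt
    (by linarith : x ^ α + E ≠ 0)).congr_deriv ?_
  have := hx.1.ne'
  rw [waveRate]
  change α * x ^ (α - 1) / (2 * waveNumber α E x) = _
  field_simp

theorem tendsto_waveNumber_div (hα : 0 < α) :
    Tendsto (fun x => waveNumber α E x / x ^ (α / 2)) atTop (𝓝 1) := by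
  have h : Tendsto (fun x : ℝ => √(1 + E * (x ^ α)⁻¹)) atTop (𝓝 √(1 + E * 0)) :=
    ((tendsto_inv_atTop_zero.comp (tendsto_rpow_atTop hα)).const_mul E).const_add 1 |>.sqrt
  simp only [mul_zero, add_zero, Real.sqrt_one] at h
  refine h.congr' ?_
  filter_upwards [eventually_gt_atTop 0] with x hx
  have hp : 0 < x ^ α := Real.rpow_pos_of_pos hx α
  have e : x ^ (α / 2) = √(x ^ α) := by
    rw [Real.sqrt_eq_rpow, ← Real.rpow_mul hx.le]; ring_nf
  rw [e, waveNumber, ← Real.sqrt_div' _ hp.le]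
  congr 1
  field_simp

theorem tendsto_mul_waveRate (hα : 0 < α) :
    Tendsto (fun x => x * waveRate α E x) atTop (𝓝 (α / 2)) := by
  have h := (((tendsto_waveNumber_div E hα).pow 2).inv₀ (by norm_num)).const_mul (α / 2)
  simp only [one_pow, inv_one, mul_one] at h
  refine h.congr' ?_
  filter_upwards [eventually_gt_atTop 0, eventually_waveNumber E hα] with x hx h1
  have hp : 0 < x ^ (α / 2) := Real.rpow_pos_of_pos hx _
  have e : x ^ (α - 1) = (x ^ (α / 2)) ^ 2 / x := by
    rw [Real.rpow_sub_one hx.ne', ← Real.rpow_natCast (x ^ (α / 2)), ← Real.rpow_mul hx.le]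
    norm_num
  have := h1.1.ne'
  rw [waveRate, e]
  field_simp

theorem eventually_waveNumber_bounds (hα : 0 < α) :
    ∀ᶠ x in atTop, x ^ (α / 2) / 2 ≤ waveNumber α E x ∧
      waveNumber α E x ≤ 2 * x ^ (α / 2) := by
  have h := tendsto_waveNumber_div E hα
  filter_upwards [h.eventually (lt_mem_nhds (show (1 / 2 : ℝ) < 1 by norm_num)),
    h.eventually (gt_mem_nhds (show (1 : ℝ) < 2 by norm_num)), eventually_gt_atTop 0]
    with x h1 h2 hx
  have hp : 0 < x ^ (α / 2) := Real.rpow_pos_of_pos hx _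
  rw [lt_div_iff₀ hp] at h1
  rw [div_lt_iff₀ hp] at h2
  constructor <;> linarith

end WaveNumber

/-- Prüfer variables: `(C, S)` is the cosine and sine of twice the Prüfer angle, `L` is the
logarithm of the squared amplitude. -/
theorem exists_prufer {α E : ℝ} (hα : 0 < α) {q u u' u'' : ℝ → ℝ}
    (h1 : ∀ x ∈ Ioi (0 : ℝ), HasDerivAt u (u' x) x)
    (h2 : ∀ x ∈ Ioi (0 : ℝ), HasDerivAt u' (u'' x) x)
    (h3 : ∀ x ∈ Ioi (0 : ℝ), u'' x = (q x - x ^ α - E) * u x)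
    (hne : ∀ x ∈ Ioi (0 : ℝ), u x ≠ 0 ∨ u' x ≠ 0) :
    ∃ C S L : ℝ → ℝ, ∀ᶠ x in atTop, C x ^ 2 + S x ^ 2 = 1 ∧
      Real.exp (L x) = waveNumber α E x ^ 2 * u x ^ 2 + u' x ^ 2 ∧
      HasDerivAt L (waveRate α E x + waveRate α E x * C x +
        q x / waveNumber α E x * S x) x ∧
      HasDerivAt C (-((-2 * waveNumber α E x + (q x / waveNumber α E x * (1 + C x) -
        waveRate α E x * S x)) * S x)) x ∧
      HasDerivAt S ((-2 * waveNumber α E x + (q x / waveNumber α E x * (1 + C x) -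
        waveRate α E x * S x)) * C x) x := by
  set s := waveNumber α E with hs
  set k := waveRate α E with hk
  let R : ℝ → ℝ := fun x => (s x * u x) ^ 2 + u' x ^ 2
  refine ⟨fun x => ((s x * u x) ^ 2 - u' x ^ 2) / R x, fun x => 2 * (s x * u x) * u' x / R x,
    fun x => Real.log (R x), ?_⟩
  filter_upwards [eventually_waveNumber E hα, eventually_hasDerivAt_waveNumber E hα,
    eventually_gt_atTop 0] with x hsx hsd hx
  rw [← hs] at hsx hsd
  rw [← hk] at hsd
  have hs0 := hsx.1.ne'
  have hR : 0 < R x := by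
    rcases hne x hx with h | h
    · have : 0 < (s x * u x) ^ 2 := by positivity
      exact add_pos_of_pos_of_nonneg this (sq_nonneg _)
    · have : 0 < u' x ^ 2 := by positivity
      exact add_pos_of_nonneg_of_pos (sq_nonneg _) this
  have hR0 := hR.ne'
  have hA : HasDerivAt (fun y => s y * u y) (k x * (s x * u x) + s x * u' x) x :=
    (hsd.fun_mul (h1 x hx)).congr_deriv (by ring)
  have hB : HasDerivAt u' (q x / s x * (s x * u x) - s x * (s x * u x)) x := by
    refine (h2 x hx).congr_deriv ?_
    rw [h3 x hx, show q x - x ^ α - E = q x - s x ^ 2 by rw [hsx.2]; ring]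
    field_simp
  have hRd : HasDerivAt R (2 * (s x * u x) * (k x * (s x * u x) + s x * u' x) +
      2 * u' x * (q x / s x * (s x * u x) - s x * (s x * u x))) x := by
    refine ((hA.fun_pow 2).fun_add (hB.fun_pow 2)).congr_deriv ?_
    norm_num
  refine ⟨?_, ?_, ?_, ?_, ?_⟩
  · field_simp
    simp only [R]
    ring
  · rw [Real.exp_log hR]
    simp only [R]
    ring
  · refine (hRd.log hR0).congr_deriv ?_
    have e : R x = (s x * u x) ^ 2 + u' x ^ 2 := rfl
    generalize q x / s x = η at *
    generalize s x * u x = A at *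
    field_simp
    rw [e]
    ring
  · refine (((hA.fun_pow 2).fun_sub (hB.fun_pow 2)).fun_div hRd hR0).congr_deriv ?_
    have e : R x = (s x * u x) ^ 2 + u' x ^ 2 := rfl
    generalize q x / s x = η at *
    generalize s x * u x = A at *
    field_simp
    rw [e]
    ring
  · refine (((hA.const_mul 2).fun_mul hB).fun_div hRd hR0).congr_deriv ?_
    have e : R x = (s x * u x) ^ 2 + u' x ^ 2 := rfl
    generalize q x / s x = η at *
    generalize s x * u x = A at *
    field_simp
    rw [e]
    ring

theorem Negligible.mul_bounded {f g : ℝ → ℝ} (hf : Tendsto (fun x => x * f x) atTop (𝓝 0))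
    (hg : ∀ᶠ x in atTop, |g x| ≤ 1) : Negligible (fun x => f x * g x) := by
  refine Negligible.of_tendsto (squeeze_zero_norm' (a := fun x => |x * f x|) ?_
    (by simpa using hf.abs))
  filter_upwards [hg] with x hx
  rw [← mul_assoc, Real.norm_eq_abs, abs_mul]
  exact mul_le_of_le_one_right (abs_nonneg _) hx

/-- `(C, S)` moves on the unit circle with angular velocity `-2 √(x^α + E) + O(1/x)`. -/
structure IsPhase (α E K : ℝ) (C S b : ℝ → ℝ) : Prop where
  norm : ∀ᶠ x in atTop, C x ^ 2 + S x ^ 2 = 1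
  deriv_cos : ∀ᶠ x in atTop, HasDerivAt C (-((-2 * waveNumber α E x + b x) * S x)) x
  deriv_sin : ∀ᶠ x in atTop, HasDerivAt S ((-2 * waveNumber α E x + b x) * C x) x
  bound : ∀ᶠ x in atTop, |x * b x| ≤ K

namespace IsPhase

variable {α E F K : ℝ} {C S b D T d : ℝ → ℝ}

theorem abs_cos_le (h : IsPhase α E K C S b) : ∀ᶠ x in atTop, |C x| ≤ 1 := by
  filter_upwards [h.norm] with x hx
  exact (sq_le_one_iff_abs_le_one _).1 (by nlinarith [sq_nonneg (S x)])

theorem abs_sin_le (h : IsPhase α E K C S b) : ∀ᶠ x in atTop, |S x| ≤ 1 := by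
  filter_upwards [h.norm] with x hx
  exact (sq_le_one_iff_abs_le_one _).1 (by nlinarith [sq_nonneg (C x)])

theorem tendsto_mul_waveNumber_add (hα : 0 < α) (E F : ℝ) :
    Tendsto (fun x => |x * (-2 * (waveNumber α E x + waveNumber α F x))|) atTop atTop := by
  refine tendsto_atTop_mono' _ ?_ tendsto_id
  filter_upwards [eventually_waveNumber_bounds E hα, eventually_waveNumber_bounds F hα,
    eventually_ge_atTop 1] with x h1 h2 hx
  have hp : 1 ≤ x ^ (α / 2) := Real.one_le_rpow hx (by positivity)
  have h3 : 1 ≤ waveNumber α E x + waveNumber α F x := by linarith [h1.1, h2.1]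
  rw [abs_mul, abs_of_nonneg (by linarith : 0 ≤ x), abs_mul,
    abs_of_nonneg (by linarith : 0 ≤ waveNumber α E x + waveNumber α F x)]
  norm_num
  nlinarith

theorem tendsto_mul_waveNumber_sub (hα : 0 < α) (hα2 : α < 2) (hEF : E ≠ F) :
    Tendsto (fun x => |x * (-2 * (waveNumber α E x - waveNumber α F x))|) atTop atTop := by
  have hΔ : 0 < |E - F| := abs_pos.2 (sub_ne_zero.2 hEF)
  refine tendsto_atTop_mono' _ ?_
    ((tendsto_rpow_atTop (by linarith : 0 < 1 - α / 2)).const_mul_atTop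
      (by positivity : 0 < |E - F| / 2))
  filter_upwards [eventually_waveNumber_bounds E hα, eventually_waveNumber_bounds F hα,
    eventually_gt_atTop 0, eventually_waveNumber E hα, eventually_waveNumber F hα]
    with x h1 h2 hx h3 h4
  have hp : 0 < x ^ (α / 2) := Real.rpow_pos_of_pos hx _
  have e : |waveNumber α E x - waveNumber α F x| * (waveNumber α E x + waveNumber α F x) =
      |E - F| := by
    rw [← abs_of_pos (add_pos h3.1 h4.1), ← abs_mul]
    congr 1
    linarith [h3.2, h4.2, mul_comm (waveNumber α E x) (waveNumber α F x)]
  have h5 : |E - F| ≤ |waveNumber α E x - waveNumber α F x| * (4 * x ^ (α / 2)) := by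
    rw [← e]
    gcongr
    linarith [h1.2, h2.2]
  rw [abs_mul, abs_mul, abs_of_pos hx, Real.rpow_sub hx, Real.rpow_one]
  norm_num
  rw [div_mul_div_comm, div_le_iff₀ (by positivity)]
  nlinarith

theorem negligible_cos (h : IsPhase α E K C S b) (hα : 0 < α) :
    Negligible (fun x => C x / x) := by
  refine Negligible.of_oscillating (ω := fun x => -2 * waveNumber α E x) (b := b)
    (g := fun x => x * waveRate α E x) (K := max K (α / 2 + 1)) h.deriv_sin h.abs_cos_le
    h.abs_sin_le (h.bound.mono fun x hx => hx.trans (le_max_left _ _)) ?_ ?_ ?_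
  · filter_upwards [eventually_hasDerivAt_waveNumber E hα, eventually_gt_atTop 0] with x hx h0
    refine (hx.const_mul (-2)).congr_deriv ?_
    field_simp
  · have := (tendsto_mul_waveRate E hα).abs
    rw [abs_of_pos (by positivity : 0 < α / 2)] at this
    filter_upwards [this.eventually (gt_mem_nhds (lt_add_one _))] with x hx
    exact hx.le.trans (le_max_right _ _)
  · refine ((tendsto_mul_waveNumber_add hα E E).const_mul_atTop
      (by norm_num : (0 : ℝ) < 1 / 2)).congr fun x => ?_
    rw [← abs_of_pos (by norm_num : (0 : ℝ) < 1 / 2), ← abs_mul]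
    ring_nf

theorem negligible_combined (h : IsPhase α E K C S b) (h' : IsPhase α F K D T d)
    (hα : 0 < α) (σ : ℝ) (hσ : σ ^ 2 = 1)
    (hinf : Tendsto (fun x => |x * (-2 * (waveNumber α E x + σ * waveNumber α F x))|)
      atTop atTop) :
    Negligible (fun x => (C x * D x - σ * (S x * T x)) / x) := by
  have hσ' : |σ| = 1 := by rw [← sq_abs] at hσ; nlinarith [abs_nonneg σ]
  have hunit : ∀ᶠ x in atTop, (C x * D x - σ * (S x * T x)) ^ 2 +
      (S x * D x + σ * (C x * T x)) ^ 2 = 1 := by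
    filter_upwards [h.norm, h'.norm] with x h1 h2
    linear_combination (C x ^ 2 * T x ^ 2 + S x ^ 2 * T x ^ 2) * hσ + h1 * (D x ^ 2 + T x ^ 2) + h2
  refine Negligible.of_oscillating
    (S := fun x => S x * D x + σ * (C x * T x))
    (ω := fun x => -2 * (waveNumber α E x + σ * waveNumber α F x))
    (b := fun x => b x + σ * d x)
    (g := fun x => σ * (α * x ^ α / (2 * (waveNumber α E x * waveNumber α F x))))
    (K := max (K + K) (2 * α)) ?_ ?_ ?_ ?_ ?_ ?_ hinf
  · filter_upwards [h.deriv_sin, h.deriv_cos, h'.deriv_sin, h'.deriv_cos] with x h1 h2 h3 h4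
    refine ((h1.fun_mul h4).fun_add ((h2.fun_mul h3).const_mul σ)).congr_deriv ?_
    linear_combination (S x * T x * (-2 * waveNumber α F x + d x)) * hσ
  · filter_upwards [hunit] with x hx
    exact (sq_le_one_iff_abs_le_one _).1 (by nlinarith [sq_nonneg (S x * D x + σ * (C x * T x))])
  · filter_upwards [hunit] with x hx
    exact (sq_le_one_iff_abs_le_one _).1 (by nlinarith [sq_nonneg (C x * D x - σ * (S x * T x))])
  · filter_upwards [h.bound, h'.bound] with x h1 h2
    refine le_trans ?_ (le_max_left _ _)
    calc |x * (b x + σ * d x)| = |x * b x + σ * (x * d x)| := by ring_nf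
      _ ≤ |x * b x| + |σ| * |x * d x| := (abs_add_le _ _).trans_eq (by rw [abs_mul σ])
      _ ≤ K + K := by rw [hσ', one_mul]; exact add_le_add h1 h2
  · filter_upwards [eventually_hasDerivAt_waveNumber E hα, eventually_hasDerivAt_waveNumber F hα,
      eventually_waveNumber E hα, eventually_waveNumber F hα, eventually_gt_atTop 0]
      with x h1 h2 h3 h4 hx
    refine ((h1.fun_add (h2.const_mul σ)).const_mul (-2)).congr_deriv ?_
    have := h3.1.ne'
    have := h4.1.ne'
    rw [waveRate, waveRate, Real.rpow_sub_one hx.ne']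
    field_simp
    linear_combination waveNumber α F x * hσ
  · filter_upwards [eventually_waveNumber_bounds E hα, eventually_waveNumber_bounds F hα,
      eventually_gt_atTop 0] with x h1 h2 hx
    refine le_trans ?_ (le_max_right _ _)
    have hp : 0 < x ^ (α / 2) := Real.rpow_pos_of_pos hx _
    have e : x ^ α = x ^ (α / 2) * x ^ (α / 2) := by rw [← Real.rpow_add hx]; ring_nf
    have h3 : 0 < waveNumber α E x := by linarith [h1.1]
    have h4 : 0 < waveNumber α F x := by linarith [h2.1]
    rw [abs_mul, hσ', one_mul, e, abs_of_pos (by positivity), div_le_iff₀ (by positivity)]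
    have := mul_le_mul h1.1 h2.1 (by positivity) h3.le
    nlinarith

theorem negligible_sin_mul_sin (h : IsPhase α E K C S b) (h' : IsPhase α F K D T d)
    (hα : 0 < α) (hα2 : α < 2) (hEF : E ≠ F) : Negligible (fun x => S x * T x / x) := by
  have h1 := negligible_combined h h' hα 1 (by norm_num)
    (by simpa only [one_mul] using tendsto_mul_waveNumber_add hα E F)
  have h2 := negligible_combined h h' hα (-1) (by norm_num)
    (by simpa only [neg_one_mul, ← sub_eq_add_neg] using tendsto_mul_waveNumber_sub hα hα2 hEF)
  refine ((h2.const_mul (1 / 2)).add (h1.const_mul (-1 / 2))).congr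
    (Eventually.of_forall fun x => ?_)
  ring

theorem negligible_sin_sq (h : IsPhase α E K C S b) (hα : 0 < α) :
    Negligible (fun x => (S x * S x - 1 / 2) / x) := by
  have h1 := negligible_combined h h hα 1 (by norm_num)
    (by simpa only [one_mul] using tendsto_mul_waveNumber_add hα E E)
  refine (h1.const_mul (-1 / 2)).congr ?_
  filter_upwards [h.norm] with x hx
  linear_combination (-1 / 2) * hx / x

end IsPhase

section Growth

variable {α A : ℝ} {q : ℝ → ℝ}

theorem eventually_abs_mul_div_rpow_le
    (hq : ∀ᶠ x in atTop, x ^ (1 - α / 2) * |q x| ≤ A) :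
    ∀ᶠ x in atTop, |x * (q x / x ^ (α / 2))| ≤ A := by
  filter_upwards [hq, eventually_gt_atTop 0] with x h hx
  have hp : 0 < x ^ (α / 2) := Real.rpow_pos_of_pos hx _
  rw [Real.rpow_sub hx, Real.rpow_one] at h
  rw [abs_mul, abs_div, abs_of_pos hx, abs_of_pos hp]
  exact le_of_eq_of_le (by ring) h

theorem eventually_abs_mul_div_waveNumber_le (hα : 0 < α) (E : ℝ)
    (hq : ∀ᶠ x in atTop, x ^ (1 - α / 2) * |q x| ≤ A) :
    ∀ᶠ x in atTop, |x * (q x / waveNumber α E x)| ≤ 2 * A := by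
  filter_upwards [eventually_abs_mul_div_rpow_le hq, eventually_waveNumber_bounds E hα,
    eventually_gt_atTop 0] with x h h1 hx
  have hp : 0 < x ^ (α / 2) := Real.rpow_pos_of_pos hx _
  have h3 : 0 < waveNumber α E x := by linarith [h1.1]
  rw [← mul_div_assoc, abs_div, abs_of_pos hp, div_le_iff₀ hp] at h
  rw [← mul_div_assoc, abs_div, abs_of_pos h3, div_le_iff₀ h3]
  have : 0 ≤ A := by
    by_contra hA
    nlinarith [abs_nonneg (x * q x)]
  nlinarith [h1.1]

theorem tendsto_mul_sub_div_waveNumber (hα : 0 < α) (E : ℝ)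
    (hq : ∀ᶠ x in atTop, x ^ (1 - α / 2) * |q x| ≤ A) :
    Tendsto (fun x => x * (q x / waveNumber α E x - q x / x ^ (α / 2))) atTop (𝓝 0) := by
  have h0 : Tendsto (fun x => 2 * A * |1 - waveNumber α E x / x ^ (α / 2)|) atTop (𝓝 0) := by
    simpa using (((tendsto_waveNumber_div E hα).const_sub 1).abs).const_mul (2 * A)
  refine squeeze_zero_norm' ?_ h0
  filter_upwards [eventually_abs_mul_div_waveNumber_le hα E hq, eventually_waveNumber E hα,
    eventually_gt_atTop 0] with x h h1 hx
  have hp : 0 < x ^ (α / 2) := Real.rpow_pos_of_pos hx _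
  have h3 := h1.1.ne'
  have e : x * (q x / waveNumber α E x - q x / x ^ (α / 2)) =
      x * (q x / waveNumber α E x) * (1 - waveNumber α E x / x ^ (α / 2)) := by
    field_simp
  rw [e, Real.norm_eq_abs, abs_mul]
  gcongr

theorem isPhase_of_prufer (hα : 0 < α) {E : ℝ} {C S : ℝ → ℝ}
    (hq : ∀ᶠ x in atTop, x ^ (1 - α / 2) * |q x| ≤ A)
    (h : ∀ᶠ x in atTop, C x ^ 2 + S x ^ 2 = 1 ∧
      HasDerivAt C (-((-2 * waveNumber α E x + (q x / waveNumber α E x * (1 + C x) -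
        waveRate α E x * S x)) * S x)) x ∧
      HasDerivAt S ((-2 * waveNumber α E x + (q x / waveNumber α E x * (1 + C x) -
        waveRate α E x * S x)) * C x) x) :
    IsPhase α E (2 * A * 2 + (α / 2 + 1)) C S
      (fun x => q x / waveNumber α E x * (1 + C x) - waveRate α E x * S x) where
  norm := h.mono fun x hx => hx.1
  deriv_cos := h.mono fun x hx => hx.2.1
  deriv_sin := h.mono fun x hx => hx.2.2
  bound := by
    have hk := (tendsto_mul_waveRate E hα).abs
    rw [abs_of_pos (by positivity : 0 < α / 2)] at hk
    filter_upwards [h, eventually_abs_mul_div_waveNumber_le hα E hq,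
      hk.eventually (gt_mem_nhds (lt_add_one _))] with x h1 h2 h3
    have hC : |C x| ≤ 1 := (sq_le_one_iff_abs_le_one _).1 (by nlinarith [h1.1, sq_nonneg (S x)])
    have hS : |S x| ≤ 1 := (sq_le_one_iff_abs_le_one _).1 (by nlinarith [h1.1, sq_nonneg (C x)])
    have hC' : |1 + C x| ≤ 2 := (abs_add_le _ _).trans (by norm_num; linarith)
    calc |x * (q x / waveNumber α E x * (1 + C x) - waveRate α E x * S x)|
        = |x * (q x / waveNumber α E x) * (1 + C x) - x * waveRate α E x * S x| := by ring_nf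
      _ ≤ |x * (q x / waveNumber α E x)| * |1 + C x| + |x * waveRate α E x| * |S x| := by
        rw [← abs_mul, ← abs_mul]; exact abs_sub _ _
      _ ≤ 2 * A * 2 + (α / 2 + 1) * 1 := by
        gcongr
        exact (abs_nonneg _).trans h2
      _ = _ := by ring

theorem exists_log_le_sum {ι : Type*} [Fintype ι] [Nonempty ι] {E : ι → ℝ}
    (hE : Function.Injective E) (hα : 0 < α) (hα2 : α < 2) (hA : 0 < A)
    (hq : ∀ᶠ x in atTop, x ^ (1 - α / 2) * |q x| ≤ A)
    {K : ℝ} {C S b L : ι → ℝ → ℝ} (h : ∀ i, IsPhase α (E i) K (C i) (S i) (b i))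
    (hL : ∀ i, ∀ᶠ x in atTop, HasDerivAt (L i) (waveRate α (E i) x +
      waveRate α (E i) x * C i x + q x / waveNumber α (E i) x * S i x) x)
    {c : ℝ} (hc : c < (Fintype.card ι : ℝ) * (α / 2) - A * √((Fintype.card ι : ℝ) / 2)) :
    ∃ K', ∀ᶠ x in atTop, c * Real.log x + K' ≤ ∑ i, L i x := by
  classical
  set N : ℝ := (Fintype.card ι : ℝ) with hN
  have hNpos : 0 < N := by rw [hN]; exact_mod_cast Fintype.card_pos
  set lam := √(N / 2) with hlam
  have hlam0 : 0 < lam := Real.sqrt_pos.2 (by positivity)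
  have hlam2 : lam ^ 2 = N / 2 := Real.sq_sqrt (by positivity)
  have hrate : ∀ i, Tendsto (fun x => x * (waveRate α (E i) x - α / 2 / x)) atTop (𝓝 0) := by
    intro i
    have := (tendsto_mul_waveRate (E i) hα).sub_const (α / 2)
    rw [sub_self] at this
    refine this.congr' ?_
    filter_upwards [eventually_ne_atTop 0] with x hx
    field_simp
  have hn1 : ∀ i, Negligible (fun x => (waveRate α (E i) x - α / 2 / x) +
      (waveRate α (E i) x - α / 2 / x) * C i x + α / 2 * (C i x / x) +
      (q x / waveNumber α (E i) x - q x / x ^ (α / 2)) * S i x) := fun i =>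
    (((Negligible.of_tendsto (hrate i)).add
      (Negligible.mul_bounded (hrate i) (h i).abs_cos_le)).add
      (((h i).negligible_cos hα).const_mul _)).add
      (Negligible.mul_bounded (tendsto_mul_sub_div_waveNumber hα (E i) hq) (h i).abs_sin_le)
  have hn2 : ∀ i j, Negligible (fun x => (S i x * S j x - if i = j then 1 / 2 else 0) / x) := by
    intro i j
    by_cases hij : i = j
    · subst hij
      simpa using (h i).negligible_sin_sq hα
    · simpa [hij] using (h i).negligible_sin_mul_sin (h j) hα hα2 (hE.ne hij)
  have hn := (Negligible.sum Finset.univ hn1).add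
    ((Negligible.sum Finset.univ fun i => Negligible.sum Finset.univ (hn2 i)).const_mul
      (-(A / (2 * lam))))
  refine eventually_ge_log_of_deriv hc
    (L' := fun x => ∑ i, (waveRate α (E i) x +
      waveRate α (E i) x * C i x + q x / waveNumber α (E i) x * S i x)) ?_ hn ?_
  · filter_upwards [eventually_all.2 hL] with x hx
    exact HasDerivAt.fun_sum fun i _ => hx i
  · filter_upwards [eventually_abs_mul_div_rpow_le hq, eventually_gt_atTop 0] with x hw hx
    set w := q x / x ^ (α / 2) with hwdef
    set T := ∑ i, S i x with hT
    have e1 : ∑ i, ((waveRate α (E i) x - α / 2 / x) +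
        (waveRate α (E i) x - α / 2 / x) * C i x + α / 2 * (C i x / x) +
        (q x / waveNumber α (E i) x - w) * S i x) =
        ∑ i, (waveRate α (E i) x + waveRate α (E i) x * C i x +
          q x / waveNumber α (E i) x * S i x) - N * (α / 2 / x) - w * T := by
      rw [hT, Finset.mul_sum, hN, ← Finset.card_univ, ← nsmul_eq_mul, ← Finset.sum_const,
        ← Finset.sum_sub_distrib, ← Finset.sum_sub_distrib]
      exact Finset.sum_congr rfl fun i _ => by ring
    have e2 : ∑ i, ∑ j, (S i x * S j x - if i = j then 1 / 2 else 0) / x =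
        (T ^ 2 - lam ^ 2) / x := by
      simp_rw [← Finset.sum_div, Finset.sum_sub_distrib]
      rw [hlam2, hT, sq, Finset.sum_mul_sum]
      congr 2
      simp [← hN]
      ring
    rw [e1, e2]
    have h1 : -(A * |T|) ≤ x * w * T := by
      have := neg_abs_le (x * w * T)
      rw [abs_mul] at this
      nlinarith [mul_le_mul_of_nonneg_right hw (abs_nonneg T)]
    have h2 : A * |T| ≤ A / (2 * lam) * (T ^ 2 + lam ^ 2) := by
      rw [div_mul_eq_mul_div, le_div_iff₀ (by positivity)]
      nlinarith [mul_nonneg hA.le (sq_nonneg (|T| - lam)), sq_abs T]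
    have h3 : 0 ≤ (x * w * T + A / (2 * lam) * (T ^ 2 + lam ^ 2)) / x :=
      div_nonneg (by linarith) hx.le
    have h4 : (x * w * T + A / (2 * lam) * (T ^ 2 + lam ^ 2)) / x =
        w * T + A / (2 * lam) * ((T ^ 2 - lam ^ 2) / x) + A * lam / x := by
      field_simp
      ring
    have h5 : (N * (α / 2) - A * lam) / x = N * (α / 2 / x) - A * lam / x := by ring
    rw [h4] at h3
    linarith

end Growth

theorem exists_bounded_primitive {f : ℝ → ℝ} (hf : ContinuousOn f (Ioi 0))
    (hi : IntegrableOn f (Ioi 0)) :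
    ∃ (U : ℝ → ℝ) (K : ℝ), ∀ x > 0, HasDerivAt U (f x) x ∧ U x ≤ K := by
  refine ⟨fun x => ∫ t in (0 : ℝ)..x, f t, ∫ t in Ioi (0 : ℝ), ‖f t‖, fun x hx => ⟨?_, ?_⟩⟩
  · refine intervalIntegral.integral_hasDerivAt_right ?_
      (hf.stronglyMeasurableAtFilter isOpen_Ioi x hx) (hf.continuousAt (Ioi_mem_nhds hx))
    rw [intervalIntegrable_iff_integrableOn_Ioc_of_le hx.le]
    exact hi.mono_set Ioc_subset_Ioi_self
  · refine (Real.le_norm_self _).trans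
      (intervalIntegral.norm_integral_le_integral_norm_uIoc.trans ?_)
    rw [uIoc_of_le hx.le]
    exact setIntegral_mono_set hi.norm (Eventually.of_forall fun t => norm_nonneg _)
      (Eventually.of_forall Ioc_subset_Ioi_self)

section Nonexistence

variable {α A : ℝ} {q : ℝ → ℝ} {ι : Type*} [Fintype ι] {E : ι → ℝ} {u u' u'' : ι → ℝ → ℝ}

/-- Square integrability is incompatible with the lower bound `1/x` for the squared amplitude. -/
theorem not_eventually_inv_le (hα : 0 < α)
    (hq : ∀ᶠ x in atTop, x ^ (1 - α / 2) * |q x| ≤ A)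
    (h1 : ∀ i, ∀ x ∈ Ioi (0 : ℝ), HasDerivAt (u i) (u' i x) x)
    (h2 : ∀ i, ∀ x ∈ Ioi (0 : ℝ), HasDerivAt (u' i) (u'' i x) x)
    (h3 : ∀ i, ∀ x ∈ Ioi (0 : ℝ), u'' i x = (q x - x ^ α - E i) * u i x)
    (hint : ∀ i, IntegrableOn (fun x => u i x ^ 2) (Ioi 0)) :
    ¬ ∀ᶠ x in atTop, x⁻¹ ≤ ∑ i, (u i x ^ 2 + u' i x ^ 2 / x ^ α) := by
  intro hρ
  obtain ⟨U, B, hU⟩ := exists_bounded_primitive (f := fun x => ∑ i, u i x ^ 2)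
    (continuousOn_finsetSum _ fun i _ x hx =>
      ((h1 i x hx).continuousAt.pow 2).continuousWithinAt)
    (integrable_finsetSum _ fun i _ => hint i)
  have hqα : Tendsto (fun x => q x / x ^ α) atTop (𝓝 0) := by
    refine squeeze_zero_norm' (a := fun x => A * x ^ (-(1 + α / 2))) ?_
      (by simpa using (tendsto_rpow_neg_atTop (by linarith : 0 < 1 + α / 2)).const_mul A)
    filter_upwards [hq, eventually_gt_atTop 0] with x h hx
    rw [Real.norm_eq_abs, abs_div, abs_of_pos (Real.rpow_pos_of_pos hx α), div_eq_mul_inv,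
      ← Real.rpow_neg hx.le]
    calc |q x| * x ^ (-α) = x ^ (1 - α / 2) * |q x| * x ^ (-(1 + α / 2)) := by
          rw [mul_right_comm, ← Real.rpow_add hx, mul_comm]
          ring_nf
      _ ≤ _ := mul_le_mul_of_nonneg_right h (Real.rpow_nonneg hx.le _)
  have hpot : ∀ i, Tendsto (fun x => (q x - E i) / x ^ α) atTop (𝓝 0) := by
    intro i
    have := hqα.sub ((tendsto_inv_atTop_zero.comp (tendsto_rpow_atTop hα)).const_mul (E i))
    rw [mul_zero, sub_zero] at this
    refine this.congr fun x => ?_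
    simp only [Function.comp]
    ring
  have hδ : Tendsto (fun x : ℝ => α * x ^ (-(1 + α / 2))) atTop (𝓝 0) := by
    simpa using (tendsto_rpow_neg_atTop (by linarith : 0 < 1 + α / 2)).const_mul α
  obtain ⟨K, hK⟩ := eventually_ge_of_deriv_nonneg
    (F := fun x => ∑ i, u i x * u' i x / x ^ α + 2 * U x - 1 / 2 * Real.log x)
    (F' := fun x => ∑ i, (((u' i x * u' i x + u i x * u'' i x) * x ^ α -
      u i x * u' i x * (α * x ^ (α - 1))) / (x ^ α) ^ 2) + 2 * ∑ i, u i x ^ 2 - 1 / 2 * x⁻¹)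
    (by
      filter_upwards [eventually_gt_atTop 0] with x hx
      refine ((HasDerivAt.fun_sum fun i _ => ?_).fun_add ((hU x hx).1.const_mul 2)).fun_sub
        ((Real.hasDerivAt_log hx.ne').const_mul _)
      exact ((h1 i x hx).fun_mul (h2 i x hx)).fun_div
        (Real.hasDerivAt_rpow_const (Or.inl hx.ne')) (Real.rpow_pos_of_pos hx α).ne')
    (by
      filter_upwards [hρ, eventually_gt_atTop 0,
        hδ.eventually (gt_mem_nhds (show (0 : ℝ) < 1 / 4 by norm_num)),
        eventually_all.2 fun i =>
          (hpot i).eventually (lt_mem_nhds (show (-(1 / 4) : ℝ) < 0 by norm_num))]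
        with x hx h0 hd hp
      have key : ∀ i, 1 / 2 * (u i x ^ 2 + u' i x ^ 2 / x ^ α) ≤
          ((u' i x * u' i x + u i x * u'' i x) * x ^ α -
            u i x * u' i x * (α * x ^ (α - 1))) / (x ^ α) ^ 2 + 2 * u i x ^ 2 := by
        intro i
        set y := x ^ (α / 2) with hy
        have hy0 : 0 < y := Real.rpow_pos_of_pos h0 _
        have e1 : x ^ α = y ^ 2 := by
          rw [hy, ← Real.rpow_natCast, ← Real.rpow_mul h0.le]; norm_num
        have e2 : x ^ (-(1 + α / 2)) = 1 / (x * y) := by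
          rw [Real.rpow_neg h0.le, Real.rpow_add h0, Real.rpow_one, one_div]
        rw [h3 i x h0, Real.rpow_sub_one h0.ne']
        have hp' := hp i
        rw [e1] at hp' ⊢
        rw [e2] at hd
        have hd0 : 0 < α * (1 / (x * y)) := by positivity
        set d := α * (1 / (x * y)) with hddef
        set p := (q x - E i) / y ^ 2 with hpdef
        set v := u' i x / y with hv
        have e3 : ((u' i x * u' i x + u i x * ((q x - y ^ 2 - E i) * u i x)) * y ^ 2 -
            u i x * u' i x * (α * (y ^ 2 / x))) / (y ^ 2) ^ 2 =
            v ^ 2 + (p - 1) * u i x ^ 2 - d * (u i x * v) := by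
          rw [hv, hpdef, hddef]
          field_simp
          ring
        have e4 : u' i x ^ 2 / y ^ 2 = v ^ 2 := by rw [hv, div_pow]
        rw [e3, e4]
        nlinarith [sq_nonneg (u i x - v), sq_nonneg (u i x + v), sq_nonneg (u i x), sq_nonneg v,
          mul_nonneg (by linarith : 0 ≤ p + 1 / 4) (sq_nonneg (u i x)),
          mul_nonneg hd0.le (sq_nonneg (u i x - v)),
          mul_nonneg (by linarith : 0 ≤ 1 / 4 - d) (add_nonneg (sq_nonneg (u i x)) (sq_nonneg v))]
      have := Finset.sum_le_sum fun i (_ : i ∈ Finset.univ) => key i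
      rw [← Finset.mul_sum, Finset.sum_add_distrib (g := fun i => 2 * u i x ^ 2),
        ← Finset.mul_sum Finset.univ _ (2 : ℝ)] at this
      linarith)
  have hD : ∀ᶠ x in atTop, 1 ≤ ∑ i, u i x * u' i x / x ^ α := by
    filter_upwards [hK, eventually_gt_atTop 0,
      Real.tendsto_log_atTop.eventually_ge_atTop (2 * (1 + 2 * B - K))] with x hx h0 hl
    linarith [(hU x h0).2]
  obtain ⟨K1, hK1⟩ := eventually_ge_of_deriv_nonneg
    (F := fun x => ∑ i, u i x ^ 2 - x) (F' := fun x => ∑ i, 2 * (u i x * u' i x) - 1)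
    (by
      filter_upwards [eventually_gt_atTop 0] with x hx
      refine (HasDerivAt.fun_sum fun i _ => ?_).fun_sub (hasDerivAt_id' x)
      refine ((h1 i x hx).fun_pow 2).congr_deriv ?_
      norm_num
      ring)
    (by
      filter_upwards [hD, eventually_ge_atTop 1] with x hx h0
      have hp : 1 ≤ x ^ α := Real.one_le_rpow h0 hα.le
      rw [← Finset.sum_div, le_div_iff₀ (by linarith)] at hx
      rw [← Finset.mul_sum]
      linarith)
  obtain ⟨K2, hK2⟩ := eventually_ge_of_deriv_nonneg
    (F := fun x => U x - x) (F' := fun x => ∑ i, u i x ^ 2 - 1)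
    (by
      filter_upwards [eventually_gt_atTop 0] with x hx
      exact (hU x hx).1.fun_sub (hasDerivAt_id' x))
    (by
      filter_upwards [hK1, eventually_ge_atTop (1 - K1)] with x hx h0
      linarith)
  obtain ⟨x, hx, h0, hx'⟩ :=
    (hK2.and ((eventually_gt_atTop 0).and (eventually_gt_atTop (B - K2)))).exists
  linarith [(hU x h0).2]

/-- The number of energies with square-integrable solutions is controlled by the size of `q`. -/
theorem card_mul_le [Nonempty ι] (hE : Function.Injective E) (hα : 0 < α) (hα2 : α < 2)
    (hA : 0 < A) (hqi : LocallyIntegrableOn q (Ioi 0))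
    (hq : ∀ᶠ x in atTop, x ^ (1 - α / 2) * |q x| ≤ A)
    (hu : ∀ i, ∃ x ∈ Ioi (0 : ℝ), u i x ≠ 0)
    (h1 : ∀ i, ∀ x ∈ Ioi (0 : ℝ), HasDerivAt (u i) (u' i x) x)
    (h2 : ∀ i, ∀ x ∈ Ioi (0 : ℝ), HasDerivAt (u' i) (u'' i x) x)
    (h3 : ∀ i, ∀ x ∈ Ioi (0 : ℝ), u'' i x = (q x - x ^ α - E i) * u i x)
    (hint : ∀ i, IntegrableOn (fun x => u i x ^ 2) (Ioi 0)) :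
    (Fintype.card ι : ℝ) * (1 - α / 2) ≤ A * √((Fintype.card ι : ℝ) / 2) := by
  by_contra! hlt
  set N : ℝ := (Fintype.card ι : ℝ) with hN
  have hNpos : 0 < N := by rw [hN]; exact_mod_cast Fintype.card_pos
  have hV : ∀ i, LocallyIntegrableOn (fun x => q x - x ^ α - E i) (Ioi 0) := fun i =>
    (hqi.sub (ContinuousOn.locallyIntegrableOn
      (fun x hx => (Real.continuousAt_rpow_const x α (Or.inl (ne_of_gt hx))).continuousWithinAt)
      measurableSet_Ioi)).sub (continuousOn_const.locallyIntegrableOn measurableSet_Ioi)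
  have hne : ∀ i, ∀ x ∈ Ioi (0 : ℝ), u i x ≠ 0 ∨ u' i x ≠ 0 := by
    intro i x hx
    by_contra! h
    obtain ⟨y, hy, hy0⟩ := hu i
    exact hy0 (eq_zero_of_zero (h1 i) (h2 i) (h3 i) (hV i) hx h.1 h.2 y hy)
  choose C S L hP using fun i => exists_prufer hα (h1 i) (h2 i) (h3 i) (hne i)
  obtain ⟨c, hc1, hc2⟩ := exists_between
    (show N * α - N < N * (α / 2) - A * √(N / 2) by linarith)
  obtain ⟨K, hK⟩ := exists_log_le_sum hE hα hα2 hA hq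
    (fun i => isPhase_of_prufer hα hq ((hP i).mono fun x hx => ⟨hx.1, hx.2.2.2⟩))
    (fun i => (hP i).mono fun x hx => hx.2.2.1) hc2
  refine not_eventually_inv_le hα hq h1 h2 h3 hint ?_
  have hlog : Tendsto (fun x => (c - N * α + N) * Real.log x) atTop atTop :=
    Real.tendsto_log_atTop.const_mul_atTop (by linarith)
  filter_upwards [hK, eventually_all.2 hP, eventually_gt_atTop 0,
    eventually_all.2 fun i => eventually_waveNumber (E i) hα,
    eventually_all.2 fun i => (tendsto_rpow_atTop hα).eventually_ge_atTop (E i),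
    (tendsto_rpow_atTop hα).eventually_ge_atTop 1,
    hlog.eventually_ge_atTop (N * Real.log 2 - K)] with x hx hPx h0 hs hEx hx1 hl
  set ρ := ∑ i, (u i x ^ 2 + u' i x ^ 2 / x ^ α) with hρ
  have hxα : 0 < x ^ α := by linarith
  have hle : ∀ i, Real.exp (L i x) ≤ 2 * x ^ α * ρ := by
    intro i
    have hi : u i x ^ 2 + u' i x ^ 2 / x ^ α ≤ ρ :=
      Finset.single_le_sum (f := fun i => u i x ^ 2 + u' i x ^ 2 / x ^ α)
        (fun j _ => by positivity) (Finset.mem_univ i)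
    have e : x ^ α * (u i x ^ 2 + u' i x ^ 2 / x ^ α) = x ^ α * u i x ^ 2 + u' i x ^ 2 := by
      field_simp
    rw [(hPx i).2.1, (hs i).2]
    nlinarith [mul_le_mul_of_nonneg_left hi hxα.le, sq_nonneg (u' i x),
      mul_nonneg (sub_nonneg.2 (hEx i)) (sq_nonneg (u i x))]
  have hρpos : 0 < ρ := by
    have := (Real.exp_pos _).trans_le (hle (Classical.arbitrary ι))
    exact pos_of_mul_pos_right this (by positivity)
  have hLi : ∀ i, L i x ≤ Real.log 2 + α * Real.log x + Real.log ρ := by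
    intro i
    have := (Real.le_log_iff_exp_le (by positivity)).2 (hle i)
    rwa [Real.log_mul (by positivity) hρpos.ne', Real.log_mul two_ne_zero hxα.ne',
      Real.log_rpow h0] at this
  have hsum := Finset.sum_le_sum fun i (_ : i ∈ Finset.univ) => hLi i
  rw [Finset.sum_const, Finset.card_univ, nsmul_eq_mul, ← hN] at hsum
  have : -Real.log x ≤ Real.log ρ := by
    refine le_of_mul_le_mul_left ?_ hNpos
    linarith
  rw [← Real.log_inv] at this
  exact (Real.log_le_log_iff (by positivity) hρpos).1 this

end Nonexistence

/-- For `0 < α < 2` and a locally integrable potential `q` on `(0,∞)` with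
`a = limsup_{x→∞} x^{1-α/2} |q x|` finite, the set `P` of energies `E` for which
`-u'' - x^α u + q u = E u` has a nonzero `L²(0,∞)` solution is finite and
`a ≥ ((2-α)/√2) √(card P)`. -/
theorem stmt0 (α : ℝ) (hα0 : 0 < α) (hα2 : α < 2)
    (q : ℝ → ℝ) (hq : LocallyIntegrableOn q (Ioi 0))
    (a : ℝ)
    (ha : limsup (fun x : ℝ => ((x ^ (1 - α / 2) * |q x| : ℝ) : EReal)) atTop = (a : EReal))
    (P : Set ℝ)
    (hP : P = {E : ℝ | ∃ u u' u'' : ℝ → ℝ,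
        (∃ x ∈ Ioi (0 : ℝ), u x ≠ 0) ∧
        (∀ x ∈ Ioi (0 : ℝ), HasDerivAt u (u' x) x) ∧
        (∀ x ∈ Ioi (0 : ℝ), HasDerivAt u' (u'' x) x) ∧
        (∀ x ∈ Ioi (0 : ℝ), -u'' x - x ^ α * u x + q x * u x = E * u x) ∧
        IntegrableOn (fun x => (u x) ^ 2) (Ioi 0)}) :
    P.Finite ∧ (2 - α) / Real.sqrt 2 * Real.sqrt (P.ncard) ≤ a := by
  have hbound : ∀ A, a < A → ∀ᶠ x in atTop, x ^ (1 - α / 2) * |q x| ≤ A := by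
    intro A hA
    have : limsup (fun x : ℝ => ((x ^ (1 - α / 2) * |q x| : ℝ) : EReal)) atTop < (A : EReal) := by
      rw [ha]; exact_mod_cast hA
    filter_upwards [eventually_lt_of_limsup_lt this] with x hx
    exact (EReal.coe_lt_coe_iff.1 hx).le
  have ha0 : 0 ≤ a := by
    by_contra! h
    obtain ⟨x, hx, hx0⟩ :=
      ((hbound (a / 2) (by linarith)).and (eventually_gt_atTop 0)).exists
    have : 0 ≤ x ^ (1 - α / 2) * |q x| := mul_nonneg (Real.rpow_nonneg hx0.le _) (abs_nonneg _)
    linarith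
  have hcard : ∀ T : Finset ℝ, (T : Set ℝ) ⊆ P → (2 - α) / √2 * √(T.card : ℝ) ≤ a := by
    intro T hT
    rcases T.eq_empty_or_nonempty with rfl | hne
    · simpa using ha0
    have : Nonempty T := hne.to_subtype
    have hsol : ∀ i : T, (i : ℝ) ∈ P := fun i => hT i.2
    rw [hP] at hsol
    choose u u' u'' h0 h1 h2 h3 h4 using hsol
    refine le_of_forall_gt_imp_ge_of_dense fun A hA => ?_
    have h := card_mul_le (E := fun i : T => (i : ℝ)) Subtype.val_injective hα0 hα2
      (ha0.trans_lt hA) hq (hbound A hA) h0 h1 h2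
      (fun i x hx => by linear_combination -(h3 i x hx)) h4
    rw [Fintype.card_coe, Real.sqrt_div' _ zero_le_two] at h
    have hN : 0 < √(T.card : ℝ) := Real.sqrt_pos.2 (by exact_mod_cast hne.card_pos)
    have hN2 : √(T.card : ℝ) * √(T.card : ℝ) = T.card := Real.mul_self_sqrt (by positivity)
    have h22 : √2 * √2 = (2 : ℝ) := Real.mul_self_sqrt (by norm_num)
    have h20 : 0 < √(2 : ℝ) := by positivity
    rw [mul_div_assoc', le_div_iff₀ h20, ← hN2, Real.sqrt_mul_self hN.le] at h
    have h' : √(T.card : ℝ) * (1 - α / 2) * √2 ≤ A := by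
      refine le_of_mul_le_mul_right ?_ hN
      linarith
    rw [div_mul_eq_mul_div, div_le_iff₀ h20]
    nlinarith [mul_le_mul_of_nonneg_right h' h20.le]
  have hfin : P.Finite := by
    by_contra hinf
    obtain ⟨n, hn⟩ := exists_nat_gt ((a / ((2 - α) / √2)) ^ 2)
    obtain ⟨T, hT, hTn⟩ := Set.Infinite.exists_subset_card_eq hinf n
    have h := hcard T hT
    have hpos : 0 < (2 - α) / √2 := div_pos (by linarith) (by positivity)
    rw [hTn, mul_comm, ← le_div_iff₀ hpos, Real.sqrt_le_left (by positivity)] at h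
    linarith
  refine ⟨hfin, ?_⟩
  rw [Set.ncard_eq_toFinset_card P hfin]
  exact hcard _ (by simp)
end

section
/- Let 0 < α < 2 and N ≥ 1. For any distinct real numbers E_1, …, E_N and any θ_1, …, θ_N ∈ [0,π], there exists a potential q ∈ C^∞([0,∞)) such that limsup_{x→∞} x^{1-α/2}|q(x)| ≤ (2-α) e^{2√(ln N)} N and, for every j = 1, …, N, the equation -u''(x) - x^α u(x) + q(x)u(x) = E_j u(x) has a nonzero solution u with ∫₀^∞ |u(x)|² dx < ∞ satisfying the boundary condition u'(0) cos θ_j = u(0) sin θ_j. -/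
open Filter MeasureTheory Set
open scoped Topology NNReal ContDiff
open Asymptotics

/-! ### Global solutions of ordinary differential equations with bounded Lipschitz fields -/

/-- A time dependent vector field which is, locally uniformly in time, bounded and Lipschitz in
space has a global integral curve through every point. -/
theorem exists_global_integralCurve {V : Type*} [NormedAddCommGroup V] [NormedSpace ℝ V]
    [CompleteSpace V] {F : ℝ → V → V} (hc : ∀ x, Continuous fun t => F t x)
    (hF : ∀ T : ℝ, ∃ K : ℝ≥0, ∀ t ∈ Icc (-T) T, LipschitzWith K (F t) ∧ ∀ x, ‖F t x‖ ≤ K)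
    (x₀ : V) : ∃ γ : ℝ → V, γ 0 = x₀ ∧ ∀ t, HasDerivAt γ (F t (γ t)) t := by
  have h0 : ∀ n : ℕ, (0 : ℝ) ∈ Icc (-((n : ℝ) + 1)) (n + 1) := fun n =>
    ⟨by have := n.cast_nonneg (α := ℝ); linarith, by positivity⟩
  have hex : ∀ n : ℕ, ∃ γ : ℝ → V, γ 0 = x₀ ∧ ∀ t ∈ Icc (-((n : ℝ) + 1)) (n + 1),
      HasDerivWithinAt γ (F t (γ t)) (Icc (-((n : ℝ) + 1)) (n + 1)) t := by
    intro n
    obtain ⟨K, hK⟩ := hF (n + 1)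
    have hP : IsPicardLindelof F (tmin := -((n : ℝ) + 1)) (tmax := n + 1) ⟨0, h0 n⟩ x₀
        (K * (n + 1)) 0 K K :=
      { lipschitzOnWith := fun t ht => (hK t ht).1.lipschitzOnWith
        continuousOn := fun x _ => (hc x).continuousOn
        norm_le := fun t ht x _ => (hK t ht).2 x
        mul_max_le := by simp }
    exact hP.exists_eq_forall_mem_Icc_hasDerivWithinAt₀
  choose γ hγ0 hγ using hex
  have hd : ∀ n : ℕ, ∀ t ∈ Ioo (-((n : ℝ) + 1)) (n + 1), HasDerivAt (γ n) (F t (γ n t)) t :=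
    fun n t ht => (hγ n t (Ioo_subset_Icc_self ht)).hasDerivAt (Icc_mem_nhds ht.1 ht.2)
  have hmono : ∀ m n : ℕ, m ≤ n → EqOn (γ m) (γ n) (Ioo (-((m : ℝ) + 1)) (m + 1)) := by
    intro m n hmn
    obtain ⟨K, hK⟩ := hF (m + 1)
    have hmn' : (m : ℝ) ≤ n := by exact_mod_cast hmn
    have hm0 : (0 : ℝ) ≤ m := m.cast_nonneg
    refine ODE_solution_unique_of_mem_Ioo (v := F) (s := fun _ => univ) (K := K) (t₀ := 0)
      (fun t ht => (hK t (Ioo_subset_Icc_self ht)).1.lipschitzOnWith)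
      ⟨by linarith, by linarith⟩ (fun t ht => ⟨hd m t ht, mem_univ _⟩)
      (fun t ht => ⟨hd n t ⟨by linarith [ht.1], by linarith [ht.2]⟩, mem_univ _⟩) ?_
    rw [hγ0, hγ0]
  have hmono' : ∀ m n : ℕ, ∀ t : ℝ, |t| < m + 1 → |t| < n + 1 → γ m t = γ n t := by
    intro m n t hm hn
    rcases le_total m n with h | h
    · exact hmono m n h (abs_lt.1 hm)
    · exact (hmono n m h (abs_lt.1 hn)).symm
  refine ⟨fun t => γ ⌈|t|⌉₊ t, by simpa using hγ0 _, fun t => ?_⟩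
  have hlt : ∀ s : ℝ, |s| < (⌈|s|⌉₊ : ℝ) + 1 := fun s => (Nat.le_ceil _).trans_lt (lt_add_one _)
  refine (hd ⌈|t|⌉₊ t (abs_lt.1 (hlt t))).congr_of_eventuallyEq ?_
  filter_upwards [continuous_abs.continuousAt.eventually_lt continuousAt_const (hlt t)] with s hs
  exact hmono' _ _ s (hlt s) hs

/-- Functions on `ℝ × V` which are bounded and Lipschitz in the second variable, uniformly for
the first variable in `S`. -/
def BddLip {V : Type*} [NormedAddCommGroup V] (S : Set ℝ) (g : ℝ → V → ℝ) : Prop :=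
  ∃ K : ℝ, 0 ≤ K ∧ ∀ t ∈ S, (∀ x, |g t x| ≤ K) ∧ ∀ x y, |g t x - g t y| ≤ K * ‖x - y‖

namespace BddLip

variable {V : Type*} [NormedAddCommGroup V] {S : Set ℝ} {f g : ℝ → V → ℝ}

theorem add (hf : BddLip S f) (hg : BddLip S g) : BddLip S fun t x => f t x + g t x := by
  obtain ⟨K, hK, hf⟩ := hf
  obtain ⟨L, hL, hg⟩ := hg
  refine ⟨K + L, by positivity, fun t ht => ⟨fun x => ?_, fun x y => ?_⟩⟩
  · exact (abs_add_le _ _).trans (add_le_add ((hf t ht).1 x) ((hg t ht).1 x))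
  · rw [add_sub_add_comm, add_mul]
    exact (abs_add_le _ _).trans (add_le_add ((hf t ht).2 x y) ((hg t ht).2 x y))

theorem mul (hf : BddLip S f) (hg : BddLip S g) : BddLip S fun t x => f t x * g t x := by
  obtain ⟨K, hK, hf⟩ := hf
  obtain ⟨L, hL, hg⟩ := hg
  refine ⟨2 * K * L + K * L, by positivity, fun t ht => ⟨fun x => ?_, fun x y => ?_⟩⟩
  · rw [abs_mul]
    have := mul_le_mul ((hf t ht).1 x) ((hg t ht).1 x) (abs_nonneg _) hK
    nlinarith [mul_nonneg hK hL]
  · have h1 : f t x * g t x - f t y * g t y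
        = f t x * (g t x - g t y) + (f t x - f t y) * g t y := by ring
    rw [h1]
    refine (abs_add_le _ _).trans ?_
    rw [abs_mul, abs_mul]
    have h2 := mul_le_mul ((hf t ht).1 x) ((hg t ht).2 x y) (abs_nonneg _) hK
    have h3 := mul_le_mul ((hf t ht).2 x y) ((hg t ht).1 y) (abs_nonneg _)
      (mul_nonneg hK (norm_nonneg _))
    nlinarith [mul_nonneg (mul_nonneg hK hL) (norm_nonneg (x - y))]

theorem of_continuous {c : ℝ → ℝ} (hS : IsCompact S) (hc : Continuous c) :
    BddLip S fun t (_ : V) => c t := by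
  obtain ⟨K, hK⟩ := hS.exists_bound_of_continuousOn hc.continuousOn
  refine ⟨|K|, abs_nonneg _, fun t ht => ⟨fun _ => (hK t ht).trans (le_abs_self K), fun x y => ?_⟩⟩
  simp only [sub_self, abs_zero]
  positivity

theorem sum {ι : Type*} (s : Finset ι) {f : ι → ℝ → V → ℝ} (hf : ∀ i, BddLip S (f i)) :
    BddLip S fun t x => ∑ i ∈ s, f i t x := by
  classical
  induction s using Finset.induction_on with
  | empty => exact ⟨0, le_rfl, by simp⟩
  | insert i s hi ih =>
    simp only [Finset.sum_insert hi]
    exact (hf i).add ih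

theorem sin_apply {ι : Type*} [Fintype ι] (m : ℝ) (i : ι) :
    BddLip S fun _ (x : ι → ℝ) => Real.sin (m * x i) := by
  refine ⟨max 1 |m|, by positivity, fun t _ => ⟨fun x => ?_, fun x y => ?_⟩⟩
  · exact (Real.abs_sin_le_one _).trans (le_max_left _ _)
  · have h1 : |Real.sin (m * x i) - Real.sin (m * y i)| ≤ |m * x i - m * y i| := by
      simpa [Real.dist_eq] using Real.lipschitzWith_sin.dist_le_mul (m * x i) (m * y i)
    refine h1.trans ?_
    rw [← mul_sub, abs_mul]
    exact mul_le_mul (le_max_right _ _) (norm_le_pi_norm (x - y) i) (abs_nonneg _) (by positivity)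

theorem cos_apply {ι : Type*} [Fintype ι] (m : ℝ) (i : ι) :
    BddLip S fun _ (x : ι → ℝ) => Real.cos (m * x i) := by
  refine ⟨max 1 |m|, by positivity, fun t _ => ⟨fun x => ?_, fun x y => ?_⟩⟩
  · exact (Real.abs_cos_le_one _).trans (le_max_left _ _)
  · have h1 : |Real.cos (m * x i) - Real.cos (m * y i)| ≤ |m * x i - m * y i| := by
      simpa [Real.dist_eq] using Real.lipschitzWith_cos.dist_le_mul (m * x i) (m * y i)
    refine h1.trans ?_
    rw [← mul_sub, abs_mul]
    exact mul_le_mul (le_max_right _ _) (norm_le_pi_norm (x - y) i) (abs_nonneg _) (by positivity)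

/-- A vector field on `ι → ℝ` with bounded Lipschitz components is bounded and Lipschitz. -/
theorem pi {ι : Type*} [Fintype ι] {G : ℝ → (ι → ℝ) → ι → ℝ}
    (hG : ∀ j, BddLip S fun t x => G t x j) :
    ∃ K : ℝ≥0, ∀ t ∈ S, LipschitzWith K (G t) ∧ ∀ x, ‖G t x‖ ≤ K := by
  choose K hK h using hG
  have hle : ∀ j, K j ≤ ∑ i, K i := fun j =>
    Finset.single_le_sum (f := K) (fun i _ => hK i) (Finset.mem_univ j)
  have h0 : 0 ≤ ∑ i, K i := Finset.sum_nonneg fun i _ => hK i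
  refine ⟨⟨∑ i, K i, h0⟩, fun t ht => ⟨LipschitzWith.of_dist_le_mul fun x y => ?_, fun x => ?_⟩⟩
  · rw [dist_eq_norm, dist_eq_norm]
    refine (pi_norm_le_iff_of_nonneg (by positivity)).2 fun j => ?_
    exact ((h j t ht).2 x y).trans (mul_le_mul_of_nonneg_right (hle j) (norm_nonneg _))
  · exact (pi_norm_le_iff_of_nonneg h0).2 fun j => ((h j t ht).1 x).trans (hle j)

end BddLip

/-! ### Functions whose primitive stays bounded at infinity -/

/-- `h` is, up to an error of size `x ^ (-1 - η)`, the derivative of a bounded function. -/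
def BddPrimitive (η : ℝ) (h : ℝ → ℝ) : Prop :=
  ∃ H H' : ℝ → ℝ, (∀ᶠ x in atTop, HasDerivAt H (H' x) x) ∧ H =O[atTop] (fun _ => (1 : ℝ)) ∧
    (fun x => h x - H' x) =O[atTop] fun x : ℝ => x ^ (-1 - η)

namespace BddPrimitive

variable {η : ℝ} {f g : ℝ → ℝ}

theorem of_isBigO (hf : f =O[atTop] fun x : ℝ => x ^ (-1 - η)) : BddPrimitive η f :=
  ⟨fun _ => 0, fun _ => 0, Eventually.of_forall fun x => hasDerivAt_const x 0,
    isBigO_zero _ _, by simpa using hf⟩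

theorem congr (hf : BddPrimitive η f) (h : f =ᶠ[atTop] g) : BddPrimitive η g := by
  obtain ⟨H, H', h1, h2, h3⟩ := hf
  exact ⟨H, H', h1, h2, h3.congr' (h.mono fun x hx => by simp only [hx]) EventuallyEq.rfl⟩

theorem add (hf : BddPrimitive η f) (hg : BddPrimitive η g) :
    BddPrimitive η fun x => f x + g x := by
  obtain ⟨H, H', h1, h2, h3⟩ := hf
  obtain ⟨G, G', g1, g2, g3⟩ := hg
  refine ⟨fun x => H x + G x, fun x => H' x + G' x, ?_, h2.add g2, ?_⟩
  · filter_upwards [h1, g1] with x hx gx using hx.add gx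
  · exact (h3.add g3).congr_left fun x => by ring

theorem const_mul (c : ℝ) (hf : BddPrimitive η f) : BddPrimitive η fun x => c * f x := by
  obtain ⟨H, H', h1, h2, h3⟩ := hf
  refine ⟨fun x => c * H x, fun x => c * H' x, ?_, h2.const_mul_left c, ?_⟩
  · filter_upwards [h1] with x hx using hx.const_mul c
  · exact (h3.const_mul_left c).congr_left fun x => by ring

theorem sum {ι : Type*} (s : Finset ι) {f : ι → ℝ → ℝ} (hf : ∀ i ∈ s, BddPrimitive η (f i)) :
    BddPrimitive η fun x => ∑ i ∈ s, f i x := by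
  classical
  induction s using Finset.induction_on with
  | empty => exact of_isBigO (by simpa using isBigO_zero _ _)
  | insert i s hi ih =>
    simp only [Finset.sum_insert hi]
    exact (hf i (by simp)).add (ih fun j hj => hf j (by simp [hj]))

/-- An oscillating integral: if the phase has derivative close to `D * x ^ β`, `β ≥ -1`, then
`cos φ / x` has a bounded primitive. -/
theorem cos_div {β D : ℝ} (hD : D ≠ 0) (hβ : 0 ≤ 1 + β) (hη : η ≤ 1 + β) {φ φ' : ℝ → ℝ}
    (hφ : ∀ᶠ x in atTop, HasDerivAt φ (φ' x) x)
    (herr : (fun x => φ' x - D * x ^ β) =O[atTop] fun x : ℝ => x ^ (β - η)) :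
    BddPrimitive η fun x => Real.cos (φ x) / x := by
  have hcos : (fun x => Real.cos (φ x)) =O[atTop] (fun _ : ℝ => (1 : ℝ)) :=
    IsBigO.of_bound 1 (Eventually.of_forall fun x => by simpa using Real.abs_cos_le_one _)
  have hsin : (fun x => Real.sin (φ x)) =O[atTop] (fun _ : ℝ => (1 : ℝ)) :=
    IsBigO.of_bound 1 (Eventually.of_forall fun x => by simpa using Real.abs_sin_le_one _)
  refine ⟨fun x => Real.sin (φ x) * x ^ (-1 - β) / D, fun x => (Real.cos (φ x) * φ' x *
    x ^ (-1 - β) + Real.sin (φ x) * ((-1 - β) * x ^ (-1 - β - 1))) / D, ?_, ?_, ?_⟩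
  · filter_upwards [hφ, eventually_gt_atTop 0] with x hx hx0
    exact (hx.sin.mul (Real.hasDerivAt_rpow_const (Or.inl hx0.ne'))).div_const D
  · have h1 : (fun x : ℝ => x ^ (-1 - β)) =O[atTop] (fun _ : ℝ => (1 : ℝ)) := by
      refine IsBigO.of_bound 1 ?_
      filter_upwards [eventually_ge_atTop 1] with x hx
      rw [Real.norm_of_nonneg (by positivity)]
      simpa using Real.rpow_le_one_of_one_le_of_nonpos hx (by linarith)
    have h2 := ((hsin.mul h1).const_mul_left D⁻¹)
    refine h2.congr (fun x => ?_) (fun x => by simp)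
    ring
  · have h1 : (fun x => Real.cos (φ x) * ((φ' x - D * x ^ β) * x ^ (-1 - β)))
        =O[atTop] fun x : ℝ => x ^ (-1 - η) := by
      refine (hcos.mul (herr.mul (isBigO_refl (fun x : ℝ => x ^ (-1 - β)) atTop))).congr'
        EventuallyEq.rfl ?_
      filter_upwards [eventually_gt_atTop 0] with x hx
      rw [one_mul, ← Real.rpow_add hx]
      congr 1
      ring
    have h2 : (fun x => Real.sin (φ x) * x ^ (-1 - β - 1))
        =O[atTop] fun x : ℝ => x ^ (-1 - η) := by
      refine (hsin.mul (isBigO_refl (fun x : ℝ => x ^ (-1 - β - 1)) atTop)).trans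
        (IsBigO.of_bound 1 ?_)
      filter_upwards [eventually_ge_atTop 1] with x hx
      rw [one_mul, one_mul, Real.norm_of_nonneg (by positivity),
        Real.norm_of_nonneg (by positivity)]
      exact Real.rpow_le_rpow_of_exponent_le hx (by linarith)
    refine ((h1.const_mul_left (-D⁻¹)).add (h2.const_mul_left (-(D⁻¹ * (-1 - β))))).congr'
      ?_ EventuallyEq.rfl
    filter_upwards [eventually_gt_atTop 0] with x hx
    have h3 : x ^ β * x ^ (-1 - β) = x⁻¹ := by
      rw [← Real.rpow_add hx, ← Real.rpow_neg_one]
      congr 1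
      ring
    have h4 : D⁻¹ * D = 1 := inv_mul_cancel₀ hD
    rw [div_eq_mul_inv, div_eq_mul_inv, ← h3]
    linear_combination (Real.cos (φ x) * (x ^ β * x ^ (-1 - β))) * h4

/-- A function with derivative `-κ / x + h`, with `h` of bounded primitive, is at most
`C - κ log x`. -/
theorem exists_le_sub_log {κ : ℝ} {L : ℝ → ℝ} (hη : 0 < η) (hf : BddPrimitive η f)
    (hL : ∀ᶠ x in atTop, HasDerivAt L (-κ / x + f x) x) :
    ∃ C, ∀ᶠ x in atTop, L x ≤ C - κ * Real.log x := by
  obtain ⟨H, H', h1, h2, h3⟩ := hf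
  obtain ⟨B, hB⟩ := h2.bound
  obtain ⟨C, hC⟩ := h3.bound
  obtain ⟨X, hX⟩ := eventually_atTop.1 (((h1.and hB).and (hC.and hL)).and (eventually_gt_atTop 0))
  have hX0 : 0 < X := (hX X le_rfl).2
  set M : ℝ → ℝ := fun x => L x + κ * Real.log x - H x + |C| / η * x ^ (-η) with hM
  have hd : ∀ x, X ≤ x → HasDerivAt M
      ((-κ / x + f x) + κ * x⁻¹ - H' x + |C| / η * (-η * x ^ (-η - 1))) x := by
    intro x hx
    obtain ⟨⟨⟨a1, -⟩, -, a4⟩, a5⟩ := hX x hx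
    exact ((a4.add ((Real.hasDerivAt_log a5.ne').const_mul κ)).sub a1).add
      ((Real.hasDerivAt_rpow_const (Or.inl a5.ne')).const_mul _)
  have hanti : AntitoneOn M (Ici X) := by
    refine antitoneOn_of_deriv_nonpos (convex_Ici X)
      (fun x hx => (hd x hx).continuousAt.continuousWithinAt)
      (fun x hx => (hd x (interior_subset hx)).differentiableAt.differentiableWithinAt)
      fun x hx => ?_
    have hx' : X ≤ x := interior_subset hx
    rw [(hd x hx').deriv]
    obtain ⟨⟨-, a3, -⟩, a5⟩ := hX x hx'
    rw [Real.norm_of_nonneg (Real.rpow_nonneg a5.le _), Real.norm_eq_abs] at a3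
    have e1 : |C| / η * (-η * x ^ (-η - 1)) = -(|C| * x ^ (-1 - η)) := by
      rw [show -η - 1 = -1 - η by ring]
      field_simp
    have e2 : -κ / x + κ * x⁻¹ = 0 := by ring
    have e3 := mul_le_mul_of_nonneg_right (le_abs_self C) (Real.rpow_nonneg a5.le (-1 - η))
    rw [e1]
    linarith [le_abs_self (f x - H' x)]
  refine ⟨M X + B, eventually_atTop.2 ⟨X, fun x hx => ?_⟩⟩
  have h4 := hanti self_mem_Ici hx hx
  obtain ⟨⟨⟨-, a2⟩, -⟩, a5⟩ := hX x hx
  rw [norm_one, mul_one, Real.norm_eq_abs] at a2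
  have h5 : 0 ≤ |C| / η * x ^ (-η) := by positivity
  simp only [hM] at h4 ⊢
  linarith [le_abs_self (H x)]

end BddPrimitive

/-! ### Asymptotics of the Prüfer weight `√(x ^ α + e)` -/

section Weight

variable {α : ℝ}

theorem eventually_weight_bounds (hα : 0 < α) (e : ℝ) :
    ∀ᶠ x : ℝ in atTop, 0 < x ∧ x ^ α = x ^ (α / 2) * x ^ (α / 2) ∧ 0 < x ^ (α / 2) ∧
      0 < x ^ α + e ∧ √(x ^ α + e) * √(x ^ α + e) = x ^ α + e ∧
      x ^ (α / 2) ≤ 2 * √(x ^ α + e) := by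
  filter_upwards [eventually_gt_atTop 0,
    (tendsto_rpow_atTop hα).eventually_ge_atTop (2 * |e| + 1)] with x hx hxe
  have h1 : x ^ α = x ^ (α / 2) * x ^ (α / 2) := by
    rw [← Real.rpow_add hx]
    congr 1
    ring
  have h2 : 0 < x ^ α + e := by linarith [neg_abs_le e, abs_nonneg e]
  have h3 := Real.mul_self_sqrt h2.le
  refine ⟨hx, h1, by positivity, h2, h3, ?_⟩
  refine abs_le_of_sq_le_sq' ?_ (by positivity) |>.2
  nlinarith [neg_abs_le e]

theorem isBigO_sqrt_sub (hα : 0 < α) (e : ℝ) :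
    (fun x : ℝ => √(x ^ α + e) - x ^ (α / 2) - e / 2 * x ^ (-(α / 2)))
      =O[atTop] fun x : ℝ => x ^ (-(3 * α / 2)) := by
  refine IsBigO.of_bound (e ^ 2) ?_
  filter_upwards [eventually_weight_bounds hα e] with x ⟨hx, h1, hy, _, h3, h4⟩
  have h5 : x ^ (-(α / 2)) = (x ^ (α / 2))⁻¹ := Real.rpow_neg hx.le _
  have h6 : x ^ (-(3 * α / 2)) = ((x ^ (α / 2)) ^ 3)⁻¹ := by
    rw [Real.rpow_neg hx.le, ← Real.rpow_natCast, ← Real.rpow_mul hx.le]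
    congr 2
    push_cast
    ring
  rw [h5, h6, Real.norm_eq_abs, Real.norm_of_nonneg (by positivity)]
  set y := x ^ (α / 2)
  set w := √(x ^ α + e)
  have hw : 0 < w := by linarith
  have he : e = w * w - y * y := by linarith
  have h7 : w - y - e / 2 * y⁻¹ = -(e ^ 2 / (2 * y * (w + y) ^ 2)) := by
    have : w + y ≠ 0 := by positivity
    rw [he]
    field_simp
    ring
  rw [h7, abs_neg, abs_of_nonneg (by positivity), ← div_eq_mul_inv]
  refine div_le_div_of_nonneg_left (by positivity) (by positivity) ?_
  have h8 : y ^ 2 ≤ (w + y) ^ 2 := by nlinarith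
  have h9 : y ^ 3 = y * y ^ 2 := by ring
  rw [h9]
  exact mul_le_mul (by linarith) h8 (by positivity) (by positivity)

theorem isBigO_rpow_div_sqrt_sub (hα : 0 < α) (e : ℝ) :
    (fun x : ℝ => x ^ (α / 2 - 1) / √(x ^ α + e) - 1 / x)
      =O[atTop] fun x : ℝ => x ^ (-1 - α) := by
  refine IsBigO.of_bound (2 * |e|) ?_
  filter_upwards [eventually_weight_bounds hα e] with x ⟨hx, h1, hy, _, h3, h4⟩
  have h5 : x ^ (-1 - α) = x⁻¹ * (x ^ (α / 2) * x ^ (α / 2))⁻¹ := by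
    rw [← h1, ← Real.rpow_neg hx.le, ← Real.rpow_neg_one, ← Real.rpow_add hx]
    rfl
  rw [Real.rpow_sub_one hx.ne', h5, Real.norm_eq_abs, Real.norm_of_nonneg (by positivity)]
  set y := x ^ (α / 2)
  set w := √(x ^ α + e)
  have hw : 0 < w := by linarith
  have he : e = w * w - y * y := by linarith
  have h7 : y / x / w - 1 / x = -(e / (x * (w * (w + y)))) := by
    have : w + y ≠ 0 := by positivity
    rw [he]
    field_simp
    ring
  rw [h7, abs_neg, abs_div, abs_of_pos (by positivity : 0 < x * (w * (w + y))),
    div_le_iff₀ (by positivity)]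
  have h8 : 2 * |e| * (x⁻¹ * (y * y)⁻¹) * (x * (w * (w + y)))
      = |e| * (2 * w * (w + y) / (y * y)) := by
    field_simp
  rw [h8]
  refine le_mul_of_one_le_right (abs_nonneg e) ((one_le_div (by positivity)).2 ?_)
  exact mul_le_mul h4 (by linarith) hy.le (by positivity)

theorem isBigO_rpow_div_sub (hα : 0 < α) (e : ℝ) :
    (fun x : ℝ => x ^ (α - 1) / (x ^ α + e) - 1 / x) =O[atTop] fun x : ℝ => x ^ (-1 - α) := by
  refine IsBigO.of_bound (4 * |e|) ?_
  filter_upwards [eventually_weight_bounds hα e] with x ⟨hx, h1, hy, h2, h3, h4⟩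
  have h5 : x ^ (-1 - α) = x⁻¹ * (x ^ α)⁻¹ := by
    rw [← Real.rpow_neg hx.le, ← Real.rpow_neg_one, ← Real.rpow_add hx]
    rfl
  have hz : 0 < x ^ α := by positivity
  have h6 : x ^ α ≤ 4 * (x ^ α + e) := by nlinarith
  rw [Real.rpow_sub_one hx.ne', h5, Real.norm_eq_abs, Real.norm_of_nonneg (by positivity)]
  have h7 : x ^ α / x / (x ^ α + e) - 1 / x = -(e / (x * (x ^ α + e))) := by
    field_simp
    ring
  rw [h7, abs_neg, abs_div, abs_of_pos (by positivity : 0 < x * (x ^ α + e)),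
    div_le_iff₀ (by positivity)]
  have h8 : 4 * |e| * (x⁻¹ * (x ^ α)⁻¹) * (x * (x ^ α + e))
      = |e| * (4 * (x ^ α + e) / x ^ α) := by
    field_simp
  rw [h8]
  exact le_mul_of_one_le_right (abs_nonneg e) ((one_le_div hz).2 h6)

end Weight

/-! ### Asymptotics of the Prüfer variables -/

theorem isBigO_rpow_atTop_of_le {a b : ℝ} (h : a ≤ b) :
    (fun x : ℝ => x ^ a) =O[atTop] fun x : ℝ => x ^ b := by
  refine IsBigO.of_bound 1 ?_
  filter_upwards [eventually_ge_atTop 1] with x hx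
  rw [one_mul, Real.norm_of_nonneg (by positivity), Real.norm_of_nonneg (by positivity)]
  exact Real.rpow_le_rpow_of_exponent_le hx h

/-- An odd wave profile with values in `[-1, 1]` whose correlation with `sin` exceeds that of
`sin` itself. -/
noncomputable def waveProfile (s : ℝ) : ℝ := (3 * Real.sin s - Real.sin s ^ 3) / 2

theorem abs_waveProfile_le_one (s : ℝ) : |waveProfile s| ≤ 1 := by
  have h1 := Real.neg_one_le_sin s
  have h2 := Real.sin_le_one s
  have e1 := mul_nonneg (sq_nonneg (Real.sin s - 1)) (by linarith : 0 ≤ 2 + Real.sin s)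
  have e2 := mul_nonneg (sq_nonneg (Real.sin s + 1)) (by linarith : 0 ≤ 2 - Real.sin s)
  unfold waveProfile
  exact abs_le.2 ⟨by linarith, by linarith⟩

theorem waveProfile_mul_sin (s t : ℝ) :
    waveProfile (2 * s) * Real.sin (2 * t) =
      9 / 16 * (Real.cos (2 * s + -2 * t) - Real.cos (2 * s + 2 * t)) +
        1 / 16 * (Real.cos (6 * s + -2 * t) - Real.cos (6 * s + 2 * t)) := by
  have h1 : Real.sin (6 * s) = 3 * Real.sin (2 * s) - 4 * Real.sin (2 * s) ^ 3 := by
    rw [← Real.sin_three_mul]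
    congr 1
    ring
  rw [waveProfile, Real.cos_add, Real.cos_add, Real.cos_add, Real.cos_add, neg_mul,
    Real.sin_neg, Real.cos_neg, h1]
  ring

theorem abs_sum_waveProfile_le {N : ℕ} (s : Fin N → ℝ) : |∑ i, waveProfile (s i)| ≤ N := by
  refine (Finset.abs_sum_le_sum_abs _ _).trans ?_
  simpa using Finset.sum_le_sum fun i (_ : i ∈ Finset.univ) => abs_waveProfile_le_one (s i)

section Phases

variable {α η : ℝ} {N : ℕ} {E : Fin N → ℝ} {Θ Θ' : Fin N → ℝ → ℝ}

theorem bddPrimitive_cos_phase (hα0 : 0 < α) (hα2 : α < 2) (hE : Function.Injective E)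
    (hη : η ≤ α) (hη' : η ≤ 1 - α / 2)
    (hΘ : ∀ j, ∀ᶠ x in atTop, HasDerivAt (Θ j) (Θ' j x) x)
    (hasym : ∀ j, (fun x => Θ' j x - x ^ (α / 2) - E j / 2 * x ^ (-(α / 2)))
      =O[atTop] fun x : ℝ => x ^ (-(α / 2) - η))
    {a b : ℝ} {i j : Fin N} (h : a + b ≠ 0 ∨ (b = -a ∧ a ≠ 0 ∧ i ≠ j)) :
    BddPrimitive η fun x => Real.cos (a * Θ i x + b * Θ j x) / x := by
  have hd : ∀ᶠ x in atTop, HasDerivAt (fun x => a * Θ i x + b * Θ j x)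
      (a * Θ' i x + b * Θ' j x) x := by
    filter_upwards [hΘ i, hΘ j] with x hi hj using (hi.const_mul a).add (hj.const_mul b)
  have hsum := ((hasym i).const_mul_left a).add ((hasym j).const_mul_left b)
  rcases h with h | ⟨rfl, ha, hij⟩
  · refine BddPrimitive.cos_div (β := α / 2) h (by linarith) (by linarith) hd ?_
    have h1 := (isBigO_rpow_atTop_of_le (a := -(α / 2)) (b := α / 2 - η)
      (by linarith)).const_mul_left ((a * E i + b * E j) / 2)
    refine ((hsum.trans (isBigO_rpow_atTop_of_le (b := α / 2 - η) (by linarith))).add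
      h1).congr_left fun x => ?_
    ring
  · have hE' : E i - E j ≠ 0 := sub_ne_zero.2 fun h => hij (hE h)
    refine BddPrimitive.cos_div (β := -(α / 2)) (D := a * (E i - E j) / 2) (by positivity)
      (by linarith) (by linarith) hd (hsum.congr_left fun x => ?_)
    ring

theorem bddPrimitive_sum_waveProfile (hα0 : 0 < α) (hα2 : α < 2) (hE : Function.Injective E)
    (hη : η ≤ α) (hη' : η ≤ 1 - α / 2)
    (hΘ : ∀ j, ∀ᶠ x in atTop, HasDerivAt (Θ j) (Θ' j x) x)
    (hasym : ∀ j, (fun x => Θ' j x - x ^ (α / 2) - E j / 2 * x ^ (-(α / 2)))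
      =O[atTop] fun x : ℝ => x ^ (-(α / 2) - η)) (j : Fin N) :
    BddPrimitive η fun x =>
      (∑ i, waveProfile (2 * Θ i x)) * Real.sin (2 * Θ j x) / x - 9 / 16 / x := by
  have hph : ∀ (a b : ℝ) (i : Fin N), (a + b ≠ 0 ∨ (b = -a ∧ a ≠ 0 ∧ i ≠ j)) →
      BddPrimitive η fun x => Real.cos (a * Θ i x + b * Θ j x) / x := fun a b i h =>
    bddPrimitive_cos_phase hα0 hα2 hE hη hη' hΘ hasym h
  have hterm : ∀ i ∈ Finset.univ, BddPrimitive η fun x =>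
      waveProfile (2 * Θ i x) * Real.sin (2 * Θ j x) / x - if i = j then 9 / 16 / x else 0 := by
    intro i _
    have h1 := (hph 2 2 i (Or.inl (by norm_num))).const_mul (-(9 / 16))
    have h2 := (hph 6 (-2) i (Or.inl (by norm_num))).const_mul (1 / 16)
    have h3 := (hph 6 2 i (Or.inl (by norm_num))).const_mul (-(1 / 16))
    by_cases hij : i = j
    · subst hij
      refine ((h1.add h2).add h3).congr (Eventually.of_forall fun x => ?_)
      have h0 : Real.cos (2 * Θ i x + -2 * Θ i x) = 1 := by simp
      simp only [waveProfile_mul_sin, h0, if_true]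
      ring
    · have h4 := (hph 2 (-2) i (Or.inr ⟨by norm_num, by norm_num, hij⟩)).const_mul (9 / 16)
      refine (((h4.add h1).add h2).add h3).congr (Eventually.of_forall fun x => ?_)
      simp only [waveProfile_mul_sin, hij, if_false]
      ring
  refine (BddPrimitive.sum Finset.univ hterm).congr (Eventually.of_forall fun x => ?_)
  simp only [Finset.sum_sub_distrib, Finset.sum_ite_eq', Finset.mem_univ, if_true,
    Finset.sum_mul, Finset.sum_div]

/-- Asymptotics of the Prüfer angle equation. -/
theorem isBigO_angle_field (hα0 : 0 < α) (e : ℝ) (hη : η ≤ α) (hη' : η ≤ 1 - α / 2)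
    {S θ : ℝ → ℝ} {B : ℝ} (hS : ∀ x, |S x| ≤ B) :
    (fun x => (√(x ^ α + e) + (2 - α) * x ^ (α / 2 - 1) * S x / √(x ^ α + e) * Real.sin (θ x) ^ 2
      + α / 2 * x ^ (α - 1) / (x ^ α + e) * (Real.sin (θ x) * Real.cos (θ x)))
      - x ^ (α / 2) - e / 2 * x ^ (-(α / 2))) =O[atTop] fun x : ℝ => x ^ (-(α / 2) - η) := by
  have hinv : (fun x : ℝ => 1 / x) =O[atTop] fun x : ℝ => x ^ (-(α / 2) - η) := by
    refine (isBigO_rpow_atTop_of_le (a := -1) (by linarith)).congr' ?_ EventuallyEq.rfl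
    filter_upwards with x
    rw [Real.rpow_neg_one, one_div]
  have h1 := (isBigO_sqrt_sub hα0 e).trans
    (isBigO_rpow_atTop_of_le (b := -(α / 2) - η) (by linarith))
  have h2 : (fun x : ℝ => x ^ (α / 2 - 1) / √(x ^ α + e))
      =O[atTop] fun x : ℝ => x ^ (-(α / 2) - η) :=
    (((isBigO_rpow_div_sqrt_sub hα0 e).trans
      (isBigO_rpow_atTop_of_le (by linarith))).add hinv).congr_left fun x => by ring
  have h3 : (fun x : ℝ => x ^ (α - 1) / (x ^ α + e))
      =O[atTop] fun x : ℝ => x ^ (-(α / 2) - η) :=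
    (((isBigO_rpow_div_sub hα0 e).trans
      (isBigO_rpow_atTop_of_le (by linarith))).add hinv).congr_left fun x => by ring
  have b1 : (fun x => S x * Real.sin (θ x) ^ 2) =O[atTop] fun _ => (1 : ℝ) := by
    refine IsBigO.of_bound B (Eventually.of_forall fun x => ?_)
    rw [norm_one, mul_one, Real.norm_eq_abs, abs_mul, abs_of_nonneg (sq_nonneg (Real.sin (θ x)))]
    exact (mul_le_of_le_one_right (abs_nonneg _) (Real.sin_sq_le_one _)).trans (hS x)
  have b2 : (fun x => Real.sin (θ x) * Real.cos (θ x)) =O[atTop] fun _ => (1 : ℝ) := by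
    refine IsBigO.of_bound 1 (Eventually.of_forall fun x => ?_)
    rw [norm_one, mul_one, Real.norm_eq_abs, abs_mul]
    exact mul_le_one₀ (Real.abs_sin_le_one _) (abs_nonneg _) (Real.abs_cos_le_one _)
  have h4 := ((h2.mul b1).const_mul_left (2 - α)).congr_right fun x => mul_one _
  have h5 := ((h3.mul b2).const_mul_left (α / 2)).congr_right fun x => mul_one _
  refine ((h1.add h4).add h5).congr_left fun x => ?_
  ring

/-- Asymptotics of the logarithmic derivative of the Prüfer amplitude. -/
theorem bddPrimitive_amplitude (hα0 : 0 < α) (hα2 : α < 2) (hE : Function.Injective E)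
    (hη : η ≤ α) (hη' : η ≤ 1 - α / 2)
    (hΘ : ∀ j, ∀ᶠ x in atTop, HasDerivAt (Θ j) (Θ' j x) x)
    (hasym : ∀ j, (fun x => Θ' j x - x ^ (α / 2) - E j / 2 * x ^ (-(α / 2)))
      =O[atTop] fun x : ℝ => x ^ (-(α / 2) - η)) (j : Fin N) :
    BddPrimitive η fun x =>
      (-(2 - α) * x ^ (α / 2 - 1) * (∑ i, waveProfile (2 * Θ i x)) / √(x ^ α + E j) *
        (Real.sin (Θ j x) * Real.cos (Θ j x))
        - α / 2 * x ^ (α - 1) / (x ^ α + E j) * Real.cos (Θ j x) ^ 2)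
        + (α / 4 + (2 - α) * (9 / 32)) / x := by
  have h1 := (bddPrimitive_sum_waveProfile hα0 hα2 hE hη hη' hΘ hasym j).const_mul (-((2 - α) / 2))
  have h2 := (bddPrimitive_cos_phase hα0 hα2 hE hη hη' hΘ hasym (a := 2) (b := 0) (i := j)
    (j := j) (Or.inl (by norm_num))).const_mul (-(α / 4))
  have b1 : (fun x => (∑ i, waveProfile (2 * Θ i x)) * (Real.sin (Θ j x) * Real.cos (Θ j x)))
      =O[atTop] fun _ => (1 : ℝ) := by
    refine IsBigO.of_bound N (Eventually.of_forall fun x => ?_)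
    rw [norm_one, mul_one, Real.norm_eq_abs, abs_mul, abs_mul]
    exact (mul_le_of_le_one_right (abs_nonneg _) (mul_le_one₀ (Real.abs_sin_le_one _)
      (abs_nonneg _) (Real.abs_cos_le_one _))).trans (abs_sum_waveProfile_le _)
  have b2 : (fun x => Real.cos (Θ j x) ^ 2) =O[atTop] fun _ => (1 : ℝ) := by
    refine IsBigO.of_bound 1 (Eventually.of_forall fun x => ?_)
    rw [norm_one, mul_one, Real.norm_eq_abs, abs_of_nonneg (sq_nonneg _)]
    exact Real.cos_sq_le_one _
  have hle := isBigO_rpow_atTop_of_le (a := -1 - α) (b := -1 - η) (by linarith)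
  have h3 := BddPrimitive.of_isBigO (((((isBigO_rpow_div_sqrt_sub hα0 (E j)).mul b1).congr_right
    fun x => mul_one _).trans hle).const_mul_left (-(2 - α)))
  have h4 := BddPrimitive.of_isBigO (((((isBigO_rpow_div_sub hα0 (E j)).mul b2).congr_right
    fun x => mul_one _).trans hle).const_mul_left (-(α / 2)))
  refine (((h1.add h2).add h3).add h4).congr (Eventually.of_forall fun x => ?_)
  simp only [zero_mul, add_zero]
  rw [Real.cos_two_mul, Real.sin_two_mul]
  ring

end Phases

/-! ### The coupled system of Prüfer angles -/

section AngleField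

variable {N : ℕ} {A B C D : Fin N → ℝ → ℝ}

/-- The vector field driving the Prüfer angles. -/
noncomputable def angleField (A B C D : Fin N → ℝ → ℝ) (t : ℝ) (θ : Fin N → ℝ) (j : Fin N) : ℝ :=
  A j t * Real.cos (θ j) ^ 2 + B j t * Real.sin (θ j) ^ 2 +
    C j t * (Real.sin (θ j) * Real.cos (θ j)) +
    D j t * (∑ i, waveProfile (2 * θ i)) * Real.sin (θ j) ^ 2

theorem exists_angles (hA : ∀ j, Continuous (A j)) (hB : ∀ j, Continuous (B j))
    (hC : ∀ j, Continuous (C j)) (hD : ∀ j, Continuous (D j)) (θ₀ : Fin N → ℝ) :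
    ∃ Θ : ℝ → Fin N → ℝ, Θ 0 = θ₀ ∧ ∀ t, HasDerivAt Θ (angleField A B C D t (Θ t)) t := by
  refine exists_global_integralCurve (fun x => continuous_pi fun j => ?_) (fun T => ?_) θ₀
  · have := hA j
    have := hB j
    have := hC j
    have := hD j
    unfold angleField
    fun_prop
  · refine BddLip.pi fun j => ?_
    have hS : IsCompact (Icc (-T) T) := isCompact_Icc
    have hs := BddLip.sin_apply (S := Icc (-T) T) 1 j
    have hc := BddLip.cos_apply (S := Icc (-T) T) 1 j
    have hconst : ∀ a : ℝ, BddLip (V := Fin N → ℝ) (Icc (-T) T) fun _ _ => a := fun a =>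
      BddLip.of_continuous hS continuous_const
    have hwave : ∀ i, BddLip (Icc (-T) T) fun _ (x : Fin N → ℝ) => waveProfile (2 * x i) := by
      intro i
      have h2 := BddLip.sin_apply (S := Icc (-T) T) 2 i
      convert ((hconst (3 / 2)).mul h2).add ((hconst (-1 / 2)).mul (h2.mul (h2.mul h2)))
        using 3 with t x
      rw [waveProfile]
      ring
    convert ((((BddLip.of_continuous hS (hA j)).mul (hc.mul hc)).add
      ((BddLip.of_continuous hS (hB j)).mul (hs.mul hs))).add
      ((BddLip.of_continuous hS (hC j)).mul (hs.mul hc))).add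
      (((BddLip.of_continuous hS (hD j)).mul (BddLip.sum Finset.univ hwave)).mul (hs.mul hs))
      using 3 with t x
    simp only [angleField, one_mul]
    ring

theorem contDiffOn_angles (hA : ∀ j, ContDiffOn ℝ ∞ (A j) (Ioi 0))
    (hB : ∀ j, ContDiffOn ℝ ∞ (B j) (Ioi 0)) (hC : ∀ j, ContDiffOn ℝ ∞ (C j) (Ioi 0))
    (hD : ∀ j, ContDiffOn ℝ ∞ (D j) (Ioi 0)) {Θ : ℝ → Fin N → ℝ}
    (hΘ : ∀ t, HasDerivAt Θ (angleField A B C D t (Θ t)) t) : ContDiffOn ℝ ∞ Θ (Ioi 0) := by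
  intro x hx
  have hx : (0 : ℝ) < x := hx
  refine ContDiffAt.contDiffWithinAt ?_
  have hsub : Icc (x / 2) (2 * x) ⊆ Ioi 0 := fun t ht => lt_of_lt_of_le (half_pos hx) ht.1
  have hmaps : MapsTo (Prod.fst : ℝ × (Fin N → ℝ) → ℝ) (Icc (x / 2) (2 * x) ×ˢ univ) (Ioi 0) :=
    fun p hp => hsub hp.1
  have hfst : ∀ {f : ℝ → ℝ}, ContDiffOn ℝ ∞ f (Ioi 0) →
      ContDiffOn ℝ ∞ (fun p : ℝ × (Fin N → ℝ) => f p.1) (Icc (x / 2) (2 * x) ×ˢ univ) :=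
    fun hf => hf.comp contDiff_fst.contDiffOn hmaps
  have hfield : ContDiffOn ℝ ∞ (Function.uncurry (angleField A B C D))
      (Icc (x / 2) (2 * x) ×ˢ univ) := by
    refine contDiffOn_pi.2 fun j => ?_
    have h1 := hfst (hA j)
    have h2 := hfst (hB j)
    have h3 := hfst (hC j)
    have h4 := hfst (hD j)
    have hs : ContDiff ℝ ∞ fun p : ℝ × (Fin N → ℝ) => Real.sin (p.2 j) := by fun_prop
    have hc : ContDiff ℝ ∞ fun p : ℝ × (Fin N → ℝ) => Real.cos (p.2 j) := by fun_prop
    have hw : ContDiff ℝ ∞ fun p : ℝ × (Fin N → ℝ) => ∑ i, waveProfile (2 * p.2 i) := by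
      unfold waveProfile
      fun_prop
    exact (((h1.mul (hc.pow 2).contDiffOn).add (h2.mul (hs.pow 2).contDiffOn)).add
      (h3.mul (hs.mul hc).contDiffOn)).add ((h4.mul hw.contDiffOn).mul (hs.pow 2).contDiffOn)
  exact (ODE.contDiffOn_enat_Icc_of_hasDerivWithinAt (n := ⊤) hfield
    (fun t _ => (hΘ t).hasDerivWithinAt) (mapsTo_univ _ _)).contDiffAt
    (Icc_mem_nhds (by linarith) (by linarith))

end AngleField

/-- Reconstruction of a solution of `u'' = V u` from its Prüfer variables with weight `w`. -/
theorem hasDerivAt_of_prufer {w θ R : ℝ → ℝ} {w' V x : ℝ} (hw0 : w x ≠ 0)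
    (hw : HasDerivAt w w' x)
    (hθ : HasDerivAt θ (w x * Real.cos (θ x) ^ 2 - V / w x * Real.sin (θ x) ^ 2 +
      w' / w x * (Real.sin (θ x) * Real.cos (θ x))) x)
    (hR : HasDerivAt R ((w x * (Real.sin (θ x) * Real.cos (θ x)) +
      V / w x * (Real.sin (θ x) * Real.cos (θ x)) - w' / w x * Real.cos (θ x) ^ 2) * R x) x) :
    HasDerivAt (fun t => R t * Real.sin (θ t)) (w x * R x * Real.cos (θ x)) x ∧
      HasDerivAt (fun t => w t * R t * Real.cos (θ t)) (V * (R x * Real.sin (θ x))) x := by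
  constructor
  · refine (hR.mul hθ.sin).congr_deriv ?_
    linear_combination (w x * R x * Real.cos (θ x)) * Real.sin_sq_add_cos_sq (θ x)
  · refine ((hw.mul hR).mul hθ.cos).congr_deriv ?_
    simp only [Pi.mul_apply]
    field_simp
    linear_combination (R x * (Real.sin (θ x) * V - Real.cos (θ x) * w')) *
      Real.sin_sq_add_cos_sq (θ x)

/-! ### Cutoffs -/

/-- A smooth function on `(0, ∞)` becomes smooth on `ℝ` after multiplication by a cutoff. -/
theorem contDiff_smoothTransition_mul {X : ℝ} (hX : 0 < X) {f : ℝ → ℝ}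
    (hf : ∀ x, 0 < x → ContDiffAt ℝ ∞ f x) :
    ContDiff ℝ ∞ fun x => Real.smoothTransition (x - X) * f x := by
  refine contDiff_iff_contDiffAt.2 fun x => ?_
  rcases lt_or_ge x X with h | h
  · refine (contDiffAt_const (c := (0 : ℝ))).congr_of_eventuallyEq ?_
    filter_upwards [eventually_lt_nhds h] with y hy
    rw [Real.smoothTransition.zero_of_nonpos (by linarith), zero_mul]
  · exact (Real.smoothTransition.contDiff.comp
      (contDiff_id.sub contDiff_const)).contDiffAt.mul (hf x (hX.trans_le h))

/-- Square integrability from power decay. -/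
theorem integrableOn_sq_of_log_decay {L θ : ℝ → ℝ} {κ C : ℝ} (hκ : 1 < 2 * κ)
    (hLc : Continuous L) (hθ : Continuous θ)
    (hL : ∀ᶠ x in atTop, L x ≤ C - κ * Real.log x) :
    IntegrableOn (fun x => (Real.exp (L x) * Real.sin (θ x)) ^ 2) (Ioi 0) := by
  have hcont : Continuous fun x => (Real.exp (L x) * Real.sin (θ x)) ^ 2 := by fun_prop
  refine IntegrableOn.mono_set ?_ Ioi_subset_Ici_self
  refine (hcont.locallyIntegrable.locallyIntegrableOn _).integrableOn_of_isBigO_atTop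
    (g := fun x => x ^ (-(2 * κ))) ?_ (integrableAtFilter_rpow_atTop_iff.2 (by linarith))
  refine IsBigO.of_bound (Real.exp (2 * C)) ?_
  filter_upwards [hL, eventually_gt_atTop 0] with x hx hx0
  rw [Real.norm_of_nonneg (by positivity), Real.norm_of_nonneg (by positivity), mul_pow]
  calc Real.exp (L x) ^ 2 * Real.sin (θ x) ^ 2 ≤ Real.exp (L x) ^ 2 :=
        mul_le_of_le_one_right (by positivity) (Real.sin_sq_le_one _)
    _ = Real.exp (2 * L x) := by rw [← Real.exp_nat_mul]; norm_num
    _ ≤ Real.exp (2 * C + Real.log x * (-(2 * κ))) := Real.exp_le_exp.2 (by linarith)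
    _ = Real.exp (2 * C) * x ^ (-(2 * κ)) := by rw [Real.exp_add, Real.rpow_def_of_pos hx0]

theorem exists_prufer_weight {α : ℝ} (hα : 0 < α) (e : ℝ) :
    ∃ w : ℝ → ℝ, ContDiff ℝ ∞ w ∧ (∀ x, 0 < w x) ∧ w 0 = 1 ∧
      w =ᶠ[atTop] fun x => √(x ^ α + e) := by
  obtain ⟨X₀, hX₀⟩ := eventually_atTop.1 ((tendsto_rpow_atTop hα).eventually_ge_atTop (1 - e))
  set X := max X₀ 1
  have hX : 0 < X := lt_of_lt_of_le one_pos (le_max_right _ _)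
  have hp : ∀ x, 0 < Real.smoothTransition (x - X) * (x ^ α + e - 1) + 1 := by
    intro x
    rcases lt_or_ge x X with h | h
    · rw [Real.smoothTransition.zero_of_nonpos (by linarith)]
      norm_num
    · have h1 := hX₀ x ((le_max_left _ _).trans h)
      have h2 := Real.smoothTransition.nonneg (x - X)
      have h3 : 0 ≤ x ^ α + e - 1 := by linarith
      positivity
  refine ⟨fun x => √(Real.smoothTransition (x - X) * (x ^ α + e - 1) + 1), ?_,
    fun x => Real.sqrt_pos.2 (hp x), ?_, ?_⟩
  · refine ((contDiff_smoothTransition_mul hX fun x hx => ?_).add contDiff_const).sqrt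
      fun x => (hp x).ne'
    exact ((Real.contDiffAt_rpow_const_of_ne hx.ne').add contDiffAt_const).sub contDiffAt_const
  · beta_reduce
    rw [Real.smoothTransition.zero_of_nonpos (by linarith)]
    norm_num
  · filter_upwards [eventually_ge_atTop (X + 1)] with x hx
    rw [Real.smoothTransition.one_of_one_le (by linarith)]
    congr 1
    ring

theorem eventually_logDeriv_prufer_weight {α : ℝ} (hα : 0 < α) (e : ℝ) {w : ℝ → ℝ}
    (hw : w =ᶠ[atTop] fun x => √(x ^ α + e)) :
    ∀ᶠ x in atTop, deriv w x / w x = α / 2 * x ^ (α - 1) / (x ^ α + e) := by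
  obtain ⟨X, hX⟩ := eventually_atTop.1 hw
  filter_upwards [eventually_gt_atTop X, eventually_weight_bounds hα e]
    with x hx ⟨hx0, _, _, hpos, hsq, _⟩
  have h1 : HasDerivAt w (α * x ^ (α - 1) / (2 * √(x ^ α + e))) x := by
    refine (((Real.hasDerivAt_rpow_const (Or.inl hx0.ne')).add_const e).sqrt
      hpos.ne').congr_of_eventuallyEq ?_
    filter_upwards [Ioi_mem_nhds hx] with y hy using hX y (le_of_lt hy)
  have h2 : 0 < √(x ^ α + e) := Real.sqrt_pos.2 hpos
  rw [h1.deriv, hX x hx.le, div_div]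
  conv_rhs => rw [← hsq]
  field_simp

/-- For `0 < α < 2`, distinct energies `E_1, …, E_N` and angles
`θ_1, …, θ_N ∈ [0,π]`, there is a smooth potential `q ∈ C^∞([0,∞))` with
`limsup_{x→∞} x^{1-α/2}|q x| ≤ (2-α) e^{2√(ln N)} N` such that for each `j` the equation
`-u'' - x^α u + q u = E_j u` has a nonzero `L²(0,∞)` solution satisfying
`u'(0) cos θ_j = u(0) sin θ_j`. -/
theorem stmt1 (α : ℝ) (hα0 : 0 < α) (hα2 : α < 2)
    (N : ℕ) (hN : 1 ≤ N)
    (E : Fin N → ℝ) (hE : Function.Injective E)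
    (θ : Fin N → ℝ) (hθ : ∀ j, θ j ∈ Icc 0 Real.pi) :
    ∃ q : ℝ → ℝ, ContDiffOn ℝ (⊤ : ℕ∞) q (Ici 0) ∧
      limsup (fun x : ℝ => ((x ^ (1 - α / 2) * |q x| : ℝ) : EReal)) atTop
        ≤ (((2 - α) * Real.exp (2 * Real.sqrt (Real.log N)) * N : ℝ) : EReal) ∧
      ∀ j : Fin N, ∃ u u' u'' : ℝ → ℝ,
        (∃ x ∈ Ici (0 : ℝ), u x ≠ 0) ∧
        (∀ x ∈ Ici (0 : ℝ), HasDerivAt u (u' x) x) ∧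
        (∀ x ∈ Ici (0 : ℝ), HasDerivAt u' (u'' x) x) ∧
        (∀ x ∈ Ioi (0 : ℝ), -u'' x - x ^ α * u x + q x * u x = E j * u x) ∧
        IntegrableOn (fun x => (u x) ^ 2) (Ioi 0) ∧
        u' 0 * Real.cos (θ j) = u 0 * Real.sin (θ j) := by
  have hη0 : 0 < min α (1 - α / 2) := lt_min hα0 (by linarith)
  have hη : min α (1 - α / 2) ≤ α := min_le_left _ _
  have hη' : min α (1 - α / 2) ≤ 1 - α / 2 := min_le_right _ _
  set η := min α (1 - α / 2)
  choose w hw hwpos hw0 hwe using fun j => exists_prufer_weight hα0 (E j)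
  have hwc : ∀ j, Continuous (w j) := fun j => (hw j).continuous
  have hw' : ∀ j, ContDiff ℝ ∞ (deriv (w j)) := fun j => (contDiff_infty_iff_deriv.1 (hw j)).2
  have hw'c : ∀ j, Continuous (deriv (w j)) := fun j => (hw' j).continuous
  have hwne : ∀ j x, w j x ≠ 0 := fun j x => (hwpos j x).ne'
  have hpow : Continuous fun x : ℝ => x ^ α := Real.continuous_rpow_const hα0.le
  set g : ℝ → ℝ := fun x => Real.smoothTransition (x - 1) * ((2 - α) * x ^ (α / 2 - 1)) with hg
  have hgs : ContDiff ℝ ∞ g := contDiff_smoothTransition_mul one_pos fun x hx =>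
    contDiffAt_const.mul (Real.contDiffAt_rpow_const_of_ne hx.ne')
  have hgc : Continuous g := hgs.continuous
  have hge : ∀ᶠ x in atTop, g x = (2 - α) * x ^ (α / 2 - 1) := by
    filter_upwards [eventually_ge_atTop 2] with x hx
    simp only [hg]
    rw [Real.smoothTransition.one_of_one_le (by linarith), one_mul]
  have hBc : ∀ j, Continuous fun x => (x ^ α + E j) / w j x := fun j =>
    (hpow.add continuous_const).div (hwc j) (hwne j)
  have hCc : ∀ j, Continuous fun x => deriv (w j) x / w j x := fun j =>
    (hw'c j).div (hwc j) (hwne j)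
  have hDc : ∀ j, Continuous fun x => g x / w j x := fun j => hgc.div (hwc j) (hwne j)
  obtain ⟨Θ, hΘ0, hΘ⟩ := exists_angles hwc hBc hCc hDc fun j => Real.pi / 2 - θ j
  have hΘs : ContDiffOn ℝ ∞ Θ (Ioi 0) := by
    refine contDiffOn_angles (fun j => (hw j).contDiffOn) (fun j => ?_) (fun j => ?_)
      (fun j => ?_) hΘ
    · refine ContDiffOn.div (fun x hx => ?_) (hw j).contDiffOn fun x _ => hwne j x
      exact ((Real.contDiffAt_rpow_const_of_ne (ne_of_gt hx)).add
        contDiffAt_const).contDiffWithinAt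
    · exact (hw' j).contDiffOn.div (hw j).contDiffOn fun x _ => hwne j x
    · exact hgs.contDiffOn.div (hw j).contDiffOn fun x _ => hwne j x
  have hΘj : ∀ j x, HasDerivAt (fun t => Θ t j) _ x := fun j x => hasDerivAt_pi.1 (hΘ x) j
  have hΘc : ∀ j, Continuous fun t => Θ t j := fun j =>
    continuous_iff_continuousAt.2 fun x => (hΘj j x).continuousAt
  set S : ℝ → ℝ := fun x => ∑ i, waveProfile (2 * Θ x i) with hS
  have hSb : ∀ x, |S x| ≤ N := fun x => abs_sum_waveProfile_le _
  have hSc : Continuous S := by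
    simp only [hS]
    unfold waveProfile
    fun_prop
  have hasym : ∀ j, (fun x => angleField w (fun j x => (x ^ α + E j) / w j x)
      (fun j x => deriv (w j) x / w j x) (fun j x => g x / w j x) x (Θ x) j
      - x ^ (α / 2) - E j / 2 * x ^ (-(α / 2))) =O[atTop] fun x : ℝ => x ^ (-(α / 2) - η) := by
    intro j
    refine (isBigO_angle_field hα0 (E j) hη hη' hSb (θ := fun x => Θ x j)).congr' ?_
      EventuallyEq.rfl
    filter_upwards [hwe j, eventually_logDeriv_prufer_weight hα0 (E j) (hwe j), hge,
      eventually_weight_bounds hα0 (E j)] with x h1 h2 h3 ⟨_, _, _, hpos, hsq, _⟩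
    have h4 : (x ^ α + E j) / √(x ^ α + E j) = √(x ^ α + E j) := Real.div_sqrt
    simp only [angleField]
    rw [h2, h1, h3, h4]
    linear_combination (-√(x ^ α + E j)) * Real.sin_sq_add_cos_sq (Θ x j)
  refine ⟨fun x => -g x * S x, ?_, ?_, fun j => ?_⟩
  · intro x hx
    refine ContDiffAt.contDiffWithinAt ?_
    rcases lt_or_ge x 1 with h | h
    · refine (contDiffAt_const (c := (0 : ℝ))).congr_of_eventuallyEq ?_
      filter_upwards [eventually_lt_nhds h] with y hy
      simp only [hg]
      rw [Real.smoothTransition.zero_of_nonpos (by linarith)]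
      ring
    · have hx0 : 0 < x := by linarith
      have h1 : ∀ i, ContDiffAt ℝ ∞ (fun t => Θ t i) x := fun i =>
        contDiffAt_pi.1 (hΘs.contDiffAt (Ioi_mem_nhds hx0)) i
      refine hgs.contDiffAt.neg.mul ?_
      simp only [hS]
      unfold waveProfile
      fun_prop
  · refine limsup_le_of_le (by isBoundedDefault) ?_
    filter_upwards [hge, eventually_gt_atTop 0] with x h1 hx
    rw [EReal.coe_le_coe_iff, h1, abs_mul, abs_neg, abs_mul, abs_of_pos (by linarith : 0 < 2 - α),
      abs_of_pos (by positivity : 0 < x ^ (α / 2 - 1))]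
    have h2 : x ^ (1 - α / 2) * x ^ (α / 2 - 1) = 1 := by
      rw [← Real.rpow_add hx, show 1 - α / 2 + (α / 2 - 1) = 0 by ring, Real.rpow_zero]
    have h3 : x ^ (1 - α / 2) * ((2 - α) * x ^ (α / 2 - 1) * |S x|) = (2 - α) * |S x| := by
      linear_combination (2 - α) * |S x| * h2
    have h4 : 1 ≤ Real.exp (2 * √(Real.log N)) := Real.one_le_exp (by positivity)
    have h5 : (0 : ℝ) ≤ N := N.cast_nonneg
    have h6 : 0 < 2 - α := by linarith
    rw [h3, mul_assoc]
    exact mul_le_mul_of_nonneg_left ((hSb x).trans (le_mul_of_one_le_left h5 h4)) h6.le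
  · set V : ℝ → ℝ := fun x => -g x * S x - x ^ α - E j with hV
    have hVc : Continuous V := by fun_prop
    set ρ : ℝ → ℝ := fun x => w j x * (Real.sin (Θ x j) * Real.cos (Θ x j)) +
      V x / w j x * (Real.sin (Θ x j) * Real.cos (Θ x j)) -
      deriv (w j) x / w j x * Real.cos (Θ x j) ^ 2 with hρ
    have hsc : Continuous fun x => Real.sin (Θ x j) := Real.continuous_sin.comp (hΘc j)
    have hcc : Continuous fun x => Real.cos (Θ x j) := Real.continuous_cos.comp (hΘc j)
    have hρc : Continuous ρ :=
      (((hwc j).mul (hsc.mul hcc)).add ((hVc.div (hwc j) (hwne j)).mul (hsc.mul hcc))).sub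
        ((hCc j).mul (hcc.pow 2))
    set L : ℝ → ℝ := fun x => ∫ t in (0 : ℝ)..x, ρ t with hL
    have hLd : ∀ x, HasDerivAt L (ρ x) x := fun x =>
      (hρc.integral_hasStrictDerivAt 0 x).hasDerivAt
    have hLc : Continuous L := continuous_iff_continuousAt.2 fun x => (hLd x).continuousAt
    have hsol := fun x => hasDerivAt_of_prufer (w := w j) (θ := fun t => Θ t j)
      (R := fun t => Real.exp (L t)) (w' := deriv (w j) x) (V := V x) (hwne j x)
      ((hw j).differentiable (by simp) x).hasDerivAt
      ((hΘj j x).congr_deriv (by simp only [angleField, hV, hS]; ring))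
      ((hLd x).exp.congr_deriv (by ring))
    refine ⟨fun x => Real.exp (L x) * Real.sin (Θ x j),
      fun x => w j x * Real.exp (L x) * Real.cos (Θ x j),
      fun x => V x * (Real.exp (L x) * Real.sin (Θ x j)), ?_, fun x _ => (hsol x).1,
      fun x _ => (hsol x).2, fun x _ => ?_, ?_, ?_⟩
    · by_contra! hzero
      have h1 : Real.sin (Θ 1 j) = 0 := by
        simpa [Real.exp_ne_zero] using hzero 1 (by simp)
      have h2 : HasDerivAt (fun x => Real.exp (L x) * Real.sin (Θ x j)) 0 1 := by
        refine (hasDerivAt_const (1 : ℝ) (0 : ℝ)).congr_of_eventuallyEq ?_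
        filter_upwards [eventually_gt_nhds (one_pos : (0 : ℝ) < 1)] with y hy
        exact hzero y hy.le
      have h3 : Real.cos (Θ 1 j) = 0 := by
        simpa [Real.exp_ne_zero, hwne] using (hsol 1).1.unique h2
      simpa [h1, h3] using Real.sin_sq_add_cos_sq (Θ 1 j)
    · simp only [hV]
      ring
    · have hamp := bddPrimitive_amplitude (Θ := fun j x => Θ x j) hα0 hα2 hE hη hη'
        (fun j => Eventually.of_forall fun x => hΘj j x) hasym j
      obtain ⟨C, hC⟩ := hamp.exists_le_sub_log (κ := α / 4 + (2 - α) * (9 / 32)) (L := L) hη0 (by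
        filter_upwards [hwe j, eventually_logDeriv_prufer_weight hα0 (E j) (hwe j), hge,
          eventually_weight_bounds hα0 (E j)] with x h1 h2 h3 ⟨_, _, _, hpos, hsq, _⟩
        refine (hLd x).congr_deriv ?_
        have h4 : V x / w j x = -((2 - α) * x ^ (α / 2 - 1)) * S x / √(x ^ α + E j)
            - √(x ^ α + E j) := by
          have h5 : (x ^ α + E j) / √(x ^ α + E j) = √(x ^ α + E j) := Real.div_sqrt
          rw [h1]
          simp only [hV, h3]
          linear_combination -h5
        simp only [hρ]
        rw [h4, h2, h1]
        ring)
      exact integrableOn_sq_of_log_decay (by linarith) hLc (hΘc j) hC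
    · simp only [hΘ0, hw0, Real.cos_pi_div_two_sub, Real.sin_pi_div_two_sub]
      ring
end

section
/- Suppose 2/3 < α < 2. Then for every integer N ≥ 2 there exists a continuous potential q on (0,∞) such that limsup_{x→∞} x^{1-α/2}|q(x)| ≤ 48(2-α)√(N ln N) and the set P of energies E ∈ ℝ for which -u''(x) - x^α u(x) + q(x)u(x) = E u(x) has a nonzero square-integrable solution on (0,∞) has exactly N elements. -/
open Filter MeasureTheory Set
open scoped Topology

/-- Appending `b` after the first `N` terms of `a`. -/
def concatAt (N : ℕ) (a b : ℕ → ℝ) (k : ℕ) : ℝ := if k < N then a k else b (k - N)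

lemma concatAt_sign {N : ℕ} {a b : ℕ → ℝ} (ha : ∀ k, a k = 1 ∨ a k = -1)
    (hb : ∀ k, b k = 1 ∨ b k = -1) (k : ℕ) : concatAt N a b k = 1 ∨ concatAt N a b k = -1 := by
  unfold concatAt
  split_ifs
  exacts [ha k, hb _]

lemma sum_concatAt (N : ℕ) (a b : ℕ → ℝ) (z : ℂ) :
    ∑ k ∈ Finset.range (N + N), (concatAt N a b k : ℂ) * z ^ k =
      ∑ k ∈ Finset.range N, (a k : ℂ) * z ^ k +
        z ^ N * ∑ k ∈ Finset.range N, (b k : ℂ) * z ^ k := by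
  rw [Finset.sum_range_add, Finset.mul_sum]
  congr 1
  · refine Finset.sum_congr rfl fun k hk => ?_
    simp [concatAt, Finset.mem_range.1 hk]
  · refine Finset.sum_congr rfl fun k _ => ?_
    simp only [concatAt, add_lt_iff_neg_left, not_lt_zero, if_false, add_tsub_cancel_left]
    ring

/-- A Rudin–Shapiro pair of arbitrary length. -/
lemma exists_rudinShapiro_pair (N : ℕ) (hN : 1 ≤ N) :
    ∃ a b : ℕ → ℝ, (∀ k, a k = 1 ∨ a k = -1) ∧ (∀ k, b k = 1 ∨ b k = -1) ∧
      ∀ z : ℂ, ‖z‖ = 1 →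
        ‖∑ k ∈ Finset.range N, (a k : ℂ) * z ^ k‖ ^ 2 +
          ‖∑ k ∈ Finset.range N, (b k : ℂ) * z ^ k‖ ^ 2 ≤ (5 * √N - 7 / 2) ^ 2 := by
  induction N using Nat.strong_induction_on with
  | _ N ih =>
  rcases Nat.lt_or_ge N 2 with h | h
  · obtain rfl : N = 1 := by omega
    refine ⟨fun _ => 1, fun _ => 1, by simp, by simp, fun z _ => ?_⟩
    norm_num
  obtain ⟨M, hM⟩ : ∃ M, M = N / 2 := ⟨_, rfl⟩
  obtain ⟨a, b, ha, hb, hab⟩ := ih M (by omega) (by omega)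
  have hM1 : 1 ≤ M := by omega
  have hs1 : 1 ≤ √(M : ℝ) := Real.one_le_sqrt.2 (by exact_mod_cast hM1)
  have h2 : √2 ^ 2 = 2 := Real.sq_sqrt (by norm_num)
  have h2l : 1.414 ≤ √2 := Real.le_sqrt_of_sq_le (by norm_num)
  have h2u : √2 ≤ 1.415 := by rw [Real.sqrt_le_left (by norm_num)]; norm_num
  have hsM : √((M + M : ℕ) : ℝ) = √2 * √(M : ℝ) := by
    rw [← Real.sqrt_mul (by norm_num)]; push_cast; ring_nf
  have hnb : ∀ k, -b k = 1 ∨ -b k = -1 := fun k => by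
    rcases hb k with h | h <;> simp [h]
  have key : ∀ z : ℂ, ‖z‖ = 1 →
      ‖∑ k ∈ Finset.range (M + M), (concatAt M a b k : ℂ) * z ^ k‖ ^ 2 +
      ‖∑ k ∈ Finset.range (M + M), (concatAt M a (fun k => -b k) k : ℂ) * z ^ k‖ ^ 2 ≤
        (√2 * (5 * √M - 7 / 2)) ^ 2 := by
    intro z hz
    rw [sum_concatAt, sum_concatAt]
    simp only [Complex.ofReal_neg, neg_mul, Finset.sum_neg_distrib, mul_neg, ← sub_eq_add_neg]
    have := parallelogram_law_with_norm ℝ (∑ k ∈ Finset.range M, (a k : ℂ) * z ^ k)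
      (z ^ M * ∑ k ∈ Finset.range M, (b k : ℂ) * z ^ k)
    have h3 := hab z hz
    rw [norm_mul, norm_pow, hz, one_pow, one_mul] at this
    rw [mul_pow, h2]
    nlinarith
  rcases Nat.even_or_odd' N with ⟨m, hm | hm⟩
  · have hN' : N = M + M := by omega
    rw [hN', hsM]
    refine ⟨_, _, concatAt_sign ha hb, concatAt_sign ha hnb, fun z hz => (key z hz).trans ?_⟩
    apply pow_le_pow_left₀ (by nlinarith)
    nlinarith
  · have hN' : N = M + M + 1 := by omega
    refine ⟨_, _, concatAt_sign (N := M) ha hb, concatAt_sign (N := M) ha hnb, fun z hz => ?_⟩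
    have hk := key z hz
    rw [hN', Finset.sum_range_succ, Finset.sum_range_succ]
    have hnorm : ∀ c : ℝ, (c = 1 ∨ c = -1) → ‖(c : ℂ) * z ^ (M + M)‖ = 1 := by
      rintro c (rfl | rfl) <;> simp [hz]
    have t1 := norm_add_le (∑ k ∈ Finset.range (M + M), (concatAt M a b k : ℂ) * z ^ k)
      ((concatAt M a b (M + M) : ℂ) * z ^ (M + M))
    have t2 := norm_add_le
      (∑ k ∈ Finset.range (M + M), (concatAt M a (fun k => -b k) k : ℂ) * z ^ k)
      ((concatAt M a (fun k => -b k) (M + M) : ℂ) * z ^ (M + M))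
    rw [hnorm _ (concatAt_sign ha hb _)] at t1
    rw [hnorm _ (concatAt_sign ha hnb _)] at t2
    set X := ‖∑ k ∈ Finset.range (M + M), (concatAt M a b k : ℂ) * z ^ k‖
    set Y := ‖∑ k ∈ Finset.range (M + M), (concatAt M a (fun k => -b k) k : ℂ) * z ^ k‖
    have hX : 0 ≤ X := norm_nonneg _
    have hY : 0 ≤ Y := norm_nonneg _
    have hR : 0 ≤ √2 * (5 * √M - 7 / 2) := by nlinarith
    set R := √2 * (5 * √M - 7 / 2) with hRdef
    have hXY : X + Y ≤ √2 * R := by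
      apply abs_le_of_sq_le_sq' _ (by positivity) |>.2
      rw [mul_pow, h2]; nlinarith [sq_nonneg (X - Y)]
    have h4 : (R + √2) ^ 2 ≤ (5 * √((M + M + 1 : ℕ) : ℝ) - 7 / 2) ^ 2 := by
      have : √2 * √(M : ℝ) ≤ √((M + M + 1 : ℕ) : ℝ) := by
        rw [← hsM]; apply Real.sqrt_le_sqrt; push_cast; linarith
      apply pow_le_pow_left₀ (by positivity)
      rw [hRdef]; nlinarith
    refine le_trans (add_le_add (pow_le_pow_left₀ (norm_nonneg _) t1 2)
      (pow_le_pow_left₀ (norm_nonneg _) t2 2)) (le_trans ?_ h4)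
    nlinarith

lemma exists_flat_signs (N : ℕ) (hN : 1 ≤ N) :
    ∃ s : ℕ → ℝ, (∀ k, s k = 1 ∨ s k = -1) ∧
      ∀ y t : ℝ, |∑ k ∈ Finset.range N, s k * Real.sin (y + k * t)| ≤ 5 * √N := by
  obtain ⟨a, b, ha, -, h⟩ := exists_rudinShapiro_pair N hN
  refine ⟨a, ha, fun y t => ?_⟩
  have h1 := h (Complex.exp (t * Complex.I)) (Complex.norm_exp_ofReal_mul_I t)
  have hs1 : 1 ≤ √(N : ℝ) := Real.one_le_sqrt.2 (by exact_mod_cast hN)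
  have h2 : ‖∑ k ∈ Finset.range N, (a k : ℂ) * Complex.exp (t * Complex.I) ^ k‖ ≤ 5 * √N := by
    refine le_trans (abs_le_of_sq_le_sq' (b := 5 * √N - 7 / 2) ?_ (by linarith)).2 (by linarith)
    nlinarith [sq_nonneg ‖∑ k ∈ Finset.range N, (b k : ℂ) * Complex.exp (t * Complex.I) ^ k‖]
  have h3 : ∑ k ∈ Finset.range N, a k * Real.sin (y + k * t) =
      (Complex.exp (y * Complex.I) *
        ∑ k ∈ Finset.range N, (a k : ℂ) * Complex.exp (t * Complex.I) ^ k).im := by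
    rw [Finset.mul_sum, Complex.im_sum]
    refine Finset.sum_congr rfl fun k _ => ?_
    have : Complex.exp (y * Complex.I) * ((a k : ℂ) * Complex.exp (t * Complex.I) ^ k) =
        (a k : ℂ) * Complex.exp ((y + k * t : ℝ) * Complex.I) := by
      rw [← Complex.exp_nat_mul, mul_left_comm, ← Complex.exp_add]
      push_cast; ring_nf
    rw [this, Complex.im_ofReal_mul, Complex.exp_ofReal_mul_I_im]
  rw [h3]
  refine (Complex.abs_im_le_norm _).trans ?_
  rwa [norm_mul, Complex.norm_exp_ofReal_mul_I, one_mul]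

/-- The WKB phase `x^(1+α/2)/(1+α/2) + (E/2) x^(1-α/2)/(1-α/2)` at energy `E`. -/
noncomputable def phase (α E x : ℝ) : ℝ :=
  x ^ (1 + α / 2) / (1 + α / 2) + E / 2 * (x ^ (1 - α / 2) / (1 - α / 2))

/-- `(u, v)` solves `u' = v`, `v' = (V - E) u` on `(a, ∞)`. -/
structure IsSol (V : ℝ → ℝ) (a E : ℝ) (u v : ℝ → ℝ) : Prop where
  fst : ∀ x, a < x → HasDerivAt u (v x) x
  snd : ∀ x, a < x → HasDerivAt v ((V x - E) * u x) x

/-- `(u, v)` is bounded on the WKB scale `(x^(-α/4), x^(α/4))`. -/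
structure IsWKBBounded (α : ℝ) (u v : ℝ → ℝ) : Prop where
  fst : (fun x => x ^ (α / 4) * u x) =O[atTop] fun _ => (1 : ℝ)
  snd : (fun x => x ^ (-(α / 4)) * v x) =O[atTop] fun _ => (1 : ℝ)

/-- `(u, v)` has WKB asymptotics with amplitudes `A` (cosine) and `B` (sine). -/
structure IsWKB (α E A B : ℝ) (u v : ℝ → ℝ) : Prop where
  fst : Tendsto (fun x => x ^ (α / 4) * u x -
    (A * Real.cos (phase α E x) + B * Real.sin (phase α E x))) atTop (𝓝 0)
  snd : Tendsto (fun x => x ^ (-(α / 4)) * v x -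
    (B * Real.cos (phase α E x) - A * Real.sin (phase α E x))) atTop (𝓝 0)

lemma isBigO_one_of_abs_le {f : ℝ → ℝ} (C : ℝ) (h : ∀ x, |f x| ≤ C) :
    f =O[atTop] fun _ => (1 : ℝ) :=
  Asymptotics.isBigO_of_le' (c := C) _ fun x => by simpa using h x

lemma isBigO_cos_sin (A B : ℝ) (θ : ℝ → ℝ) :
    (fun x => A * Real.cos (θ x) + B * Real.sin (θ x)) =O[atTop] fun _ => (1 : ℝ) := by
  refine isBigO_one_of_abs_le (|A| + |B|) fun x => (abs_add_le _ _).trans ?_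
  rw [abs_mul, abs_mul]
  exact add_le_add (mul_le_of_le_one_right (abs_nonneg _) (Real.abs_cos_le_one _))
    (mul_le_of_le_one_right (abs_nonneg _) (Real.abs_sin_le_one _))

lemma IsWKB.bounded {α E A B : ℝ} {u v : ℝ → ℝ} (h : IsWKB α E A B u v) :
    IsWKBBounded α u v := by
  constructor
  · simpa using (h.fst.isBigO_one ℝ).add (isBigO_cos_sin A B (phase α E))
  · have := (h.snd.isBigO_one ℝ).add (isBigO_cos_sin B (-A) (phase α E))
    refine this.congr_left fun x => ?_
    ring

lemma tendsto_zero_of_isBigO_one {f g : ℝ → ℝ} (hf : f =O[atTop] fun _ => (1 : ℝ))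
    (hg : Tendsto g atTop (𝓝 0)) : Tendsto (fun x => f x * g x) atTop (𝓝 0) := by
  rw [← Asymptotics.isLittleO_one_iff ℝ] at hg ⊢
  simpa using hf.mul_isLittleO hg

lemma tendsto_mul_sub {f g F G : ℝ → ℝ} (hf : Tendsto (fun x => f x - F x) atTop (𝓝 0))
    (hg : Tendsto (fun x => g x - G x) atTop (𝓝 0)) (hF : F =O[atTop] fun _ => (1 : ℝ))
    (hG : G =O[atTop] fun _ => (1 : ℝ)) :
    Tendsto (fun x => f x * g x - F x * G x) atTop (𝓝 0) := by
  have h1 := tendsto_zero_of_isBigO_one hF hg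
  have h2 := tendsto_zero_of_isBigO_one hG hf
  have h3 := hf.mul hg
  have h4 := (h1.add h2).add h3
  simp only [mul_zero, add_zero] at h4
  refine h4.congr fun x => ?_
  ring

lemma rpow_tendsto_zero {p : ℝ} (hp : p < 0) : Tendsto (fun x : ℝ => x ^ p) atTop (𝓝 0) := by
  simpa using tendsto_rpow_neg_atTop (y := -p) (by linarith)

lemma hasDerivAt_wronskian {V : ℝ → ℝ} {a E₁ E₂ : ℝ} {u₁ v₁ u₂ v₂ : ℝ → ℝ}
    (h₁ : IsSol V a E₁ u₁ v₁) (h₂ : IsSol V a E₂ u₂ v₂) {x : ℝ} (hx : a < x) :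
    HasDerivAt (fun x => u₁ x * v₂ x - v₁ x * u₂ x) ((E₁ - E₂) * (u₁ x * u₂ x)) x := by
  refine HasDerivAt.congr_deriv
    (((h₁.fst x hx).fun_mul (h₂.snd x hx)).fun_sub ((h₁.snd x hx).fun_mul (h₂.fst x hx))) ?_
  ring

lemma constant_of_hasDerivAt_zero {f : ℝ → ℝ} {a : ℝ} (h : ∀ x, a < x → HasDerivAt f 0 x)
    {x y : ℝ} (hx : a < x) (hy : a < y) : f x = f y := by
  have := (convex_Ioi a).is_const_of_fderivWithin_eq_zero (𝕜 := ℝ) (f := f)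
    (fun z hz => (h z hz).differentiableAt.differentiableWithinAt) (fun z hz => by
      rw [fderivWithin_of_isOpen isOpen_Ioi hz, ← toSpanSingleton_deriv, (h z hz).deriv]
      simp) hx hy
  exact this

lemma hasDerivAt_integral {f : ℝ → ℝ} {a c : ℝ} (hf : ContinuousOn f (Ioi a)) (hc : a < c) {x : ℝ}
    (hx : a < x) : HasDerivAt (fun x => ∫ t in c..x, f t) (f x) x := by
  refine intervalIntegral.integral_hasDerivAt_right ?_ ?_ (hf.continuousAt (Ioi_mem_nhds hx))
  · refine (hf.mono fun y hy => ?_).intervalIntegrable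
    exact lt_of_lt_of_le (lt_min hc hx) hy.1
  · exact hf.stronglyMeasurableAtFilter isOpen_Ioi x hx

lemma IsSol.continuousOn {V : ℝ → ℝ} {a E : ℝ} {u v : ℝ → ℝ} (h : IsSol V a E u v) :
    ContinuousOn u (Ioi a) := fun x hx => (h.fst x hx).continuousAt.continuousWithinAt

lemma IsSol.continuousOn_snd {V : ℝ → ℝ} {a E : ℝ} {u v : ℝ → ℝ} (h : IsSol V a E u v) :
    ContinuousOn v (Ioi a) := fun x hx => (h.snd x hx).continuousAt.continuousWithinAt

/-- L'Hôpital's rule against the power `x ^ p`. -/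
lemma tendsto_rpow_neg_mul_of_deriv {H h : ℝ → ℝ} {p L : ℝ} (hp : 0 < p)
    (hH : ∀ᶠ x in atTop, HasDerivAt H (h x) x)
    (hh : Tendsto (fun x => x ^ (1 - p) * h x) atTop (𝓝 L)) :
    Tendsto (fun x => x ^ (-p) * H x) atTop (𝓝 (L / p)) := by
  rw [Metric.tendsto_atTop] at hh ⊢
  intro ε hε
  obtain ⟨X₁, hX₁⟩ := hh (ε * p / 2) (by positivity)
  obtain ⟨X₂, hX₂⟩ := eventually_atTop.1 hH
  set X := max (max X₁ X₂) 1 with hX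
  have hXpos : 0 < X := lt_of_lt_of_le one_pos (le_max_right _ _)
  set K : ℝ → ℝ := fun x => H x - L / p * x ^ p with hK
  have hKd : ∀ x, X ≤ x → HasDerivAt K (h x - L * x ^ (p - 1)) x := fun x hx => by
    have hx0 : 0 < x := hXpos.trans_le hx
    refine HasDerivAt.congr_deriv
      ((hX₂ x (le_trans (le_trans (le_max_right _ _) (le_max_left _ _)) hx)).fun_sub
        ((Real.hasDerivAt_rpow_const (p := p) (Or.inl hx0.ne')).const_mul (L / p))) ?_
    field_simp
  have hB : ∀ y, X ≤ y → HasDerivAt (fun y => ε / 2 * (y ^ p - X ^ p))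
      (ε / 2 * (p * y ^ (p - 1))) y := fun y hy =>
    ((Real.hasDerivAt_rpow_const (Or.inl (hXpos.trans_le hy).ne')).sub_const _).const_mul _
  have hbound : ∀ x, X ≤ x → ‖K x - K X‖ ≤ ε / 2 * (x ^ p - X ^ p) := fun x hx => by
    refine image_norm_le_of_norm_deriv_right_le_deriv_boundary'
      (f := fun y => K y - K X) (f' := fun y => h y - L * y ^ (p - 1))
      (B := fun y => ε / 2 * (y ^ p - X ^ p)) (B' := fun y => ε / 2 * (p * y ^ (p - 1)))
      (a := X) (b := x) ?_ ?_ ?_ ?_ ?_ ?_ (right_mem_Icc.2 hx)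
    · exact fun y hy => ((hKd y hy.1).sub_const _).continuousAt.continuousWithinAt
    · exact fun y hy => ((hKd y hy.1).sub_const _).hasDerivWithinAt
    · simp
    · exact fun y hy => (hB y hy.1).continuousAt.continuousWithinAt
    · exact fun y hy => (hB y hy.1).hasDerivWithinAt
    · intro y hy
      have hy0 : 0 < y := hXpos.trans_le hy.1
      have h1 := hX₁ y (le_trans (le_trans (le_max_left _ _) (le_max_left _ _)) hy.1)
      rw [Real.dist_eq] at h1
      have h2 : h y - L * y ^ (p - 1) = y ^ (p - 1) * (y ^ (1 - p) * h y - L) := by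
        have : y ^ (p - 1) * y ^ (1 - p) = 1 := by
          rw [← Real.rpow_add hy0]; simp
        linear_combination -h y * this
      rw [h2, Real.norm_eq_abs, abs_mul, abs_of_pos (Real.rpow_pos_of_pos hy0 _)]
      have := mul_le_mul_of_nonneg_left h1.le (Real.rpow_pos_of_pos hy0 (p - 1)).le
      linarith
  obtain ⟨X₃, hX₃⟩ := Metric.tendsto_atTop.1
    ((rpow_tendsto_zero (p := -p) (by linarith)).const_mul |K X|) (ε / 2) (by positivity)
  refine ⟨max X X₃, fun x hx => ?_⟩
  have hx1 : X ≤ x := le_trans (le_max_left _ _) hx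
  have hx0 : 0 < x := hXpos.trans_le hx1
  have h3 := hX₃ x (le_trans (le_max_right _ _) hx)
  have h4 := hbound x hx1
  have hpos := Real.rpow_pos_of_pos hx0 p
  have hneg := Real.rpow_pos_of_pos hx0 (-p)
  have hmul : x ^ (-p) * x ^ p = 1 := by rw [← Real.rpow_add hx0]; simp
  have h5 : x ^ (-p) * H x - L / p = x ^ (-p) * K x := by
    simp only [hK]; linear_combination (L / p) * hmul
  rw [Real.dist_eq, mul_zero, sub_zero, abs_mul, abs_abs, abs_of_pos hneg] at h3
  rw [Real.dist_eq, h5, abs_mul, abs_of_pos hneg]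
  have h6 : |K x| ≤ |K X| + ε / 2 * x ^ p := by
    have := abs_sub_abs_le_abs_sub (K x) (K X)
    have hXp := Real.rpow_pos_of_pos hXpos p
    rw [Real.norm_eq_abs] at h4
    nlinarith
  calc x ^ (-p) * |K x| ≤ x ^ (-p) * (|K X| + ε / 2 * x ^ p) := by gcongr
    _ = |K X| * x ^ (-p) + ε / 2 * (x ^ (-p) * x ^ p) := by ring
    _ < ε := by rw [hmul]; linarith

lemma rpow_quarter {α x : ℝ} (hx : 0 < x) :
    x ^ (α / 2) = (x ^ (α / 4)) ^ 2 ∧ x ^ α = (x ^ (α / 4)) ^ 4 ∧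
      x ^ (-(α / 4)) = (x ^ (α / 4))⁻¹ ∧ x ^ (-(α / 2)) = ((x ^ (α / 4)) ^ 2)⁻¹ ∧
      x ^ (-α) = ((x ^ (α / 4)) ^ 4)⁻¹ := by
  refine ⟨?_, ?_, ?_, ?_, ?_⟩
  · rw [← Real.rpow_mul_natCast hx.le]; congr 1; push_cast; ring
  · rw [← Real.rpow_mul_natCast hx.le]; congr 1; push_cast; ring
  · rw [Real.rpow_neg hx.le]
  · rw [Real.rpow_neg hx.le, ← Real.rpow_mul_natCast hx.le]; congr 2; push_cast; ring
  · rw [Real.rpow_neg hx.le, ← Real.rpow_mul_natCast hx.le]; congr 2; push_cast; ring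

lemma rpow_sub_one_eq_mul_inv {x : ℝ} (hx : 0 < x) (y : ℝ) : x ^ (y - 1) = x ^ y * x⁻¹ := by
  rw [Real.rpow_sub_one hx.ne', div_eq_mul_inv]

lemma IsWKB.tendsto_energy {α E A B : ℝ} {u v : ℝ → ℝ} (h : IsWKB α E A B u v) :
    Tendsto (fun x => (x ^ (α / 4) * u x) ^ 2 + (x ^ (-(α / 4)) * v x) ^ 2) atTop
      (𝓝 (A ^ 2 + B ^ 2)) := by
  have hF := isBigO_cos_sin A B (phase α E)
  have hG : (fun x => B * Real.cos (phase α E x) - A * Real.sin (phase α E x)) =O[atTop]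
      fun _ => (1 : ℝ) :=
    (isBigO_cos_sin B (-A) (phase α E)).congr_left fun x => by ring
  have := ((tendsto_mul_sub h.fst h.fst hF hF).add
    (tendsto_mul_sub h.snd h.snd hG hG)).add_const (A ^ 2 + B ^ 2)
  simp only [add_zero, zero_add] at this
  refine this.congr fun x => ?_
  linear_combination -(A ^ 2 + B ^ 2) * Real.sin_sq_add_cos_sq (phase α E x)

lemma IsWKB.tendsto_primitive {α a E A B : ℝ} {q u v G : ℝ → ℝ} (hα0 : 0 < α) (hα2 : α < 2)
    (hq : Tendsto q atTop (𝓝 0)) (hs : IsSol (fun x => q x - x ^ α) a E u v)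
    (hw : IsWKB α E A B u v) (hG : ∀ᶠ x in atTop, HasDerivAt G (u x ^ 2) x) :
    Tendsto (fun x => x ^ (-(1 - α / 2)) * G x) atTop (𝓝 ((A ^ 2 + B ^ 2) / (2 - α))) := by
  have hp : 0 < 1 - α / 2 := by linarith
  have hUV := hw.bounded.fst.mul hw.bounded.snd
  have hUU := hw.bounded.fst.mul hw.bounded.fst
  simp only [mul_one] at hUV hUU
  have hH : ∀ᶠ x in atTop, HasDerivAt (fun x => 2 * G x + u x * v x * x ^ (-α))
      (2 * u x ^ 2 + ((v x * v x + u x * ((q x - x ^ α - E) * u x)) * x ^ (-α) +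
        u x * v x * (-α * x ^ (-α - 1)))) x := by
    filter_upwards [hG, eventually_gt_atTop a, eventually_gt_atTop 0] with x h1 h2 h3
    exact (h1.const_mul 2).fun_add (((hs.fst x h2).fun_mul (hs.snd x h2)).fun_mul
      (Real.hasDerivAt_rpow_const (Or.inl h3.ne')))
  have hneg : Tendsto (fun x : ℝ => x ^ (-α)) atTop (𝓝 0) := rpow_tendsto_zero (by linarith)
  have hneg2 : Tendsto (fun x : ℝ => x ^ (-(α / 2) - 1)) atTop (𝓝 0) :=
    rpow_tendsto_zero (by linarith)
  have hlim : Tendsto (fun x => x ^ (1 - (1 - α / 2)) *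
      (2 * u x ^ 2 + ((v x * v x + u x * ((q x - x ^ α - E) * u x)) * x ^ (-α) +
        u x * v x * (-α * x ^ (-α - 1))))) atTop (𝓝 (A ^ 2 + B ^ 2)) := by
    have e1 := tendsto_zero_of_isBigO_one hUU ((hq.sub_const E).mul hneg |>.trans (by simp))
    have e2 := tendsto_zero_of_isBigO_one hUV (hneg2.const_mul (-α) |>.trans (by simp))
    have := (hw.tendsto_energy.add e1).add e2
    simp only [add_zero] at this
    refine this.congr' ?_
    filter_upwards [eventually_gt_atTop 0] with x hx
    obtain ⟨h1, h2, h3, h4, h5⟩ := rpow_quarter (α := α) hx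
    rw [sub_sub_cancel, rpow_sub_one_eq_mul_inv hx, rpow_sub_one_eq_mul_inv hx, h1, h2, h3, h4, h5]
    have hX := (Real.rpow_pos_of_pos hx (α / 4)).ne'
    field_simp
    ring
  have h1 := tendsto_rpow_neg_mul_of_deriv hp hH hlim
  have h2 : Tendsto (fun x : ℝ => x ^ (-(1 - α / 2)) * x ^ (-α)) atTop (𝓝 0) := by
    simpa using (rpow_tendsto_zero (p := -(1 - α / 2)) (by linarith)).mul hneg
  have h3 := (h1.sub (tendsto_zero_of_isBigO_one hUV h2)).mul_const (1 / 2)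
  have h4 : ((A ^ 2 + B ^ 2) / (1 - α / 2) - 0) * (1 / 2) = (A ^ 2 + B ^ 2) / (2 - α) := by
    have : 2 - α ≠ 0 := by linarith
    have : 1 - α / 2 ≠ 0 := by linarith
    field_simp
    ring
  rw [h4] at h3
  refine h3.congr' ?_
  filter_upwards [eventually_gt_atTop 0] with x hx
  have hX := (Real.rpow_pos_of_pos hx (α / 4)).ne'
  rw [(rpow_quarter hx).2.2.1]
  field_simp
  ring

lemma IsWKB.eq_zero_of_integrable {α a E A B : ℝ} {q u v : ℝ → ℝ} (hα0 : 0 < α) (hα2 : α < 2)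
    (hq : Tendsto q atTop (𝓝 0)) (hs : IsSol (fun x => q x - x ^ α) a E u v)
    (hw : IsWKB α E A B u v) (hsq : IntegrableAtFilter (fun x => u x ^ 2) atTop) :
    A ^ 2 + B ^ 2 = 0 := by
  obtain ⟨s, hs1, hs2⟩ := hsq
  obtain ⟨c, hc⟩ := mem_atTop_sets.1 hs1
  have hac : a < max c (a + 1) := lt_of_lt_of_le (lt_add_one a) (le_max_right _ _)
  have hI : IntegrableOn (fun x => u x ^ 2) (Ioi (max c (a + 1))) :=
    hs2.mono_set fun x hx => hc x (le_trans (le_max_left _ _) (le_of_lt hx))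
  have h1 := intervalIntegral_tendsto_integral_Ioi _ hI tendsto_id
  have h2 := (rpow_tendsto_zero (p := -(1 - α / 2)) (by linarith)).mul h1
  have h3 := hw.tendsto_primitive hα0 hα2 hq hs (G := fun x => ∫ t in max c (a + 1)..x, u t ^ 2) (by
    filter_upwards [eventually_gt_atTop a] with x hx
    exact hasDerivAt_integral (hs.continuousOn.pow 2) hac hx)
  have h4 := tendsto_nhds_unique h2 h3
  rw [zero_mul, eq_comm, div_eq_zero_iff] at h4
  exact h4.resolve_right (by linarith)

lemma IsSol.congr {V W : ℝ → ℝ} {a E : ℝ} {u v : ℝ → ℝ} (h : IsSol V a E u v)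
    (hVW : ∀ x, V x = W x) : IsSol W a E u v := by
  rwa [← funext hVW]

lemma IsSol.mono {V : ℝ → ℝ} {a b E : ℝ} {u v : ℝ → ℝ} (h : IsSol V a E u v) (hab : a ≤ b) :
    IsSol V b E u v :=
  ⟨fun x hx => h.fst x (hab.trans_lt hx), fun x hx => h.snd x (hab.trans_lt hx)⟩

/-- Double commutation at the energy of `(f, g)`: `f / G` solves the transformed equation. -/
lemma IsSol.darboux_self {V : ℝ → ℝ} {a E : ℝ} {f g G : ℝ → ℝ} (h : IsSol V a E f g)
    (hG : ∀ x, a < x → HasDerivAt G (f x ^ 2) x) (hG1 : ∀ x, a < x → 1 ≤ G x) :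
    IsSol (fun x => V x - 2 * (2 * f x * g x / G x - f x ^ 4 / G x ^ 2)) a E
      (fun x => f x / G x) (fun x => g x / G x - f x ^ 3 / G x ^ 2) := by
  constructor
  · intro x hx
    have hne : G x ≠ 0 := (one_pos.trans_le (hG1 x hx)).ne'
    refine ((h.fst x hx).fun_div (hG x hx) hne).congr_deriv ?_
    field_simp
  · intro x hx
    have hne : G x ≠ 0 := (one_pos.trans_le (hG1 x hx)).ne'
    refine (((h.snd x hx).fun_div (hG x hx) hne).fun_sub
      (((h.fst x hx).fun_pow 3).fun_div ((hG x hx).fun_pow 2) (pow_ne_zero 2 hne))).congr_deriv ?_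
    field_simp
    push_cast
    ring

/-- Double commutation at the energy of `(f, g)`: transformation of solutions at other energies. -/
lemma IsSol.darboux {V : ℝ → ℝ} {a E₀ E : ℝ} {f g G u v : ℝ → ℝ} (h : IsSol V a E₀ f g)
    (hG : ∀ x, a < x → HasDerivAt G (f x ^ 2) x) (hG1 : ∀ x, a < x → 1 ≤ G x)
    (hu : IsSol V a E u v) (hE : E₀ - E ≠ 0) :
    IsSol (fun x => V x - 2 * (2 * f x * g x / G x - f x ^ 4 / G x ^ 2)) a E
      (fun x => u x - f x / G x * ((f x * v x - g x * u x) / (E₀ - E)))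
      (fun x => v x - ((g x / G x - f x ^ 3 / G x ^ 2) * ((f x * v x - g x * u x) / (E₀ - E)) +
        f x / G x * (f x * u x))) := by
  have hs := h.darboux_self hG hG1
  constructor
  · intro x hx
    refine ((hu.fst x hx).fun_sub ((hs.fst x hx).fun_mul
      ((hasDerivAt_wronskian h hu hx).div_const (E₀ - E)))).congr_deriv ?_
    field_simp
  · intro x hx
    have hne : G x ≠ 0 := (one_pos.trans_le (hG1 x hx)).ne'
    refine ((hu.snd x hx).fun_sub (((hs.snd x hx).fun_mul
      ((hasDerivAt_wronskian h hu hx).div_const (E₀ - E))).fun_add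
        ((hs.fst x hx).fun_mul ((h.fst x hx).fun_mul (hu.fst x hx))))).congr_deriv ?_
    field_simp
    ring

lemma IsWKBBounded.wronskian {α : ℝ} {f g u v : ℝ → ℝ} (hf : IsWKBBounded α f g)
    (hu : IsWKBBounded α u v) (c : ℝ) :
    (fun x => (f x * v x - g x * u x) / c) =O[atTop] fun _ => (1 : ℝ) := by
  have h := ((hf.fst.mul hu.snd).sub (hf.snd.mul hu.fst)).const_mul_left c⁻¹
  simp only [mul_one] at h
  refine h.congr' ?_ EventuallyEq.rfl
  filter_upwards [eventually_gt_atTop 0] with x hx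
  have hX := (Real.rpow_pos_of_pos hx (α / 4)).ne'
  rw [(rpow_quarter hx).2.2.1]
  field_simp

section corrections

variable {α c : ℝ} {f g G u v : ℝ → ℝ}

lemma darboux_correction_fst (hf : IsWKBBounded α f g) (hu : IsWKBBounded α u v)
    (hG : Tendsto (fun x => (G x)⁻¹) atTop (𝓝 0)) :
    Tendsto (fun x => x ^ (α / 4) * (f x / G x * ((f x * v x - g x * u x) / c))) atTop (𝓝 0) := by
  have h := (hf.fst.mul (hf.wronskian hu c))
  simp only [mul_one] at h
  refine (tendsto_zero_of_isBigO_one h hG).congr fun x => ?_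
  ring

lemma darboux_correction_snd (hα : 0 < α) (hf : IsWKBBounded α f g) (hu : IsWKBBounded α u v)
    (hG : Tendsto (fun x => (G x)⁻¹) atTop (𝓝 0)) :
    Tendsto (fun x => x ^ (-(α / 4)) *
      ((g x / G x - f x ^ 3 / G x ^ 2) * ((f x * v x - g x * u x) / c) +
        f x / G x * (f x * u x))) atTop (𝓝 0) := by
  have hJ := hf.wronskian hu c
  have hneg : Tendsto (fun x : ℝ => x ^ (-α)) atTop (𝓝 0) := rpow_tendsto_zero (by linarith)
  have h1 := hf.snd.mul hJ
  have h2 := (hf.fst.pow 3).mul hJ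
  have h3 := (hf.fst.pow 2).mul hu.fst
  simp only [mul_one, one_pow] at h1 h2 h3
  have e1 := tendsto_zero_of_isBigO_one h1 hG
  have e2 := tendsto_zero_of_isBigO_one h2 ((hneg.mul (hG.pow 2)).trans (by simp))
  have e3 := tendsto_zero_of_isBigO_one h3 ((hneg.mul hG).trans (by simp))
  have := (e1.sub e2).add e3
  simp only [sub_zero, add_zero] at this
  refine this.congr' ?_
  filter_upwards [eventually_gt_atTop 0] with x hx
  have hX := (Real.rpow_pos_of_pos hx (α / 4)).ne'
  obtain ⟨-, -, h3, -, h5⟩ := rpow_quarter (α := α) hx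
  rw [h3, h5]
  generalize (f x * v x - g x * u x) / c = J
  generalize hK : (G x)⁻¹ = K
  simp only [div_eq_mul_inv, ← inv_pow, hK]
  field_simp

end corrections

/-- The effect of `n` commutation steps on the WKB level: a perturbation `q` with bound states at
the energies `0, …, n - 1` and signs `s`. -/
structure HasBoundStates (α a : ℝ) (n : ℕ) (s : ℕ → ℝ) (q : ℝ → ℝ) : Prop where
  cont : ContinuousOn q (Ioi a)
  asymp : Tendsto (fun x => x ^ (1 - α / 2) * q x -
    2 * (2 - α) * ∑ k ∈ Finset.range n, s k * Real.sin (2 * phase α k x)) atTop (𝓝 0)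
  basis : ∀ E : ℝ, (∀ k < n, E ≠ (k : ℝ)) → ∀ A B : ℝ, ∃ u v : ℝ → ℝ,
    IsSol (fun x => q x - x ^ α) a E u v ∧ IsWKB α E A B u v
  bound : ∀ k < n, ∃ u v : ℝ → ℝ, IsSol (fun x => q x - x ^ α) a k u v ∧ IsWKBBounded α u v ∧
    (∃ᶠ x in atTop, u x ≠ 0) ∧ IntegrableAtFilter (fun x => u x ^ 2) atTop

lemma HasBoundStates.tendsto_zero {α a : ℝ} {n : ℕ} {q : ℝ → ℝ} {s : ℕ → ℝ} (hα2 : α < 2)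
    (h : HasBoundStates α a n s q) : Tendsto q atTop (𝓝 0) := by
  have hneg := rpow_tendsto_zero (p := -(1 - α / 2)) (by linarith)
  have hb : (fun x => 2 * (2 - α) * ∑ k ∈ Finset.range n, s k * Real.sin (2 * phase α k x))
      =O[atTop] fun _ => (1 : ℝ) := by
    refine (Asymptotics.IsBigO.fun_sum fun k _ => ?_).const_mul_left _
    exact (isBigO_one_of_abs_le 1 fun x => Real.abs_sin_le_one _).const_mul_left (s k)
  have hq := (h.asymp.isBigO_one ℝ).add hb
  refine (tendsto_zero_of_isBigO_one hq hneg).congr' ?_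
  filter_upwards [eventually_gt_atTop 0] with x hx
  have hX := (Real.rpow_pos_of_pos hx (1 - α / 2)).ne'
  rw [Real.rpow_neg hx.le, sub_add_cancel]
  field_simp

lemma IsWKB.of_correction {α E A B : ℝ} {u v du dv : ℝ → ℝ} (h : IsWKB α E A B u v)
    (h₁ : Tendsto (fun x => x ^ (α / 4) * du x) atTop (𝓝 0))
    (h₂ : Tendsto (fun x => x ^ (-(α / 4)) * dv x) atTop (𝓝 0)) :
    IsWKB α E A B (fun x => u x - du x) (fun x => v x - dv x) := by
  constructor
  · have := h.fst.sub h₁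
    rw [sub_zero] at this
    exact this.congr fun x => by ring
  · have := h.snd.sub h₂
    rw [sub_zero] at this
    exact this.congr fun x => by ring

lemma IsWKBBounded.of_correction {α : ℝ} {u v du dv : ℝ → ℝ} (h : IsWKBBounded α u v)
    (h₁ : Tendsto (fun x => x ^ (α / 4) * du x) atTop (𝓝 0))
    (h₂ : Tendsto (fun x => x ^ (-(α / 4)) * dv x) atTop (𝓝 0)) :
    IsWKBBounded α (fun x => u x - du x) (fun x => v x - dv x) := by
  constructor
  · exact (h.fst.sub (h₁.isBigO_one ℝ)).congr_left fun x => by ring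
  · exact (h.snd.sub (h₂.isBigO_one ℝ)).congr_left fun x => by ring

section primitive

variable {α a : ℝ} {f g G : ℝ → ℝ}

lemma integrable_div_primitive
    (hG : ∀ x, a < x → HasDerivAt G (f x ^ 2) x)
    (hG1 : ∀ x, a < x → 1 ≤ G x) (hGinv : Tendsto (fun x => (G x)⁻¹) atTop (𝓝 0)) :
    IntegrableAtFilter (fun x => (f x / G x) ^ 2) atTop := by
  have hd : ∀ x, a < x → HasDerivAt (fun x => -(G x)⁻¹) ((f x / G x) ^ 2) x := fun x hx => by
    have hne : G x ≠ 0 := (one_pos.trans_le (hG1 x hx)).ne'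
    refine ((hG x hx).fun_inv hne).fun_neg.congr_deriv ?_
    field_simp
  refine ⟨Ioi (a + 1), Ioi_mem_atTop _, ?_⟩
  refine integrableOn_Ioi_deriv_of_nonneg' (g := fun x => -(G x)⁻¹) (l := -0) ?_ ?_ hGinv.neg
  · exact fun x hx => hd x ((lt_add_one a).trans_le hx)
  · exact fun x _ => sq_nonneg _

lemma frequently_transformed_ne_zero {J u : ℝ → ℝ}
    (hG : ∀ x, a < x → HasDerivAt G (f x ^ 2) x)
    (hG1 : ∀ x, a < x → 1 ≤ G x) (hGinv : Tendsto (fun x => (G x)⁻¹) atTop (𝓝 0))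
    (hJ : ∀ x, a < x → HasDerivAt J (f x * u x) x)
    (hJ1 : J =O[atTop] fun _ => (1 : ℝ)) (hu : ∃ᶠ x in atTop, u x ≠ 0) :
    ∃ᶠ x in atTop, u x - f x / G x * J x ≠ 0 := by
  intro hev
  refine hu ?_
  obtain ⟨b, hb⟩ := eventually_atTop.1 hev
  set d := max a b with hd
  have hz : ∀ x, d < x → u x = f x / G x * J x := fun x hx =>
    sub_eq_zero.1 (not_not.1 (hb x ((le_max_right _ _).trans hx.le)))
  have hder : ∀ x, d < x → HasDerivAt (fun x => J x / G x) 0 x := fun x hx => by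
    have hax : a < x := (le_max_left _ _).trans_lt hx
    have hne : G x ≠ 0 := (one_pos.trans_le (hG1 x hax)).ne'
    refine ((hJ x hax).fun_div (hG x hax) hne).congr_deriv ?_
    rw [hz x hx]
    field_simp
    ring
  have hlim : Tendsto (fun x => J x / G x) atTop (𝓝 0) :=
    (tendsto_zero_of_isBigO_one hJ1 hGinv).congr fun x => (div_eq_mul_inv _ _).symm
  filter_upwards [eventually_gt_atTop d] with x hx
  have hconst : Tendsto (fun y => J y / G y) atTop (𝓝 (J x / G x)) := by
    refine tendsto_const_nhds.congr' ?_
    filter_upwards [eventually_gt_atTop d] with y hy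
    exact constant_of_hasDerivAt_zero hder hx hy
  have h0 := tendsto_nhds_unique hconst hlim
  rw [not_not, hz x hx, div_mul_eq_mul_div, mul_div_assoc, h0, mul_zero]

end primitive

lemma tendsto_darboux_potential {α E A B σ : ℝ} {f g G : ℝ → ℝ} (hα0 : 0 < α)
    (hw : IsWKB α E A B f g) (hAB : A * B = 0) (hσ : A ^ 2 - B ^ 2 = σ)
    (hGinv : Tendsto (fun x => (G x)⁻¹) atTop (𝓝 0))
    (hG : Tendsto (fun x => x ^ (1 - α / 2) * (G x)⁻¹) atTop (𝓝 (2 - α))) :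
    Tendsto (fun x => x ^ (1 - α / 2) * (-2 * (2 * f x * g x / G x - f x ^ 4 / G x ^ 2)) -
      2 * (2 - α) * (σ * Real.sin (2 * phase α E x))) atTop (𝓝 0) := by
  set θ := phase α E
  have hF := isBigO_cos_sin A B θ
  have hF' : (fun x => B * Real.cos (θ x) - A * Real.sin (θ x)) =O[atTop] fun _ => (1 : ℝ) :=
    (isBigO_cos_sin B (-A) θ).congr_left fun x => by ring
  have h1 := tendsto_mul_sub hw.fst hw.snd hF hF'
  have hFF := (hF.mul hF')
  simp only [mul_one] at hFF
  have hG' : Tendsto (fun x => x ^ (1 - α / 2) * (G x)⁻¹ - (2 - α)) atTop (𝓝 0) := by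
    simpa using hG.sub_const (2 - α)
  have h2 := (tendsto_mul_sub h1 hG' hFF
    ((isBigO_one_of_abs_le |2 - α| fun _ => le_rfl))).const_mul (-4)
  have hneg : Tendsto (fun x : ℝ => x ^ (-α)) atTop (𝓝 0) := rpow_tendsto_zero (by linarith)
  have hf4 := hw.bounded.fst.pow 4
  simp only [one_pow] at hf4
  have h3 := (tendsto_zero_of_isBigO_one hf4 ((hneg.mul (hG.mul hGinv)).trans
    (by simp))).const_mul 2
  have h4 := h2.add h3
  simp only [mul_zero, add_zero] at h4
  refine h4.congr' ?_
  filter_upwards [eventually_gt_atTop 0] with x hx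
  have hX := (Real.rpow_pos_of_pos hx (α / 4)).ne'
  obtain ⟨-, -, h3, -, h5⟩ := rpow_quarter (α := α) hx
  rw [h3, h5, Real.sin_two_mul]
  generalize x ^ (1 - α / 2) = Y
  generalize hK : (G x)⁻¹ = K
  have e : (A * Real.cos (θ x) + B * Real.sin (θ x)) * (B * Real.cos (θ x) - A * Real.sin (θ x))
      = -(σ * (Real.sin (θ x) * Real.cos (θ x))) := by
    linear_combination (Real.cos (θ x) ^ 2 - Real.sin (θ x) ^ 2) * hAB -
      Real.sin (θ x) * Real.cos (θ x) * hσ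
  rw [e]
  simp only [div_eq_mul_inv, ← inv_pow, hK]
  field_simp
  ring

/-- One step of double commutation: insert a bound state at energy `n`. -/
lemma HasBoundStates.step {α a b : ℝ} {n : ℕ} {q : ℝ → ℝ} {s : ℕ → ℝ} (hα0 : 0 < α) (hα2 : α < 2)
    (h : HasBoundStates α a n s q) (hab : a < b) (hs : s n = 1 ∨ s n = -1) :
    ∃ q', HasBoundStates α b (n + 1) s q' := by
  obtain ⟨A, B, hAB, hAB1, hσ⟩ : ∃ A B : ℝ, A * B = 0 ∧ A ^ 2 + B ^ 2 = 1 ∧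
      A ^ 2 - B ^ 2 = s n := by
    rcases hs with hs | hs
    · exact ⟨1, 0, by simp [hs]⟩
    · exact ⟨0, 1, by simp [hs]⟩
  have hq0 := h.tendsto_zero hα2
  obtain ⟨f, g, hsol, hw⟩ := h.basis n (fun k hk => by exact_mod_cast hk.ne') A B
  have hfc := hsol.continuousOn
  set G : ℝ → ℝ := fun x => 1 + ∫ t in b..x, f t ^ 2 with hGdef
  have hGa : ∀ x, a < x → HasDerivAt G (f x ^ 2) x := fun x hx =>
    (hasDerivAt_integral (hfc.pow 2) hab hx).const_add 1
  have hG : ∀ x, b < x → HasDerivAt G (f x ^ 2) x := fun x hx => hGa x (hab.trans hx)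
  have hG1 : ∀ x, b < x → 1 ≤ G x := fun x hx =>
    le_add_of_nonneg_right (intervalIntegral.integral_nonneg hx.le fun t _ => sq_nonneg _)
  have hp : 0 < 1 - α / 2 := by linarith
  have hlim := hw.tendsto_primitive hα0 hα2 hq0 hsol (eventually_atTop.2 ⟨b + 1, fun x hx =>
    hG x ((lt_add_one b).trans_le hx)⟩)
  rw [hAB1] at hlim
  have hGp : Tendsto (fun x => x ^ (1 - α / 2) * (G x)⁻¹) atTop (𝓝 (2 - α)) := by
    have := hlim.inv₀ (by simp; linarith)
    simp only [one_div, inv_inv] at this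
    refine this.congr' ?_
    filter_upwards [eventually_gt_atTop 0] with x hx
    rw [mul_inv, Real.rpow_neg hx.le, inv_inv]
  have hGinv : Tendsto (fun x => (G x)⁻¹) atTop (𝓝 0) := by
    have := (rpow_tendsto_zero (neg_lt_zero.2 hp)).mul hGp
    rw [zero_mul] at this
    refine this.congr' ?_
    filter_upwards [eventually_gt_atTop 0] with x hx
    have hX := (Real.rpow_pos_of_pos hx (1 - α / 2)).ne'
    rw [Real.rpow_neg hx.le]
    field_simp
  have hsol' := hsol.mono hab.le
  have hpot : ∀ x, (q x - x ^ α) - 2 * (2 * f x * g x / G x - f x ^ 4 / G x ^ 2) =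
      (q x + -2 * (2 * f x * g x / G x - f x ^ 4 / G x ^ 2)) - x ^ α := fun x => by ring
  have hself : IsSol (fun x => (q x + -2 * (2 * f x * g x / G x - f x ^ 4 / G x ^ 2)) - x ^ α) b n
      (fun x => f x / G x) (fun x => g x / G x - f x ^ 3 / G x ^ 2) :=
    (hsol'.darboux_self hG hG1).congr hpot
  have hsq := integrable_div_primitive hG hG1 hGinv
  refine ⟨fun x => q x + -2 * (2 * f x * g x / G x - f x ^ 4 / G x ^ 2), ?_, ?_, ?_, ?_⟩
  · have hGc : ContinuousOn G (Ioi b) := fun x hx => (hG x hx).continuousAt.continuousWithinAt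
    have hne : ∀ x ∈ Ioi b, G x ≠ 0 := fun x hx => (one_pos.trans_le (hG1 x hx)).ne'
    have hf' := hsol'.continuousOn
    have hg' := hsol'.continuousOn_snd
    refine (h.cont.mono (Ioi_subset_Ioi hab.le)).add (continuousOn_const.mul (ContinuousOn.sub ?_ ?_))
    · exact ((continuousOn_const.mul hf').mul hg').div hGc hne
    · exact (hf'.pow 4).div (hGc.pow 2) fun x hx => pow_ne_zero 2 (hne x hx)
  · have := h.asymp.add (tendsto_darboux_potential hα0 hw hAB hσ hGinv hGp)
    rw [add_zero] at this
    refine this.congr fun x => ?_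
    rw [Finset.sum_range_succ]
    ring
  · intro E hE A' B'
    obtain ⟨u, v, hu, huw⟩ := h.basis E (fun k hk => hE k (by omega)) A' B'
    have hnE : (n : ℝ) - E ≠ 0 := sub_ne_zero.2 (hE n (by omega)).symm
    exact ⟨_, _, (hsol'.darboux hG hG1 (hu.mono hab.le) hnE).congr hpot,
      huw.of_correction (darboux_correction_fst hw.bounded huw.bounded hGinv)
        (darboux_correction_snd hα0 hw.bounded huw.bounded hGinv)⟩
  · intro k hk
    rcases Nat.lt_succ_iff_lt_or_eq.1 hk with hk | rfl
    · obtain ⟨u, v, hu, huw, hne, hui⟩ := h.bound k hk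
      have hnk : (n : ℝ) - k ≠ 0 := sub_ne_zero.2 (by exact_mod_cast hk.ne')
      have hnew := (hsol'.darboux hG hG1 (hu.mono hab.le) hnk).congr hpot
      refine ⟨_, _, hnew, huw.of_correction
        (darboux_correction_fst hw.bounded huw hGinv)
        (darboux_correction_snd hα0 hw.bounded huw hGinv), ?_, ?_⟩
      · refine frequently_transformed_ne_zero hG hG1 hGinv (fun x hx => ?_)
          (hw.bounded.wronskian huw _) hne
        refine ((hasDerivAt_wronskian hsol' (hu.mono hab.le) hx).div_const ((n : ℝ) - k)).congr_deriv
          ?_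
        field_simp
      · obtain ⟨C, hC⟩ := (hw.bounded.wronskian huw ((n : ℝ) - k)).bound
        refine Asymptotics.IsBigO.integrableAtFilter
          (g := fun x => 2 * u x ^ 2 + 2 * C ^ 2 * (f x / G x) ^ 2) ?_ ?_ ?_
        · refine Asymptotics.IsBigO.of_bound 1 ?_
          filter_upwards [hC] with x hx
          simp only [Real.norm_eq_abs, abs_one, mul_one, one_mul] at hx ⊢
          rw [abs_of_nonneg (sq_nonneg _), abs_of_nonneg (by positivity)]
          generalize (f x * v x - g x * u x) / ((n : ℝ) - k) = J at *
          have hJ : J ^ 2 ≤ C ^ 2 := sq_le_sq' (abs_le.1 hx).1 (abs_le.1 hx).2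
          nlinarith [sq_nonneg (u x + f x / G x * J),
            mul_le_mul_of_nonneg_left hJ (sq_nonneg (f x / G x))]
        · exact ⟨Ioi b, Ioi_mem_atTop b,
            (hnew.continuousOn.pow 2).aestronglyMeasurable measurableSet_Ioi⟩
        · obtain ⟨S, hS, hSi⟩ := hui
          obtain ⟨T, hT, hTi⟩ := hsq
          exact ⟨S ∩ T, inter_mem hS hT, ((hSi.mono_set inter_subset_left).const_mul 2).add
            ((hTi.mono_set inter_subset_right).const_mul (2 * C ^ 2))⟩
    · refine ⟨_, _, hself, ?_, ?_, hsq⟩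
      · have hb := hw.bounded
        have hneg : Tendsto (fun x : ℝ => x ^ (-α)) atTop (𝓝 0) := rpow_tendsto_zero (by linarith)
        constructor
        · exact ((tendsto_zero_of_isBigO_one hb.fst hGinv).isBigO_one ℝ).congr_left
            fun x => by ring
        · have hf3 := hb.fst.pow 3
          simp only [one_pow] at hf3
          have := ((tendsto_zero_of_isBigO_one hb.snd hGinv).sub
            (tendsto_zero_of_isBigO_one hf3 ((hneg.mul (hGinv.pow 2)).trans
              (by simp)))).isBigO_one ℝ
          refine this.congr' ?_ EventuallyEq.rfl
          filter_upwards [eventually_gt_atTop 0] with x hx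
          have hX := (Real.rpow_pos_of_pos hx (α / 4)).ne'
          obtain ⟨-, -, h3, -, h5⟩ := rpow_quarter (α := α) hx
          rw [h3, h5]
          generalize hK : (G x)⁻¹ = K
          simp only [div_eq_mul_inv, ← inv_pow, hK]
          field_simp
      · intro hev
        have hzero : IntegrableAtFilter (fun x => f x ^ 2) atTop := by
          obtain ⟨c, hc⟩ := eventually_atTop.1 hev
          refine ⟨Ioi (max b c), Ioi_mem_atTop _, ?_⟩
          refine (integrableOn_zero (ε' := ℝ)).congr_fun (fun x hx => ?_) measurableSet_Ioi
          have h0 := not_not.1 (hc x ((le_max_right _ _).trans (le_of_lt hx)))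
          have hne : G x ≠ 0 :=
            (one_pos.trans_le (hG1 x ((le_max_left _ _).trans_lt hx))).ne'
          rw [div_eq_zero_iff, or_iff_left hne] at h0
          simp [h0]
        have := hw.eq_zero_of_integrable hα0 hα2 hq0 hsol hzero
        linarith

section linear_ode

variable {F : Type*} [NormedAddCommGroup F] [NormedSpace ℝ F] {A : ℝ → F →L[ℝ] F} {a : ℝ}

lemma norm_integral_exp_smul_le {K : ℝ → ℝ} (hA : Continuous A)
    (hK : ∀ x, HasDerivAt K (2 * ‖A x‖) x) {w : ℝ → F} {C : ℝ} (hC : 0 ≤ C)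
    (hwC : ∀ s, ‖w s‖ ≤ C) {X : ℝ} (hX : a ≤ X) :
    ‖∫ s in a..X, Real.exp (K s) • A s (w s)‖ ≤ C / 2 * Real.exp (K X) := by
  have hKc : Continuous K := continuous_iff_continuousAt.2 fun x => (hK x).continuousAt
  have hd : ∀ x, HasDerivAt (fun s => C / 2 * Real.exp (K s))
      (C / 2 * (Real.exp (K x) * (2 * ‖A x‖))) x := fun x => ((hK x).exp).const_mul _
  have hi : IntervalIntegrable (fun x => C / 2 * (Real.exp (K x) * (2 * ‖A x‖))) volume a X :=
    Continuous.intervalIntegrable (by fun_prop) _ _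
  refine (intervalIntegral.norm_integral_le_of_norm_le hX (ae_of_all _ fun s _ => ?_) hi).trans ?_
  · rw [norm_smul, Real.norm_eq_abs, Real.abs_exp]
    have := ((A s).le_opNorm (w s)).trans (mul_le_mul_of_nonneg_left (hwC s) (norm_nonneg _))
    have := mul_le_mul_of_nonneg_left this (Real.exp_pos (K s)).le
    linarith
  · rw [intervalIntegral.integral_eq_sub_of_hasDerivAt (fun x _ => hd x) hi]
    have : 0 ≤ C / 2 * Real.exp (K a) := by positivity
    linarith

/-- Global existence for linear ordinary differential equations with continuous coefficients. -/
theorem exists_linear_ode_solution [CompleteSpace F] (hA : Continuous A) (a : ℝ) (Y₀ : F) :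
    ∃ Y : ℝ → F, Continuous Y ∧ Y a = Y₀ ∧ ∀ x, a < x → HasDerivAt Y (A x (Y x)) x := by
  set K : ℝ → ℝ := fun x => 2 * ∫ s in a..x, ‖A s‖ with hKdef
  have hK : ∀ x, HasDerivAt K (2 * ‖A x‖) x := fun x =>
    (intervalIntegral.integral_hasDerivAt_right (hA.norm.intervalIntegrable _ _)
      (hA.norm.stronglyMeasurableAtFilter _ _) hA.norm.continuousAt).const_mul 2
  have hKc : Continuous K := continuous_iff_continuousAt.2 fun x => (hK x).continuousAt
  have hK0 : ∀ x, a ≤ x → 0 ≤ K x := fun x hx => mul_nonneg zero_le_two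
    (intervalIntegral.integral_nonneg hx fun _ _ => norm_nonneg _)
  have hsmul : ∀ w : ℝ → F, Continuous w → Continuous fun s => Real.exp (K s) • A s (w s) :=
    fun w hw => (Real.continuous_exp.comp hKc).smul (hA.clm_apply hw)
  have hprim : ∀ w : ℝ → F, Continuous w → ∀ x, HasDerivAt
      (fun x => Y₀ + ∫ s in a..x, Real.exp (K s) • A s (w s)) (Real.exp (K x) • A x (w x)) x :=
    fun w hw x => (intervalIntegral.integral_hasDerivAt_right ((hsmul w hw).intervalIntegrable _ _)
      ((hsmul w hw).stronglyMeasurableAtFilter _ _) (hsmul w hw).continuousAt).const_add Y₀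
  have hcont : ∀ w : ℝ → F, Continuous w → Continuous
      (fun x => Y₀ + ∫ s in a..(max x a), Real.exp (K s) • A s (w s)) := fun w hw =>
    (continuous_iff_continuousAt.2 fun x => (hprim w hw x).continuousAt).comp
      (continuous_id.max continuous_const)
  have hexp : ∀ t : ℝ, Real.exp (-t) * Real.exp t = 1 := fun t => by
    rw [← Real.exp_add, neg_add_cancel, Real.exp_zero]
  let T : BoundedContinuousFunction ℝ F → BoundedContinuousFunction ℝ F := fun y =>
    BoundedContinuousFunction.ofNormedAddCommGroup
      (fun x => Real.exp (-K (max x a)) •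
        (Y₀ + ∫ s in a..(max x a), Real.exp (K s) • A s (y s)))
      ((Real.continuous_exp.comp (hKc.comp (continuous_id.max continuous_const)).neg).smul
        (hcont y y.continuous))
      (‖Y₀‖ + ‖y‖ / 2) (fun x => by
        have hx : a ≤ max x a := le_max_right _ _
        rw [norm_smul, Real.norm_eq_abs, Real.abs_exp]
        have h1 := norm_add_le Y₀ (∫ s in a..(max x a), Real.exp (K s) • A s (y s))
        have h2 := norm_integral_exp_smul_le hA hK (norm_nonneg y) y.norm_coe_le_norm hx
        have h3 : Real.exp (-K (max x a)) ≤ 1 := Real.exp_le_one_iff.2 (by linarith [hK0 _ hx])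
        have h4 := Real.exp_pos (-K (max x a))
        have h5 := mul_le_mul_of_nonneg_left (h1.trans (add_le_add_right h2 _)) h4.le
        have h6 := mul_le_mul_of_nonneg_right h3 (norm_nonneg Y₀)
        linear_combination h5 + h6 + ‖y‖ / 2 * hexp (K (max x a)))
  have hTx : ∀ y x, T y x = Real.exp (-K (max x a)) •
      (Y₀ + ∫ s in a..(max x a), Real.exp (K s) • A s (y s)) := fun _ _ => rfl
  have hT : ContractingWith (1 / 2) T := by
    refine ⟨by rw [← NNReal.coe_lt_coe]; norm_num, LipschitzWith.of_dist_le_mul fun y z => ?_⟩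
    refine (BoundedContinuousFunction.dist_le (by positivity)).2 fun x => ?_
    have hx : a ≤ max x a := le_max_right _ _
    have hsub : T y x - T z x = Real.exp (-K (max x a)) •
        ∫ s in a..(max x a), Real.exp (K s) • A s (y s - z s) := by
      rw [hTx, hTx, ← smul_sub, add_sub_add_left_eq_sub, ← intervalIntegral.integral_sub
        ((hsmul y y.continuous).intervalIntegrable _ _) ((hsmul z z.continuous).intervalIntegrable _ _)]
      simp only [map_sub, smul_sub]
    rw [dist_eq_norm, hsub, norm_smul, Real.norm_eq_abs, Real.abs_exp, dist_eq_norm]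
    have h2 := norm_integral_exp_smul_le hA hK (norm_nonneg (y - z)) (y - z).norm_coe_le_norm hx
    have h5 := mul_le_mul_of_nonneg_left h2 (Real.exp_pos (-K (max x a))).le
    simp only [BoundedContinuousFunction.coe_sub, Pi.sub_apply] at h5
    push_cast
    linear_combination h5 + ‖y - z‖ / 2 * hexp (K (max x a))
  obtain ⟨y, hy⟩ : ∃ y, T y = y := ⟨_, hT.fixedPoint_isFixedPt⟩
  have hyx := hTx y
  rw [hy] at hyx
  refine ⟨_, hcont y y.continuous, by simp, fun x hx => ?_⟩
  have hev : (fun x => Y₀ + ∫ s in a..(max x a), Real.exp (K s) • A s (y s)) =ᶠ[𝓝 x]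
      fun x => Y₀ + ∫ s in a..x, Real.exp (K s) • A s (y s) := by
    filter_upwards [lt_mem_nhds hx] with z hz
    rw [max_eq_left hz.le]
  refine ((hprim y y.continuous x).congr_of_eventuallyEq hev).congr_deriv ?_
  rw [hyx x, map_smul, smul_smul, max_eq_left hx.le, mul_comm, hexp, one_smul]

end linear_ode

/-- A fundamental system of `u'' = p u` with Wronskian one. -/
lemma exists_isSol {p : ℝ → ℝ} (hp : Continuous p) (a : ℝ) :
    ∃ u₁ v₁ u₂ v₂ : ℝ → ℝ, IsSol p a 0 u₁ v₁ ∧ IsSol p a 0 u₂ v₂ ∧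
      ∀ x, a < x → u₁ x * v₂ x - v₁ x * u₂ x = 1 := by
  let A : ℝ → ℝ × ℝ →L[ℝ] ℝ × ℝ := fun x =>
    (ContinuousLinearMap.inl ℝ ℝ ℝ).comp (ContinuousLinearMap.snd ℝ ℝ ℝ) +
      p x • (ContinuousLinearMap.inr ℝ ℝ ℝ).comp (ContinuousLinearMap.fst ℝ ℝ ℝ)
  have hA : Continuous A := continuous_const.add (hp.smul continuous_const)
  have hAx : ∀ x y, A x y = (y.2, p x * y.1) := fun x y => by simp [A]
  have key : ∀ Y : ℝ → ℝ × ℝ, (∀ x, a < x → HasDerivAt Y (A x (Y x)) x) →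
      IsSol p a 0 (fun x => (Y x).1) (fun x => (Y x).2) := fun Y hY => by
    constructor
    · intro x hx
      have := (hasFDerivAt_fst (𝕜 := ℝ) (p := Y x)).comp_hasDerivAt x (hY x hx)
      exact this.congr_deriv (by simp [hAx])
    · intro x hx
      have := (hasFDerivAt_snd (𝕜 := ℝ) (p := Y x)).comp_hasDerivAt x (hY x hx)
      exact this.congr_deriv (by simp [hAx])
  obtain ⟨Y, hYc, hY0, hY⟩ := exists_linear_ode_solution hA a (1, 0)
  obtain ⟨Z, hZc, hZ0, hZ⟩ := exists_linear_ode_solution hA a (0, 1)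
  refine ⟨_, _, _, _, key Y hY, key Z hZ, ?_⟩
  set W : ℝ → ℝ := fun x => (Y x).1 * (Z x).2 - (Y x).2 * (Z x).1
  have hWc : Continuous W := by fun_prop
  have hW : ∀ x, a < x → HasDerivAt W 0 x := fun x hx =>
    (hasDerivAt_wronskian (key Y hY) (key Z hZ) hx).congr_deriv (by simp)
  have hWa : W a = 1 := by simp [W, hY0, hZ0]
  intro x hx
  have h1 : Tendsto W (𝓝[>] a) (𝓝 1) := hWa ▸ hWc.continuousWithinAt
  have h2 : Tendsto W (𝓝[>] a) (𝓝 (W x)) := by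
    refine tendsto_const_nhds.congr' ?_
    filter_upwards [self_mem_nhdsWithin] with y hy
    exact constant_of_hasDerivAt_zero hW hx hy
  exact tendsto_nhds_unique h2 h1

lemma exists_tendsto_of_isBigO_deriv {f f' : ℝ → ℝ} {p : ℝ} (hp : 1 < p)
    (hf : ∀ᶠ x in atTop, HasDerivAt f (f' x) x) (hf' : f' =O[atTop] fun x => x ^ (-p)) :
    ∃ L, Tendsto f atTop (𝓝 L) := by
  obtain ⟨C, hC⟩ := hf'.bound
  obtain ⟨b, hb⟩ := eventually_atTop.1 ((hf.and hC).and (eventually_gt_atTop 0))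
  have hb0 : 0 < b := (hb b le_rfl).2
  have hd : ∀ x ∈ Ioi b, HasDerivAt f (deriv f x) x := fun x hx =>
    (hb x (le_of_lt hx)).1.1.differentiableAt.hasDerivAt
  refine ⟨_, tendsto_limUnder_of_hasDerivAt_of_integrableOn_Ioi (a := b) hd ?_⟩
  refine ((integrableOn_Ioi_rpow_of_lt (a := -p) (by linarith) hb0).const_mul C).mono'
    (aestronglyMeasurable_deriv f _) ?_
  refine (ae_restrict_iff' measurableSet_Ioi).2 (ae_of_all _ fun x hx => ?_)
  obtain ⟨⟨h1, h2⟩, h3⟩ := hb x (le_of_lt hx)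
  rw [h1.deriv]
  rwa [Real.norm_of_nonneg (Real.rpow_nonneg h3.le _)] at h2

/-- A planar system that is an integrable perturbation of a rotation with phase `θ` is
asymptotic to a rotation. -/
lemma exists_rotation_asymptotics {P w θ ω e₁ e₂ : ℝ → ℝ} {p : ℝ} (hp : 1 < p)
    (hP : ∀ᶠ x in atTop, HasDerivAt P (ω x * w x + e₁ x) x)
    (hw : ∀ᶠ x in atTop, HasDerivAt w (-(ω x * P x) + e₂ x) x)
    (hθ : ∀ᶠ x in atTop, HasDerivAt θ (ω x) x)
    (he₁ : e₁ =O[atTop] fun x => x ^ (-p) * (|P x| + |w x|))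
    (he₂ : e₂ =O[atTop] fun x => x ^ (-p) * (|P x| + |w x|)) :
    ∃ A B : ℝ,
      Tendsto (fun x => P x - (A * Real.cos (θ x) + B * Real.sin (θ x))) atTop (𝓝 0) ∧
      Tendsto (fun x => w x - (B * Real.cos (θ x) - A * Real.sin (θ x))) atTop (𝓝 0) := by
  obtain ⟨c, hc, h₁⟩ := he₁.exists_nonneg
  obtain ⟨d, hd, h₂⟩ := he₂.exists_nonneg
  have hbd : ∃ R, ∀ᶠ x in atTop, P x ^ 2 + w x ^ 2 ≤ R := by
    obtain ⟨b, hb⟩ := eventually_atTop.1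
      ((hP.and hw).and ((h₁.bound.and h₂.bound).and (eventually_gt_atTop 0)))
    set m := 4 * (c + d) with hm
    set M := m / (p - 1) with hM
    have hp1 : 0 < p - 1 := by linarith
    have hM0 : 0 ≤ M := by positivity
    have hder : ∀ x, b ≤ x → HasDerivAt
        (fun x => (P x ^ 2 + w x ^ 2) * Real.exp (M * x ^ (1 - p)))
        ((2 * P x * e₁ x + 2 * w x * e₂ x - m * x ^ (-p) * (P x ^ 2 + w x ^ 2)) *
          Real.exp (M * x ^ (1 - p))) x := fun x hx => by
      obtain ⟨⟨g1, g2⟩, -, g3⟩ := hb x hx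
      refine (((g1.fun_pow 2).fun_add (g2.fun_pow 2)).fun_mul
        ((Real.hasDerivAt_rpow_const (p := 1 - p) (Or.inl g3.ne')).const_mul M).exp).congr_deriv ?_
      rw [show 1 - p - 1 = -p by ring, hM]
      field_simp
      push_cast
      ring
    have hanti : AntitoneOn (fun x => (P x ^ 2 + w x ^ 2) * Real.exp (M * x ^ (1 - p))) (Ici b) := by
      refine antitoneOn_of_deriv_nonpos (convex_Ici b)
        (fun x hx => (hder x hx).continuousAt.continuousWithinAt)
        (fun x hx => (hder x (interior_subset hx)).differentiableAt.differentiableWithinAt)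
        fun x hx => ?_
      have hx := interior_subset hx
      rw [(hder x hx).deriv]
      obtain ⟨-, ⟨g1, g2⟩, g3⟩ := hb x hx
      refine mul_nonpos_of_nonpos_of_nonneg ?_ (Real.exp_pos _).le
      have hx0 := Real.rpow_pos_of_pos g3 (-p)
      generalize x ^ (-p) = y at *
      have hnn : 0 ≤ y * (|P x| + |w x|) := by positivity
      simp only [Real.norm_eq_abs] at g1 g2
      rw [abs_of_nonneg hnn] at g1 g2
      have k1 : P x * e₁ x ≤ |P x| * (c * (y * (|P x| + |w x|))) :=
        (le_abs_self _).trans (by rw [abs_mul]; gcongr)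
      have k2 : w x * e₂ x ≤ |w x| * (d * (y * (|P x| + |w x|))) :=
        (le_abs_self _).trans (by rw [abs_mul]; gcongr)
      have k3 : |P x| * (|P x| + |w x|) ≤ 2 * (P x ^ 2 + w x ^ 2) := by
        rw [← sq_abs (P x), ← sq_abs (w x)]; nlinarith [sq_nonneg (|P x| - |w x|), abs_nonneg (w x)]
      have k4 : |w x| * (|P x| + |w x|) ≤ 2 * (P x ^ 2 + w x ^ 2) := by
        rw [← sq_abs (P x), ← sq_abs (w x)]; nlinarith [sq_nonneg (|P x| - |w x|), abs_nonneg (w x)]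
      have k5 := mul_le_mul_of_nonneg_left k3 (mul_nonneg hc hx0.le)
      have k6 := mul_le_mul_of_nonneg_left k4 (mul_nonneg hd hx0.le)
      rw [hm]
      linear_combination 2 * k1 + 2 * k2 + 2 * k5 + 2 * k6
    refine ⟨(P b ^ 2 + w b ^ 2) * Real.exp (M * b ^ (1 - p)), ?_⟩
    filter_upwards [eventually_ge_atTop b] with x hx
    refine le_trans ?_ (hanti self_mem_Ici hx hx)
    have hx0 := (hb x hx).2.2
    exact le_mul_of_one_le_right (by positivity)
      (Real.one_le_exp (mul_nonneg hM0 (Real.rpow_nonneg hx0.le _)))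
  obtain ⟨R, hR⟩ := hbd
  have hO : (fun x => x ^ (-p) * (|P x| + |w x|)) =O[atTop] fun x => x ^ (-p) := by
    refine Asymptotics.IsBigO.of_bound (R + 1) ?_
    filter_upwards [hR] with x hx
    rw [norm_mul, mul_comm, Real.norm_of_nonneg (r := |P x| + |w x|) (by positivity)]
    refine mul_le_mul_of_nonneg_right ?_ (norm_nonneg _)
    rw [← sq_abs (P x), ← sq_abs (w x)] at hx
    nlinarith [sq_nonneg (|P x| - 1/2), sq_nonneg (|w x| - 1/2)]
  have hmulO : ∀ {e t : ℝ → ℝ}, (e =O[atTop] fun x => x ^ (-p) * (|P x| + |w x|)) →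
      (∀ x, |t x| ≤ 1) → (fun x => e x * t x) =O[atTop] fun x => x ^ (-p) := fun he ht => by
    simpa using (he.trans hO).mul (isBigO_one_of_abs_le 1 ht)
  have hcos : ∀ x, |Real.cos (θ x)| ≤ 1 := fun x => Real.abs_cos_le_one _
  have hsin : ∀ x, |Real.sin (θ x)| ≤ 1 := fun x => Real.abs_sin_le_one _
  obtain ⟨A, hA⟩ := exists_tendsto_of_isBigO_deriv
    (f := fun x => P x * Real.cos (θ x) - w x * Real.sin (θ x))
    (f' := fun x => e₁ x * Real.cos (θ x) - e₂ x * Real.sin (θ x)) hp (by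
      filter_upwards [hP, hw, hθ] with x h1 h2 h3
      exact ((h1.fun_mul h3.cos).fun_sub (h2.fun_mul h3.sin)).congr_deriv (by ring))
    ((hmulO he₁ hcos).sub (hmulO he₂ hsin))
  obtain ⟨B, hB⟩ := exists_tendsto_of_isBigO_deriv
    (f := fun x => P x * Real.sin (θ x) + w x * Real.cos (θ x))
    (f' := fun x => e₁ x * Real.sin (θ x) + e₂ x * Real.cos (θ x)) hp (by
      filter_upwards [hP, hw, hθ] with x h1 h2 h3
      exact ((h1.fun_mul h3.sin).fun_add (h2.fun_mul h3.cos)).congr_deriv (by ring))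
    ((hmulO he₁ hsin).add (hmulO he₂ hcos))
  have hA' := hA.sub_const A
  have hB' := hB.sub_const B
  rw [sub_self] at hA' hB'
  refine ⟨A, B, ?_, ?_⟩
  · have := (tendsto_zero_of_isBigO_one (isBigO_one_of_abs_le 1 hcos) hA').add
      (tendsto_zero_of_isBigO_one (isBigO_one_of_abs_le 1 hsin) hB')
    rw [add_zero] at this
    refine this.congr fun x => ?_
    linear_combination P x * Real.sin_sq_add_cos_sq (θ x)
  · have := (tendsto_zero_of_isBigO_one (isBigO_one_of_abs_le 1 hcos) hB').sub
      (tendsto_zero_of_isBigO_one (isBigO_one_of_abs_le 1 hsin) hA')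
    rw [sub_zero] at this
    refine this.congr fun x => ?_
    linear_combination w x * Real.sin_sq_add_cos_sq (θ x)

lemma isBigO_rpow_of_exponent_le {r t : ℝ} (h : r ≤ t) :
    (fun x : ℝ => x ^ r) =O[atTop] fun x => x ^ t := by
  refine Asymptotics.IsBigO.of_bound 1 ?_
  filter_upwards [eventually_ge_atTop 1] with x hx
  rw [one_mul, Real.norm_of_nonneg (by positivity), Real.norm_of_nonneg (by positivity)]
  exact Real.rpow_le_rpow_of_exponent_le hx h

lemma hasDerivAt_phase {α : ℝ} (hα0 : 0 < α) (hα2 : α < 2) (E : ℝ) {x : ℝ} (hx : 0 < x) :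
    HasDerivAt (phase α E) (x ^ (α / 2) + E / 2 * x ^ (-(α / 2))) x := by
  have h1 : 1 + α / 2 ≠ 0 := by positivity
  have h2 : 2 - α ≠ 0 := by linarith
  refine (((Real.hasDerivAt_rpow_const (Or.inl hx.ne')).div_const (1 + α / 2)).fun_add
    (((Real.hasDerivAt_rpow_const (Or.inl hx.ne')).div_const (1 - α / 2)).const_mul
      (E / 2))).congr_deriv ?_
  rw [add_sub_cancel_left, show 1 - α / 2 - 1 = -(α / 2) by ring]
  field_simp

lemma exists_isWKB_free {α a E : ℝ} {u v : ℝ → ℝ} (hα0 : 2 / 3 < α) (hα2 : α < 2)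
    (h : IsSol (fun x => 0 - x ^ α) a E u v) : ∃ A B, IsWKB α E A B u v := by
  have hpos : 0 < α := by linarith
  set P : ℝ → ℝ := fun x => x ^ (α / 4) * u x with hP
  set w₀ : ℝ → ℝ := fun x => x ^ (-(α / 4)) * v x + α / 4 * (x ^ (-(α / 4)) * x⁻¹) * u x with hw₀
  set w : ℝ → ℝ := fun x => (1 - E / 2 * x ^ (-α)) * w₀ x with hw
  have hev : ∀ᶠ x : ℝ in atTop, a < x ∧ 0 < x :=
    (eventually_gt_atTop a).and (eventually_gt_atTop 0)
  have hneg : Tendsto (fun x : ℝ => x ^ (-α)) atTop (𝓝 0) := rpow_tendsto_zero (by linarith)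
  have hPd : ∀ x, a < x → 0 < x → HasDerivAt P (x ^ (α / 2) * w₀ x) x := fun x hx hx0 => by
    refine ((Real.hasDerivAt_rpow_const (Or.inl hx0.ne')).fun_mul (h.fst x hx)).congr_deriv ?_
    obtain ⟨h1, h2, h3, h4, h5⟩ := rpow_quarter (α := α) hx0
    have hX := (Real.rpow_pos_of_pos hx0 (α / 4)).ne'
    simp only [hw₀, rpow_sub_one_eq_mul_inv hx0, h1, h3]
    field_simp
    ring
  have hw₀d : ∀ x, a < x → 0 < x → HasDerivAt w₀ (-(x ^ (α / 2) + E * x ^ (-(α / 2)) +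
      α / 4 * (1 + α / 4) * (x ^ (-(α / 2)) * x⁻¹ * x⁻¹)) * P x) x := fun x hx hx0 => by
    have hr := Real.hasDerivAt_rpow_const (x := x) (p := -(α / 4)) (Or.inl hx0.ne')
    refine ((hr.fun_mul (h.snd x hx)).fun_add
      (((hr.fun_mul (hasDerivAt_inv hx0.ne')).const_mul (α / 4)).fun_mul (h.fst x hx))).congr_deriv ?_
    obtain ⟨h1, h2, h3, h4, h5⟩ := rpow_quarter (α := α) hx0
    have hX := (Real.rpow_pos_of_pos hx0 (α / 4)).ne'
    simp only [hP, rpow_sub_one_eq_mul_inv hx0, h1, h2, h3, h4]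
    field_simp
    ring
  have hwd : ∀ x, a < x → 0 < x → HasDerivAt w (α * E / 2 * (x ^ (-α) * x⁻¹) * w₀ x -
      (1 - E / 2 * x ^ (-α)) * (x ^ (α / 2) + E * x ^ (-(α / 2)) +
        α / 4 * (1 + α / 4) * (x ^ (-(α / 2)) * x⁻¹ * x⁻¹)) * P x) x := fun x hx hx0 => by
    have hr := Real.hasDerivAt_rpow_const (x := x) (p := -α) (Or.inl hx0.ne')
    refine (((hr.const_mul (E / 2)).const_sub 1).fun_mul (hw₀d x hx hx0)).congr_deriv ?_
    rw [rpow_sub_one_eq_mul_inv hx0]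
    ring
  have hw₀w : w₀ =O[atTop] w := by
    refine Asymptotics.IsBigO.of_bound 2 ?_
    have : Tendsto (fun x : ℝ => 1 - E / 2 * x ^ (-α)) atTop (𝓝 1) := by
      simpa using (hneg.const_mul (E / 2)).const_sub 1
    filter_upwards [this.eventually (lt_mem_nhds (show (1 / 2 : ℝ) < 1 by norm_num))] with x hx
    simp only [hw, norm_mul]
    have := hx.le.trans (le_abs_self _)
    rw [← Real.norm_eq_abs] at this
    nlinarith [norm_nonneg (w₀ x)]
  have hOP : P =O[atTop] fun x => |P x| + |w x| := Asymptotics.isBigO_of_le _ fun x => by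
    rw [Real.norm_eq_abs, Real.norm_of_nonneg (by positivity)]
    linarith [abs_nonneg (w x)]
  have hOw : w₀ =O[atTop] fun x => |P x| + |w x| := hw₀w.trans <|
    Asymptotics.isBigO_of_le _ fun x => by
      rw [Real.norm_eq_abs, Real.norm_of_nonneg (by positivity)]
      linarith [abs_nonneg (P x)]
  have hc₁ : (fun x : ℝ => x ^ (-α) * x ^ (-(α / 2))) =O[atTop] fun x => x ^ (-(3 * α / 2)) := by
    refine (isBigO_rpow_of_exponent_le le_rfl).congr' ?_ EventuallyEq.rfl
    filter_upwards [eventually_gt_atTop 0] with x hx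
    rw [← Real.rpow_add hx]
    ring_nf
  have hc₂ : (fun x : ℝ => x ^ (-α) * x⁻¹) =O[atTop] fun x => x ^ (-(3 * α / 2)) := by
    refine (isBigO_rpow_of_exponent_le (r := -α - 1) (by linarith)).congr' ?_ EventuallyEq.rfl
    filter_upwards [eventually_gt_atTop 0] with x hx
    rw [rpow_sub_one_eq_mul_inv hx]
  have hc₃ : (fun x : ℝ => x ^ (-(α / 2)) * x⁻¹ * x⁻¹) =O[atTop] fun x => x ^ (-(3 * α / 2)) := by
    refine (isBigO_rpow_of_exponent_le (r := -(α / 2) - 1 - 1) (by linarith)).congr' ?_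
      EventuallyEq.rfl
    filter_upwards [eventually_gt_atTop 0] with x hx
    rw [rpow_sub_one_eq_mul_inv hx, rpow_sub_one_eq_mul_inv hx]
  have hc₄ : (fun x : ℝ => (1 - E / 2 * x ^ (-α)) * (x ^ (-(α / 2)) * x⁻¹ * x⁻¹)) =O[atTop]
      fun x => x ^ (-(3 * α / 2)) := by
    simpa using (((hneg.const_mul (E / 2)).const_sub 1).isBigO_one ℝ).mul hc₃
  obtain ⟨A, B, hA, hB⟩ := exists_rotation_asymptotics (P := P) (w := w) (θ := phase α E)
    (ω := fun x => x ^ (α / 2) + E / 2 * x ^ (-(α / 2)))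
    (e₁ := fun x => E ^ 2 / 4 * (x ^ (-α) * x ^ (-(α / 2)) * w₀ x))
    (e₂ := fun x => α * E / 2 * (x ^ (-α) * x⁻¹ * w₀ x) +
      E ^ 2 / 2 * (x ^ (-α) * x ^ (-(α / 2)) * P x) -
      α / 4 * (1 + α / 4) * ((1 - E / 2 * x ^ (-α)) * (x ^ (-(α / 2)) * x⁻¹ * x⁻¹) * P x))
    (p := 3 * α / 2) (by linarith)
    (by
      filter_upwards [hev] with x hx
      refine (hPd x hx.1 hx.2).congr_deriv ?_
      obtain ⟨h1, h2, h3, h4, h5⟩ := rpow_quarter (α := α) hx.2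
      have hX := (Real.rpow_pos_of_pos hx.2 (α / 4)).ne'
      simp only [hw, h1, h4, h5]
      field_simp
      ring)
    (by
      filter_upwards [hev] with x hx
      refine (hwd x hx.1 hx.2).congr_deriv ?_
      obtain ⟨h1, h2, h3, h4, h5⟩ := rpow_quarter (α := α) hx.2
      have hX := (Real.rpow_pos_of_pos hx.2 (α / 4)).ne'
      have hx0 := hx.2.ne'
      simp only [h1, h4, h5]
      field_simp
      ring)
    (by
      filter_upwards [hev] with x hx
      exact hasDerivAt_phase hpos hα2 E hx.2)
    ((hc₁.mul hOw).const_mul_left _)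
    ((((hc₂.mul hOw).const_mul_left _).add ((hc₁.mul hOP).const_mul_left _)).sub
      ((hc₄.mul hOP).const_mul_left _))
  refine ⟨A, B, hA, ?_⟩
  have hPb : P =O[atTop] fun _ => (1 : ℝ) := by
    simpa using (hA.isBigO_one ℝ).add (isBigO_cos_sin A B (phase α E))
  have hwb : w =O[atTop] fun _ => (1 : ℝ) :=
    ((hB.isBigO_one ℝ).add (isBigO_cos_sin B (-A) (phase α E))).congr_left fun x => by ring
  have hβ : Tendsto (fun x : ℝ => α / 4 * x ^ (-(α / 2) - 1)) atTop (𝓝 0) := by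
    simpa using (rpow_tendsto_zero (p := -(α / 2) - 1) (by linarith)).const_mul (α / 4)
  have hβ' := hneg.const_mul (E / 2)
  rw [mul_zero] at hβ'
  have := (hB.add (tendsto_zero_of_isBigO_one (hw₀w.trans hwb) hβ')).sub
    (tendsto_zero_of_isBigO_one hPb hβ)
  simp only [sub_zero, add_zero] at this
  refine this.congr' ?_
  filter_upwards [hev] with x hx
  obtain ⟨h1, h2, h3, h4, h5⟩ := rpow_quarter (α := α) hx.2
  have hX := (Real.rpow_pos_of_pos hx.2 (α / 4)).ne'
  have hx0 := hx.2.ne'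
  simp only [hw, hw₀, hP, rpow_sub_one_eq_mul_inv hx.2, h3, h4, h5]
  field_simp
  ring

lemma IsWKB.tendsto_wronskian {α E A₁ B₁ A₂ B₂ : ℝ} {u₁ v₁ u₂ v₂ : ℝ → ℝ}
    (h₁ : IsWKB α E A₁ B₁ u₁ v₁) (h₂ : IsWKB α E A₂ B₂ u₂ v₂) :
    Tendsto (fun x => u₁ x * v₂ x - v₁ x * u₂ x) atTop (𝓝 (A₁ * B₂ - B₁ * A₂)) := by
  have hF : ∀ A B, (fun x => A * Real.cos (phase α E x) + B * Real.sin (phase α E x)) =O[atTop]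
      fun _ => (1 : ℝ) := fun A B => isBigO_cos_sin A B _
  have hG : ∀ A B, (fun x => B * Real.cos (phase α E x) - A * Real.sin (phase α E x)) =O[atTop]
      fun _ => (1 : ℝ) := fun A B =>
    (isBigO_cos_sin B (-A) (phase α E)).congr_left fun x => by ring
  have := ((tendsto_mul_sub h₁.fst h₂.snd (hF _ _) (hG _ _)).sub
    (tendsto_mul_sub h₁.snd h₂.fst (hG _ _) (hF _ _))).add_const (A₁ * B₂ - B₁ * A₂)
  rw [sub_zero, zero_add] at this
  refine this.congr' ?_
  filter_upwards [eventually_gt_atTop 0] with x hx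
  have hX := (Real.rpow_pos_of_pos hx (α / 4)).ne'
  have hq : x ^ (α / 4) * x ^ (-(α / 4)) = 1 := by
    rw [(rpow_quarter hx).2.2.1, mul_inv_cancel₀ hX]
  linear_combination (u₁ x * v₂ x - v₁ x * u₂ x) * hq -
    (A₁ * B₂ - B₁ * A₂) * Real.sin_sq_add_cos_sq (phase α E x)

lemma IsWKB.linear_combination {α E A₁ B₁ A₂ B₂ : ℝ} {u₁ v₁ u₂ v₂ : ℝ → ℝ}
    (h₁ : IsWKB α E A₁ B₁ u₁ v₁) (h₂ : IsWKB α E A₂ B₂ u₂ v₂) (c d : ℝ) :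
    IsWKB α E (c * A₁ + d * A₂) (c * B₁ + d * B₂) (fun x => c * u₁ x + d * u₂ x)
      (fun x => c * v₁ x + d * v₂ x) := by
  constructor
  · have := (h₁.fst.const_mul c).add (h₂.fst.const_mul d)
    simp only [mul_zero, add_zero] at this
    exact this.congr fun x => by ring
  · have := (h₁.snd.const_mul c).add (h₂.snd.const_mul d)
    simp only [mul_zero, add_zero] at this
    exact this.congr fun x => by ring

lemma IsSol.linear_combination {V : ℝ → ℝ} {a E : ℝ} {u₁ v₁ u₂ v₂ : ℝ → ℝ}
    (h₁ : IsSol V a E u₁ v₁) (h₂ : IsSol V a E u₂ v₂) (c d : ℝ) :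
    IsSol V a E (fun x => c * u₁ x + d * u₂ x) (fun x => c * v₁ x + d * v₂ x) :=
  ⟨fun x hx => ((h₁.fst x hx).const_mul c).fun_add ((h₂.fst x hx).const_mul d), fun x hx =>
    (((h₁.snd x hx).const_mul c).fun_add ((h₂.snd x hx).const_mul d)).congr_deriv (by ring)⟩

lemma hasBoundStates_zero {α : ℝ} (hα0 : 2 / 3 < α) (hα2 : α < 2) (a : ℝ) (s : ℕ → ℝ) :
    HasBoundStates α a 0 s (fun _ => 0) := by
  refine ⟨continuousOn_const, by simp, fun E _ A B => ?_, by simp⟩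
  have hp : Continuous fun x : ℝ => 0 - x ^ α - E := by
    have := Real.continuous_rpow_const (q := α) (by linarith)
    fun_prop
  obtain ⟨u₁, v₁, u₂, v₂, h₁, h₂, hW⟩ := exists_isSol hp a
  have key : ∀ {u v : ℝ → ℝ}, IsSol (fun x => 0 - x ^ α - E) a 0 u v →
      IsSol (fun x => 0 - x ^ α) a E u v := fun h =>
    ⟨h.fst, fun x hx => (h.snd x hx).congr_deriv (by ring)⟩
  obtain ⟨A₁, B₁, hw₁⟩ := exists_isWKB_free hα0 hα2 (key h₁)
  obtain ⟨A₂, B₂, hw₂⟩ := exists_isWKB_free hα0 hα2 (key h₂)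
  have hdet : A₁ * B₂ - B₁ * A₂ = 1 := by
    refine tendsto_nhds_unique (hw₁.tendsto_wronskian hw₂) (tendsto_const_nhds.congr' ?_)
    filter_upwards [eventually_gt_atTop a] with x hx
    exact (hW x hx).symm
  have e₁ : (A * B₂ - B * A₂) * A₁ + (B * A₁ - A * B₁) * A₂ = A := by
    linear_combination A * hdet
  have e₂ : (A * B₂ - B * A₂) * B₁ + (B * A₁ - A * B₁) * B₂ = B := by
    linear_combination B * hdet
  have hw := hw₁.linear_combination hw₂ (A * B₂ - B * A₂) (B * A₁ - A * B₁)
  rw [e₁, e₂] at hw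
  exact ⟨_, _, (key h₁).linear_combination (key h₂) _ _, hw⟩

lemma exists_hasBoundStates {α : ℝ} (hα0 : 2 / 3 < α) (hα2 : α < 2) {s : ℕ → ℝ}
    (hs : ∀ k, s k = 1 ∨ s k = -1) (n : ℕ) : ∃ a q, a < 0 ∧ HasBoundStates α a n s q := by
  induction n with
  | zero => exact ⟨-1, _, by norm_num, hasBoundStates_zero hα0 hα2 (-1) s⟩
  | succ n ih =>
    obtain ⟨a, q, ha, h⟩ := ih
    obtain ⟨q', h'⟩ := h.step (by linarith) hα2 (show a < a / 2 by linarith) (hs n)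
    exact ⟨a / 2, q', by linarith, h'⟩

lemma HasBoundStates.eq_zero_of_integrable {α a b E : ℝ} {n : ℕ} {q u v : ℝ → ℝ} {s : ℕ → ℝ}
    (hα0 : 0 < α) (hα2 : α < 2) (h : HasBoundStates α a n s q) (hab : a ≤ b)
    (hE : ∀ k < n, E ≠ (k : ℝ)) (hu : IsSol (fun x => q x - x ^ α) b E u v)
    (hsq : IntegrableAtFilter (fun x => u x ^ 2) atTop) {x : ℝ} (hx : b < x) : u x = 0 := by
  obtain ⟨u₁, v₁, h₁, hw₁⟩ := h.basis E hE 1 0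
  obtain ⟨u₂, v₂, h₂, hw₂⟩ := h.basis E hE 0 1
  replace h₁ := h₁.mono hab
  replace h₂ := h₂.mono hab
  have hconst : ∀ {f g f' g' : ℝ → ℝ}, IsSol (fun x => q x - x ^ α) b E f g →
      IsSol (fun x => q x - x ^ α) b E f' g' → ∀ y, b < y →
      f y * g' y - g y * f' y = f x * g' x - g x * f' x := fun hf hf' y hy =>
    constant_of_hasDerivAt_zero
      (fun z hz => (hasDerivAt_wronskian hf hf' hz).congr_deriv (by simp)) hy hx
  have hW : u₁ x * v₂ x - v₁ x * u₂ x = 1 := by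
    have hlim := hw₁.tendsto_wronskian hw₂
    rw [one_mul, zero_mul, sub_zero] at hlim
    refine tendsto_nhds_unique (tendsto_const_nhds.congr' ?_) hlim
    filter_upwards [eventually_gt_atTop b] with y hy
    exact (hconst h₁ h₂ y hy).symm
  set c := u x * v₂ x - v x * u₂ x with hc
  set d := u₁ x * v x - v₁ x * u x with hd
  have hrep : ∀ y, b < y → u y = c * u₁ y + d * u₂ y := fun y hy => by
    have k1 := hconst h₁ h₂ y hy
    rw [hW] at k1
    rw [hc, hd, ← hconst hu h₂ y hy, ← hconst h₁ hu y hy]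
    linear_combination -u y * k1
  have hw := hw₁.linear_combination hw₂ c d
  have h0 := hw.eq_zero_of_integrable hα0 hα2 (h.tendsto_zero hα2)
    (h₁.linear_combination h₂ c d) (by
      obtain ⟨S, hS, hSi⟩ := hsq
      refine ⟨S ∩ Ioi b, inter_mem hS (Ioi_mem_atTop b), ?_⟩
      have hIoi := hSi.mono_set (inter_subset_left (t := Ioi b))
      have hm : u =ᵐ[volume.restrict (S ∩ Ioi b)] fun y => c * u₁ y + d * u₂ y := by
        refine ae_restrict_of_ae_restrict_of_subset inter_subset_right
          ((ae_restrict_iff' measurableSet_Ioi).2 (ae_of_all _ hrep))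
      exact hIoi.congr (hm.mono fun y hy => by simp only [hy]))
  have hcd : c ^ 2 + d ^ 2 = 0 := by linear_combination h0
  have hc0 : c = 0 := by nlinarith
  have hd0 : d = 0 := by nlinarith
  rw [hrep x hx, hc0, hd0, zero_mul, zero_mul, add_zero]

lemma eleven_mul_sqrt_le {N : ℕ} (hN : 2 ≤ N) :
    11 * √(N : ℝ) ≤ 48 * √(N * Real.log N) := by
  have hlog : (1 / 2 : ℝ) ^ 2 ≤ Real.log N := by
    have h2 := Real.log_le_log two_pos (show (2 : ℝ) ≤ N by exact_mod_cast hN)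
    linarith [Real.log_two_gt_d9]
  have h := Real.le_sqrt_of_sq_le hlog
  rw [Real.sqrt_mul (Nat.cast_nonneg N)]
  nlinarith [Real.sqrt_nonneg (N : ℝ)]

lemma HasBoundStates.eventually_le {α a : ℝ} {N : ℕ} {q : ℝ → ℝ} {s : ℕ → ℝ} (hα2 : α < 2)
    (hN : 2 ≤ N) (h : HasBoundStates α a N s q)
    (hs : ∀ y t : ℝ, |∑ k ∈ Finset.range N, s k * Real.sin (y + k * t)| ≤ 5 * √N) :
    ∀ᶠ x in atTop, x ^ (1 - α / 2) * |q x| ≤ 48 * (2 - α) * √(N * Real.log N) := by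
  have hα : 0 < 2 - α := by linarith
  have hN0 : 0 < √(N : ℝ) := Real.sqrt_pos.2 (by exact_mod_cast (by omega : 0 < N))
  filter_upwards [Metric.tendsto_nhds.1 h.asymp ((2 - α) * √N) (by positivity),
    eventually_gt_atTop 0] with x hx hx0
  rw [dist_zero_right, Real.norm_eq_abs] at hx
  set S := ∑ k ∈ Finset.range N, s k * Real.sin (2 * phase α k x) with hS
  have hS' : |S| ≤ 5 * √N := by
    convert hs (2 * (x ^ (1 + α / 2) / (1 + α / 2))) (x ^ (1 - α / 2) / (1 - α / 2)) using 2
    refine Finset.sum_congr rfl fun k _ => ?_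
    rw [phase]
    ring_nf
  rw [← abs_of_pos (Real.rpow_pos_of_pos hx0 (1 - α / 2)), ← abs_mul]
  have h1 := abs_sub_abs_le_abs_sub (x ^ (1 - α / 2) * q x) (2 * (2 - α) * S)
  rw [abs_mul (2 * (2 - α)), abs_of_pos (by positivity : 0 < 2 * (2 - α))] at h1
  have h2 := mul_le_mul_of_nonneg_left hS' (by positivity : 0 ≤ 2 * (2 - α))
  have h3 := mul_le_mul_of_nonneg_left (eleven_mul_sqrt_le hN) hα.le
  linarith

/-- For `2/3 < α < 2` and any integer `N ≥ 2`, there is a continuous potential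
`q` on `(0,∞)` with `limsup_{x→∞} x^{1-α/2}|q x| ≤ 48 (2-α) √(N ln N)` such that the set `P`
of energies with a nonzero `L²(0,∞)` eigensolution has exactly `N` elements. -/
theorem stmt2 (α : ℝ) (hα0 : 2 / 3 < α) (hα2 : α < 2)
    (N : ℕ) (hN : 2 ≤ N) :
    ∃ q : ℝ → ℝ, ContinuousOn q (Ioi 0) ∧
      limsup (fun x : ℝ => ((x ^ (1 - α / 2) * |q x| : ℝ) : EReal)) atTop
        ≤ ((48 * (2 - α) * Real.sqrt (N * Real.log N) : ℝ) : EReal) ∧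
      ∀ P : Set ℝ,
        P = {E : ℝ | ∃ u u' u'' : ℝ → ℝ,
          (∃ x ∈ Ioi (0 : ℝ), u x ≠ 0) ∧
          (∀ x ∈ Ioi (0 : ℝ), HasDerivAt u (u' x) x) ∧
          (∀ x ∈ Ioi (0 : ℝ), HasDerivAt u' (u'' x) x) ∧
          (∀ x ∈ Ioi (0 : ℝ), -u'' x - x ^ α * u x + q x * u x = E * u x) ∧
          IntegrableOn (fun x => (u x) ^ 2) (Ioi 0)} →
        P.Finite ∧ P.ncard = N := by
  obtain ⟨s, hs, hflat⟩ := exists_flat_signs N (by omega)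
  obtain ⟨a, q, ha, h⟩ := exists_hasBoundStates hα0 hα2 hs N
  have hpos : 0 < α := by linarith
  refine ⟨q, h.cont.mono (Ioi_subset_Ioi ha.le), ?_, fun P hP => ?_⟩
  · refine limsup_le_of_le (h := ?_)
    filter_upwards [h.eventually_le hα2 hN hflat] with x hx
    exact EReal.coe_le_coe_iff.2 hx
  have hPeq : P = (fun k : ℕ => (k : ℝ)) '' (Finset.range N : Set ℕ) := by
    rw [hP]
    refine Subset.antisymm ?_ ?_
    · rintro E ⟨u, u', u'', ⟨x, hx, hne⟩, h1, h2, h3, h4⟩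
      by_contra hE
      refine hne (h.eq_zero_of_integrable hpos hα2 ha.le (E := E) (u := u) (v := u')
        (fun k hk hEk => hE ⟨k, by simpa using hk, hEk.symm⟩)
        ⟨fun y hy => h1 y hy, fun y hy => (h2 y hy).congr_deriv ?_⟩
        ⟨Ioi 0, Ioi_mem_atTop 0, h4⟩ hx)
      linear_combination -h3 y hy
    · rintro E ⟨k, hk, rfl⟩
      obtain ⟨u, v, hu, -, hne, hsq⟩ := h.bound k (by simpa using hk)
      refine ⟨u, v, _, ?_, fun x hx => hu.fst x (ha.trans hx), fun x hx => hu.snd x (ha.trans hx),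
        fun x _ => by ring, ?_⟩
      · obtain ⟨x, hx1, hx2⟩ := (hne.and_eventually (eventually_gt_atTop 0)).exists
        exact ⟨x, hx2, hx1⟩
      · have hloc : LocallyIntegrableOn (fun x => u x ^ 2) (Ici 0) :=
          ((hu.continuousOn.pow 2).mono fun x hx => ha.trans_le hx).locallyIntegrableOn
            measurableSet_Ici
        exact (integrableOn_Ici_iff_integrableAtFilter_atTop.2 ⟨hsq, hloc⟩).mono_set
          Ioi_subset_Ici_self
  rw [hPeq]
  refine ⟨(Finset.finite_toSet _).image _, ?_⟩
  rw [ncard_image_of_injective _ Nat.cast_injective, ncard_coe_finset, Finset.card_range]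
end
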